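/- Let n ≥ 3 and let z_1, …, z_n be distinct points of ℂ. Let Γ and Γ̂ be two C¹-smooth Jordan curves in ℂ, each passing through z_1, …, z_n, which are isotopic relative to z_1, …, z_n. If both Γ and Γ̂ are piecewise geodesic with respect to z_1, …, z_n, then Γ = Γ̂ (as subsets of ℂ). -/

import Mathlib

open Set Complex

/-- A parametrization of a Jordan curve in `ℂ`: a continuous `2π`-periodic map that is
injective on a fundamental period (equivalently, a continuous injective map of the unit
circle `S¹` into `ℂ`). -/
structure JordanParam (γ : ℝ → ℂ) : Prop where
  continuous : Continuous γ
  periodic : Function.Periodic γ (2 * Real.pi)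
  injOn : ∀ s ∈ Set.Ico (0 : ℝ) (2 * Real.pi), ∀ t ∈ Set.Ico (0 : ℝ) (2 * Real.pi),
    γ s = γ t → s = t

/-- `Γ` is a `C¹`-smooth Jordan curve: it admits an injective parametrization which is
continuously differentiable with nowhere-vanishing derivative. -/
def IsC1JordanCurve (Γ : Set ℂ) : Prop :=
  ∃ γ : ℝ → ℂ, JordanParam γ ∧ ContDiff ℝ 1 γ ∧ (∀ t : ℝ, deriv γ t ≠ 0) ∧ Γ = Set.range γ

/-- The arc `A ⊆ Γ` is a hyperbolic geodesic in the domain `(ℂ̂ ∖ Γ) ∪ A` on the Riemann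
sphere: for some point `p ∈ Γ ∖ closure A`, setting `ι(w) = 1/(w - p)` (so that
`ι(∞) = 0`) and `E = ι((ℂ ∖ Γ) ∪ A) ∪ {0}`, there is a holomorphic bijection from the
strip `{z : |Im z| < 1}` onto `E` sending `ℝ` onto `ι(A)`. -/
def IsHypGeodesicArc (Γ A : Set ℂ) : Prop :=
  ∃ p ∈ Γ, p ∉ closure A ∧
    ∃ f : ℂ → ℂ,
      DifferentiableOn ℂ f {z : ℂ | |z.im| < 1} ∧
      Set.BijOn f {z : ℂ | |z.im| < 1}
        ((fun w => 1 / (w - p)) '' (Γᶜ ∪ A) ∪ {0}) ∧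
      f '' {z : ℂ | z.im = 0} = (fun w => 1 / (w - p)) '' A

/-- `Γ` is piecewise geodesic with respect to the set of points `Z ⊆ Γ`: every connected
component of `Γ ∖ Z` (i.e. every open arc determined by the points of `Z`) is a
hyperbolic geodesic in the corresponding domain. -/
def PiecewiseGeodesic (Γ Z : Set ℂ) : Prop :=
  ∀ x ∈ Γ \ Z, IsHypGeodesicArc Γ (connectedComponentIn (Γ \ Z) x)

/-- The Jordan curves `Γ₀` and `Γ₁` are isotopic relative to the point set `Z`: there is
a continuous family of Jordan curves through `Z` joining `Γ₀` to `Γ₁`. -/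
def IsotopicRel (Γ₀ Γ₁ Z : Set ℂ) : Prop :=
  ∃ H : ℝ → ℝ → ℂ,
    ContinuousOn (fun p : ℝ × ℝ => H p.1 p.2) (Set.Icc (0 : ℝ) 1 ×ˢ (Set.univ : Set ℝ)) ∧
    (∀ t ∈ Set.Icc (0 : ℝ) 1, Function.Periodic (H t) (2 * Real.pi) ∧
      ∀ s ∈ Set.Ico (0 : ℝ) (2 * Real.pi), ∀ u ∈ Set.Ico (0 : ℝ) (2 * Real.pi),
        H t s = H t u → s = u) ∧
    Set.range (H 0) = Γ₀ ∧ Set.range (H 1) = Γ₁ ∧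
    (∀ t ∈ Set.Icc (0 : ℝ) 1, Z ⊆ Set.range (H t))

/-! Part A: words -/

namespace PG

variable {n : ℕ}

/-- A word is reduced. -/
def Red (w : List (Fin n)) : Prop := w.IsChain (· ≠ ·)

/-- toggle a letter at the head -/
def Lt (l : Fin n) : List (Fin n) → List (Fin n)
  | [] => [l]
  | a :: t => if a = l then t else l :: a :: t

/-- toggle a letter at the end -/
def Rt (k : Fin n) (w : List (Fin n)) : List (Fin n) := (Lt k w.reverse).reverse

lemma Red.reverse {w : List (Fin n)} (h : Red w) : Red w.reverse := by
  unfold Red at *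
  rw [List.isChain_reverse]
  exact h.imp (fun a b hab => by simpa [flip] using hab.symm)

lemma Lt_red (l : Fin n) {w : List (Fin n)} (h : Red w) : Red (Lt l w) := by
  cases w with
  | nil => simp [Lt, Red]
  | cons a t =>
    simp only [Lt]
    split_ifs with hal
    · exact List.IsChain.tail h
    · exact List.IsChain.cons_cons (Ne.symm hal) h

lemma Rt_red (k : Fin n) {w : List (Fin n)} (h : Red w) : Red (Rt k w) :=
  (Lt_red k h.reverse).reverse

lemma Lt_invol (l : Fin n) {w : List (Fin n)} (h : Red w) : Lt l (Lt l w) = w := by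
  cases w with
  | nil => simp [Lt]
  | cons a t =>
    by_cases hal : a = l
    · subst hal
      cases t with
      | nil => simp [Lt]
      | cons b s =>
        have : a ≠ b := by
          unfold Red at h
          rw [List.isChain_cons_cons] at h
          exact h.1
        simp [Lt, this.symm]
    · simp [Lt, hal]

lemma Rt_invol (k : Fin n) {w : List (Fin n)} (h : Red w) : Rt k (Rt k w) = w := by
  unfold Rt
  rw [List.reverse_reverse, Lt_invol k h.reverse, List.reverse_reverse]

lemma Lt_reverse (l : Fin n) (w : List (Fin n)) : (Lt l w).reverse = Rt l w.reverse := by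
  simp [Rt]

lemma Rt_reverse (l : Fin n) (w : List (Fin n)) : (Rt l w).reverse = Lt l w.reverse := by
  simp [Rt]

lemma Rt_nil (k : Fin n) : Rt k [] = [k] := by simp [Rt, Lt]

lemma Rt_concat (k b : Fin n) (t : List (Fin n)) :
    Rt k (t ++ [b]) = if b = k then t else t ++ [b] ++ [k] := by
  unfold Rt
  rw [List.reverse_append]
  simp only [List.reverse_cons, List.reverse_nil, List.nil_append, List.cons_append, Lt]
  split_ifs <;> simp

lemma Lt_cons (l a : Fin n) (t : List (Fin n)) :
    Lt l (a :: t) = if a = l then t else l :: a :: t := rfl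

lemma Lt_append (l : Fin n) {w : List (Fin n)} (hw : w ≠ []) (v : List (Fin n)) :
    Lt l (w ++ v) = Lt l w ++ v := by
  cases w with
  | nil => exact absurd rfl hw
  | cons a t => simp only [List.cons_append, Lt]; split_ifs <;> simp

lemma Lt_Rt_comm (l k : Fin n) (w : List (Fin n)) : Lt l (Rt k w) = Rt k (Lt l w) := by
  induction w using List.bidirectionalRec with
  | nil => 
    rw [Rt_nil]; show Lt l [k] = Rt k ([] ++ [l]); rw [Rt_concat, Lt_cons]
    by_cases h : k = l
    · simp [h]
    · simp [h, Ne.symm h]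
  | singleton a => 
    have h1 : Rt k [a] = if a = k then [] else [a, k] := Rt_concat k a []
    rw [h1, Lt_cons]
    by_cases h : a = k <;> by_cases h' : a = l
    · subst h; subst h'; simp [Lt, Rt]
    · subst h
      simp only [if_true, if_neg h']
      rw [show [l, a] = [l] ++ [a] from rfl, Rt_concat]; simp [Lt]
    · subst h'
      simp only [if_true, if_neg h]
      rw [Lt_cons, Rt_nil]; simp
    · simp only [if_neg h, if_neg h']
      rw [show [l, a] = [l] ++ [a] from rfl, Rt_concat, if_neg h, Lt_cons, if_neg h']; simp
  | cons_append a t b _ => 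
    rw [Lt_append l (by simp : a :: t ≠ []) [b]|> fun h => (show Lt l (a :: (t ++ [b])) = Lt l (a :: t) ++ [b] from h)]
    rw [Rt_concat, show a :: (t ++ [b]) = (a :: t) ++ [b] from rfl, Rt_concat]
    split_ifs with h
    · rfl
    · rw [List.append_assoc, Lt_append l (by simp), List.append_assoc]

/-- the potential -/
noncomputable def Phi (a b : Fin n → ℝ) (w : List (Fin n)) : ℝ :=
  if h : w = [] then ‖a - b‖ else ((w.length : ℝ) - 1) + b (w.head h) + a (w.getLast h)

lemma Phi_nil (a b : Fin n → ℝ) : Phi a b [] = ‖a - b‖ := by simp [Phi]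

lemma Phi_ne (a b : Fin n → ℝ) {w : List (Fin n)} (h : w ≠ []) :
    Phi a b w = ((w.length : ℝ) - 1) + b (w.head h) + a (w.getLast h) := by simp [Phi, h]

lemma Phi_reverse (a b : Fin n → ℝ) (w : List (Fin n)) : Phi b a w.reverse = Phi a b w := by
  by_cases h : w = []
  · subst h; simp [Phi, norm_sub_rev]
  · have h' : w.reverse ≠ [] := by simpa using h
    rw [Phi_ne _ _ h, Phi_ne _ _ h', List.head_reverse, List.getLast_reverse, List.length_reverse]
    ring

/-- admissible angle vectors -/
structure Ang (a : Fin n → ℝ) : Prop where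
  nonneg : ∀ i, 0 ≤ a i
  le_one : ∀ i, a i ≤ 1
  add : ∀ i j, i ≠ j → 1 ≤ a i + a j

lemma abs_le_nrm (a b : Fin n → ℝ) (k : Fin n) : |a k - b k| ≤ ‖a - b‖ := by
  have := norm_le_pi_norm (a - b) k
  simpa using this

lemma Phi_nonneg {a b : Fin n → ℝ} (ha : Ang a) (hb : Ang b) (w : List (Fin n)) :
    0 ≤ Phi a b w := by
  by_cases h : w = []
  · subst h; rw [Phi_nil]; positivity
  · rw [Phi_ne _ _ h]
    have h1 : 1 ≤ w.length := List.length_pos_iff.mpr h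
    have h1' : (1:ℝ) ≤ w.length := by exact_mod_cast h1
    have := hb.nonneg (w.head h)
    have := ha.nonneg (w.getLast h)
    linarith

lemma Phi_le {a b : Fin n → ℝ} (ha : Ang a) (hb : Ang b) (w : List (Fin n)) :
    Phi a b w ≤ w.length + 1 := by
  by_cases h : w = []
  · subst h; rw [Phi_nil]
    simp only [List.length_nil, Nat.cast_zero, zero_add]
    rw [pi_norm_le_iff_of_nonneg zero_le_one]
    intro i
    rw [Real.norm_eq_abs, Pi.sub_apply, abs_le]
    constructor <;> linarith [ha.nonneg i, ha.le_one i, hb.nonneg i, hb.le_one i]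
  · rw [Phi_ne _ _ h]
    linarith [hb.le_one (w.head h), ha.le_one (w.getLast h)]

/-- basic lower bound of the potential -/
lemma abs_sub_le_Phi {a b : Fin n → ℝ} (ha : Ang a) (hb : Ang b) (w : List (Fin n)) (k : Fin n) :
    |a k - b k| ≤ Phi a b w := by
  by_cases h : w = []
  · subst h; rw [Phi_nil]; exact abs_le_nrm a b k
  · rw [Phi_ne _ _ h]
    have h1 : 1 ≤ w.length := List.length_pos_iff.mpr h
    rcases Nat.lt_or_ge 1 w.length with h2 | h2
    · have h1' : (2:ℝ) ≤ w.length := by exact_mod_cast h2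
      have := hb.nonneg (w.head h)
      have := ha.nonneg (w.getLast h)
      rw [abs_le]
      constructor <;> linarith [ha.nonneg k, ha.le_one k, hb.nonneg k, hb.le_one k]
    · have h3 : w.length = 1 := le_antisymm h2 h1
      obtain ⟨j, rfl⟩ := List.length_eq_one_iff.mp h3
      simp only [List.length_singleton, Nat.cast_one, sub_self, zero_add, List.head_cons,
        List.getLast_singleton]
      by_cases hjk : k = j
      · subst hjk
        rw [abs_le]
        constructor <;> linarith [ha.nonneg k, hb.nonneg k]
      · rw [abs_le]
        constructor <;> linarith [ha.add k j hjk, hb.add k j hjk, ha.nonneg j, hb.nonneg j, ha.le_one k, hb.le_one k]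

lemma Phi_concat (a b : Fin n → ℝ) (u : List (Fin n)) (k : Fin n) :
    Phi a b (u ++ [k]) = u.length + b ((u ++ [k]).head (by simp)) + a k := by
  rw [Phi_ne _ _ (by simp)]; simp

lemma Phi_B1 {a b : Fin n → ℝ} (ha : Ang a) (u : List (Fin n)) (k : Fin n)
    (hu : ∀ h : u ≠ [], u.getLast h ≠ k) :
    u.length + b ((u ++ [k]).head (by simp)) - a k ≤ Phi a b u := by
  by_cases h : u = []
  · subst h; rw [Phi_nil]; simp
    have := abs_le_nrm a b k
    rw [abs_le] at this; linarith
  · rw [Phi_ne _ _ h, List.head_append_of_ne_nil h]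
    linarith [ha.add _ _ (hu h)]

lemma Rt_not_last (u : List (Fin n)) (k : Fin n) (hu : ∀ h : u ≠ [], u.getLast h ≠ k) :
    Rt k u = u ++ [k] := by
  by_cases h : u = []
  · subst h; simp [Rt_nil]
  · conv_lhs => rw [← List.dropLast_append_getLast h]
    rw [Rt_concat, if_neg (hu h), List.dropLast_append_getLast h]

lemma Lt_not_head (u : List (Fin n)) (k : Fin n) (hu : ∀ h : u ≠ [], u.head h ≠ k) :
    Lt k u = k :: u := by
  cases u with
  | nil => rfl
  | cons c t => rw [Lt_cons, if_neg]; simpa using hu (by simp)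

lemma Phi_A_aux {a b : Fin n → ℝ} (ha : Ang a) (hb : Ang b) (k : Fin n) (h0 : a k = 0)
    (h1 : ∀ j, j ≠ k → a j = 1) (u : List (Fin n)) (hu : ∀ h : u ≠ [], u.getLast h ≠ k) :
    Phi a b (u ++ [k]) = Phi a b u := by
  rw [Phi_concat]
  by_cases h : u = []
  · subst h
    rw [Phi_nil]; simp [h0]
    apply le_antisymm
    · have := abs_le_nrm a b k
      rw [h0, abs_le] at this; linarith
    · rw [pi_norm_le_iff_of_nonneg (hb.nonneg k)]
      intro i
      rw [Real.norm_eq_abs, Pi.sub_apply]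
      by_cases hik : i = k
      · subst hik; rw [h0, zero_sub, abs_neg, abs_of_nonneg (hb.nonneg i)]
      · rw [h1 i hik, abs_of_nonneg (by linarith [hb.le_one i])]
        linarith [hb.add i k hik]
  · rw [Phi_ne _ _ h, List.head_append_of_ne_nil h, h0, h1 _ (hu h)]; ring

/-- Either `u` does not end with `k` or `Rt k u` does not. -/
lemma Rt_cases (k : Fin n) {u : List (Fin n)} (hr : Red u) :
    (∀ h : u ≠ [], u.getLast h ≠ k) ∨ (∀ h : Rt k u ≠ [], (Rt k u).getLast h ≠ k) := by
  by_contra hcon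
  push Not at hcon
  obtain ⟨⟨h1, h2⟩, ⟨h3, h4⟩⟩ := hcon
  have e : u = u.dropLast ++ [k] := by
    conv_lhs => rw [← List.dropLast_append_getLast h1, h2]
  have e2 : Rt k u = u.dropLast := by
    conv_lhs => rw [e]
    rw [Rt_concat, if_pos rfl]
  set v := u.dropLast with hv
  have h5 : v ≠ [] := by rw [← e2]; exact h3
  have h6 : v.getLast h5 = k := by simp only [e2] at h4; exact h4
  have e3 : u = v.dropLast ++ [k, k] := by
    have : v = v.dropLast ++ [k] := by
      conv_lhs => rw [← List.dropLast_append_getLast h5, h6]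
    rw [e]; conv_lhs => rw [this]
    simp
  unfold Red at hr
  rw [e3, List.isChain_append] at hr
  simp at hr

lemma Phi_A {a b : Fin n → ℝ} (ha : Ang a) (hb : Ang b) (k : Fin n) (h0 : a k = 0)
    (h1 : ∀ j, j ≠ k → a j = 1) {u : List (Fin n)} (hr : Red u) :
    Phi a b (Rt k u) = Phi a b u := by
  rcases Rt_cases k hr with h | h
  · rw [Rt_not_last u k h, Phi_A_aux ha hb k h0 h1 u h]
  · have := Phi_A_aux ha hb k h0 h1 (Rt k u) h
    rw [← this, ← Rt_not_last _ k h, Rt_invol k hr]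

lemma Phi_A' {a b : Fin n → ℝ} (ha : Ang a) (hb : Ang b) (l : Fin n) (h0 : b l = 0)
    (h1 : ∀ j, j ≠ l → b j = 1) {u : List (Fin n)} (hr : Red u) :
    Phi a b (Lt l u) = Phi a b u := by
  rw [← Phi_reverse a b (Lt l u), Lt_reverse, Phi_A hb ha l h0 h1 hr.reverse, Phi_reverse]

lemma Phi_B1' {a b : Fin n → ℝ} (hb : Ang b) (u : List (Fin n)) (l : Fin n)
    (hu : ∀ h : u ≠ [], u.head h ≠ l) :
    u.length + a ((l :: u).getLast (by simp)) - b l ≤ Phi a b u := by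
  by_cases h : u = []
  · subst h; rw [Phi_nil]; simp
    have := abs_le_nrm a b l
    rw [abs_le] at this; linarith
  · rw [Phi_ne _ _ h, List.getLast_cons h]
    linarith [hb.add _ _ (hu h)]

/-- The four corner inequalities. -/
lemma Phi_B2 {a b : Fin n → ℝ} (ha : Ang a) (hb : Ang b) (u : List (Fin n)) (k l : Fin n)
    (hu : ∀ h : u ≠ [], u.getLast h ≠ k) (hu' : ∀ h : u ≠ [], u.head h ≠ l)
    (hkl : u = [] → k ≠ l) :
    (u.length + 1 + b l + a k = Phi a b (Lt l (Rt k u))) ∧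
    (u.length + 1 + b l - a k ≤ Phi a b (Lt l u)) ∧
    (u.length + 1 - b l + a k ≤ Phi a b (Rt k u)) ∧
    (u.length + 1 - b l - a k ≤ Phi a b u) := by
  by_cases h : u = []
  · subst h
    have hkl := hkl rfl
    rw [Rt_nil, Lt_cons, if_neg hkl, Phi_nil]
    have e : Lt l ([] : List (Fin n)) = [l] := rfl
    rw [e, Phi_ne _ _ (by simp), Phi_ne _ _ (by simp), Phi_ne _ _ (by simp)]
    simp
    have := abs_le_nrm a b l
    rw [abs_le] at this
    refine ⟨?_, ?_, ?_, ?_⟩ <;> linarith [ha.add k l hkl, hb.add k l hkl, this.2]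
  · have hR := Rt_not_last u k hu
    have hL := Lt_not_head u l hu'
    have hLR : Lt l (Rt k u) = l :: (u ++ [k]) := by
      rw [hR, Lt_append l h, hL]; rfl
    rw [hLR, hR, hL, Phi_ne _ _ (by simp), Phi_ne _ _ (by simp), Phi_ne _ _ (by simp), Phi_ne _ _ h]
    have i1 := ha.add _ _ (hu h)
    have i2 := hb.add _ _ (hu' h)
    refine ⟨?_, ?_, ?_, ?_⟩
    · simp
    all_goals
      try simp only [List.length_cons, List.length_append, List.length_nil, List.head_cons,
        List.head_append_of_ne_nil h, List.getLast_cons h, List.getLast_append_singleton,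
        Nat.cast_add, Nat.cast_one, Nat.cast_zero]
      linarith

end PG

/-! Part B: maximum principle -/

namespace PG
open Filter Topology

/-- local harmonic support from below -/
def Supp (V : ℂ → ℝ) (p : ℂ) : Prop :=
  ∃ G : ℂ → ℂ, AnalyticAt ℂ G p ∧ V p = (G p).re ∧ ∀ᶠ q in 𝓝 p, (G q).re ≤ V q

lemma eventually_const_of_re_le {G : ℂ → ℂ} {p : ℂ} (hG : AnalyticAt ℂ G p)
    (h : ∀ᶠ q in 𝓝 p, (G q).re ≤ (G p).re) : ∀ᶠ q in 𝓝 p, G q = G p := by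
  rcases hG.eventually_constant_or_nhds_le_map_nhds with h1 | h1
  · exact h1
  · exfalso
    have h2 : {w : ℂ | w.re ≤ (G p).re} ∈ 𝓝 (G p) := h1 (mem_map.mpr h)
    rw [Metric.mem_nhds_iff] at h2
    obtain ⟨ε, hε, hb⟩ := h2
    have h3 : G p + ((ε / 2 : ℝ) : ℂ) ∈ Metric.ball (G p) ε := by
      rw [Metric.mem_ball, dist_eq_norm, add_sub_cancel_left, Complex.norm_real, Real.norm_eq_abs,
        abs_of_pos (by linarith)]
      linarith
    have h4 := hb h3
    simp only [mem_ofPred_eq, add_re, ofReal_re] at h4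
    linarith

/-- at a local max, a supported function is locally constant -/
lemma Supp.eventually_eq {V : ℂ → ℝ} {p : ℂ} (h : Supp V p) (hm : ∀ᶠ q in 𝓝 p, V q ≤ V p) :
    ∀ᶠ q in 𝓝 p, V q = V p := by
  obtain ⟨G, hG, e, hle⟩ := h
  have h1 : ∀ᶠ q in 𝓝 p, (G q).re ≤ (G p).re := by
    filter_upwards [hm, hle] with q a b
    rw [← e]; exact b.trans a
  filter_upwards [eventually_const_of_re_le hG h1, hm, hle] with q a b c
  apply le_antisymm b
  rw [e, ← a]; exact c

lemma Supp.add {V : ℂ → ℝ} {p : ℂ} (h : Supp V p) {f : ℂ → ℝ} {F : ℂ → ℂ}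
    (hF : AnalyticAt ℂ F p) (hf : ∀ᶠ q in 𝓝 p, f q = (F q).re) : Supp (fun q => V q + f q) p := by
  obtain ⟨G, hG, e, hle⟩ := h
  refine ⟨fun q => G q + F q, hG.add hF, ?_, ?_⟩
  · simp [e, hf.self_of_nhds]
  · filter_upwards [hle, hf] with q a b
    simp only [add_re, b]; linarith

lemma superlevel_false {U : Set ℂ} (hU : IsOpen U) {W : ℂ → ℝ} (hW : ContinuousOn W U)
    (hs : ∀ p ∈ U, Supp W p) (m : ℝ) (hc : IsCompact {z | z ∈ U ∧ m ≤ W z})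
    (hne : {z | z ∈ U ∧ m ≤ W z}.Nonempty) : False := by
  obtain ⟨z0, ⟨hz0, hmz⟩, hmax⟩ := hc.exists_isMaxOn hne (hW.mono fun z hz => hz.1)
  have hmaxU : ∀ z ∈ U, W z ≤ W z0 := by
    intro z hz
    rcases le_or_gt m (W z) with h | h
    · exact hmax ⟨hz, h⟩
    · linarith
  set M := {z | z ∈ U ∧ W z = W z0} with hM
  have hMopen : IsOpen M := by
    rw [isOpen_iff_mem_nhds]
    rintro z ⟨hz, e⟩
    have h1 : ∀ᶠ q in 𝓝 z, q ∈ U := hU.mem_nhds hz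
    have h2 : ∀ᶠ q in 𝓝 z, W q ≤ W z := by
      filter_upwards [h1] with q hq
      rw [e]; exact hmaxU q hq
    filter_upwards [h1, (hs z hz).eventually_eq h2] with q a b
    exact ⟨a, b.trans e⟩
  have hMc : IsCompact M := by
    have : M = {z | z ∈ U ∧ m ≤ W z} ∩ W ⁻¹' {W z0} := by
      ext z
      simp only [hM, mem_ofPred_eq, mem_inter_iff, mem_preimage, mem_singleton_iff]
      constructor
      · rintro ⟨a, b⟩; exact ⟨⟨a, by rw [b]; exact hmz⟩, b⟩
      · rintro ⟨⟨a, _⟩, b⟩; exact ⟨a, b⟩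
    rw [this]
    have := (hW.mono (fun z (hz : z ∈ {z | z ∈ U ∧ m ≤ W z}) => hz.1)).preimage_isClosed_of_isClosed
      hc.isClosed (isClosed_singleton (x := W z0))
    exact hc.of_isClosed_subset this inter_subset_left
  have huniv : M = univ := by
    have h := isClopen_iff.mp (⟨hMc.isClosed, hMopen⟩ : IsClopen M)
    rcases h with h | h
    · exact absurd (show z0 ∈ M from ⟨hz0, rfl⟩) (by rw [h]; simp)
    · exact h
  rw [huniv] at hMc
  exact noncompact_univ ℂ hMc

lemma log_norm_local {g : ℂ → ℂ} {p : ℂ} (hg : AnalyticAt ℂ g p) (h0 : g p ≠ 0) :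
    ∃ F : ℂ → ℂ, AnalyticAt ℂ F p ∧ ∀ᶠ q in 𝓝 p, Real.log ‖g q‖ = (F q).re := by
  refine ⟨fun q => Complex.log (g q / g p) + Real.log ‖g p‖, ?_, ?_⟩
  · apply AnalyticAt.add _ analyticAt_const
    apply AnalyticAt.clog
    · exact hg.div analyticAt_const h0
    · rw [div_self h0]; exact one_mem_slitPlane
  · have : ∀ᶠ q in 𝓝 p, g q ≠ 0 := hg.continuousAt.eventually_ne h0
    filter_upwards [this] with q hq
    rw [add_re, Complex.log_re, ofReal_re, norm_div, Real.log_div]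
    · ring
    · simpa using hq
    · simpa using h0

theorem maxPrinciple {Z : Set ℂ} (hZ : Z.Finite) {V : ℂ → ℝ} (hV : ContinuousOn V Zᶜ)
    {M : ℝ} (hM : ∀ z ∉ Z, V z ≤ M) (hs : ∀ z ∉ Z, Supp V z) : ∃ c, ∀ z ∉ Z, V z = c := by
  have hZo : IsOpen Zᶜ := hZ.isClosed.isOpen_compl
  have hconn : IsConnected Zᶜ := hZ.countable.isConnected_compl_of_one_lt_rank (by simp)
  obtain ⟨p0, hp0⟩ := hconn.nonempty
  obtain ⟨r, hr, hball⟩ := Metric.nhds_basis_closedBall.mem_iff.mp (hZo.mem_nhds hp0)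
  obtain ⟨p1, hp1, hmax⟩ := (isCompact_closedBall p0 r).exists_isMaxOn
    ⟨p0, Metric.mem_closedBall_self hr.le⟩ (hV.mono hball)
  have key : ∀ z ∉ Z, V z ≤ V p1 := by
    intro q0 hq0
    by_contra hlt
    push Not at hlt
    have hq0r : r < dist q0 p0 := by
      by_contra h
      push Not at h
      have := hmax (show q0 ∈ Metric.closedBall p0 r from h)
      simp only [mem_ofPred_eq] at this
      linarith
    let D : ℂ → ℝ := fun w => 1 + ‖p0 - w‖ / r
    have hD : ∀ w, 0 < D w := fun w => by positivity
    let g : ℂ → ℂ := fun z => (∏ w ∈ hZ.toFinset, ((z - w) / ((D w : ℂ) * (z - p0)))) * (r / (z - p0))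
    have hnz : ∀ z, r ≤ dist z p0 → z - p0 ≠ 0 := by
      intro z hz h
      rw [dist_eq_norm, h, norm_zero] at hz; linarith
    have hgan : ∀ z, r ≤ dist z p0 → AnalyticAt ℂ g z := by
      intro z hz
      apply AnalyticAt.mul
      · apply Finset.analyticAt_fun_prod
        intro w _
        apply AnalyticAt.div (by fun_prop) (by fun_prop)
        exact mul_ne_zero (by exact_mod_cast (hD w).ne') (hnz z hz)
      · exact AnalyticAt.div (by fun_prop) (by fun_prop) (hnz z hz)
    have hgle' : ∀ z, r ≤ dist z p0 → ‖∏ w ∈ hZ.toFinset, ((z - w) / ((D w : ℂ) * (z - p0)))‖ ≤ 1 := by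
      intro z hz
      rw [norm_prod]
      apply Finset.prod_le_one (fun _ _ => norm_nonneg _)
      intro w _
      have hpos : 0 < ‖z - p0‖ := norm_pos_iff.mpr (hnz z hz)
      rw [norm_div, norm_mul, Complex.norm_real, Real.norm_eq_abs, abs_of_pos (hD w),
        div_le_one (mul_pos (hD w) hpos)]
      have h1 : ‖z - w‖ ≤ ‖z - p0‖ + ‖p0 - w‖ := by
        have := norm_add_le (z - p0) (p0 - w); simpa using this
      have h2 : ‖p0 - w‖ ≤ ‖p0 - w‖ / r * ‖z - p0‖ := by
        rw [div_mul_eq_mul_div, le_div_iff₀ hr]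
        rw [dist_eq_norm] at hz
        exact mul_le_mul_of_nonneg_left hz (norm_nonneg _)
      have : D w * ‖z - p0‖ = ‖z - p0‖ + ‖p0 - w‖ / r * ‖z - p0‖ := by simp only [D]; ring
      linarith
    have hgle : ∀ z, r ≤ dist z p0 → ‖g z‖ ≤ r / dist z p0 := by
      intro z hz
      simp only [g]
      rw [norm_mul, norm_div, Complex.norm_real, Real.norm_eq_abs, abs_of_pos hr, ← dist_eq_norm]
      have : 0 ≤ r / dist z p0 := by positivity
      calc _ ≤ 1 * (r / dist z p0) := mul_le_mul_of_nonneg_right (hgle' z hz) this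
        _ = _ := one_mul _
    have hgle1 : ∀ z, r ≤ dist z p0 → ‖g z‖ ≤ 1 := by
      intro z hz
      refine (hgle z hz).trans ?_
      rw [div_le_one (by linarith)]; exact hz
    have hgne : ∀ z, r ≤ dist z p0 → z ∉ Z → g z ≠ 0 := by
      intro z hz hzZ
      apply mul_ne_zero
      · rw [Finset.prod_ne_zero_iff]
        intro w hw
        apply div_ne_zero
        · rw [sub_ne_zero]; rintro rfl; exact hzZ (hZ.mem_toFinset.mp hw)
        · exact mul_ne_zero (by exact_mod_cast (hD w).ne') (hnz z hz)
      · exact div_ne_zero (by exact_mod_cast hr.ne') (hnz z hz)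
    have hgz : ∀ z, z ∈ Z → g z = 0 := by
      intro z hzZ
      simp only [g]
      rw [Finset.prod_eq_zero (hZ.mem_toFinset.mpr hzZ), zero_mul]
      simp
    let h : ℂ → ℝ := fun z => Real.log ‖g z‖
    have hh0 : ∀ z, r ≤ dist z p0 → h z ≤ 0 := fun z hz =>
      Real.log_nonpos (norm_nonneg _) (hgle1 z hz)
    obtain ⟨ε, hε, hε1⟩ : ∃ ε > 0, V p1 < V q0 + ε * h q0 := by
      have hq := hh0 q0 hq0r.le
      refine ⟨(V q0 - V p1) / (2 * (1 - h q0)), div_pos (by linarith) (by linarith), ?_⟩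
      have : (V q0 - V p1) / (2 * (1 - h q0)) * (1 - h q0) = (V q0 - V p1) / 2 := by
        have : 1 - h q0 ≠ 0 := by linarith
        field_simp
      have h3 : 0 < (V q0 - V p1) / (2 * (1 - h q0)) := div_pos (by linarith) (by linarith)
      nlinarith
    set m := V q0 + ε * h q0 with hm
    let W : ℂ → ℝ := fun z => V z + ε * h z
    let U : Set ℂ := {z | r < dist z p0} ∩ Zᶜ
    have hUo : IsOpen U := (isOpen_lt continuous_const (by fun_prop)).inter hZo
    set κ := Real.exp ((m - M) / ε) with hκ
    have hκpos : 0 < κ := Real.exp_pos _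
    let T : Set ℂ := {z | r ≤ dist z p0} ∩ (fun z => ‖g z‖) ⁻¹' (Ici κ)
    have hTc : IsClosed T := by
      apply ContinuousOn.preimage_isClosed_of_isClosed _ _ isClosed_Ici
      · exact fun z hz => ((hgan z hz).continuousAt.norm).continuousWithinAt
      · exact isClosed_le continuous_const (by fun_prop)
    have hTb : T ⊆ Metric.closedBall p0 (r / κ) := by
      rintro z ⟨hz, hz2⟩
      rw [Metric.mem_closedBall]
      have h1 : κ ≤ r / dist z p0 := le_trans hz2 (hgle z hz)
      have h2 : 0 < dist z p0 := lt_of_lt_of_le hr hz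
      rw [le_div_iff₀ h2] at h1
      rw [le_div_iff₀ hκpos]; linarith
    have hTcomp : IsCompact T := (isCompact_closedBall _ _).of_isClosed_subset hTc hTb
    have hTZ : ∀ z ∈ T, z ∉ Z := by
      rintro z ⟨_, hz2⟩ hzZ
      simp only [mem_preimage, mem_Ici, hgz z hzZ, norm_zero] at hz2
      linarith
    have hWc : ∀ z, r ≤ dist z p0 → z ∉ Z → ContinuousAt W z := by
      intro z hz hzZ
      apply ContinuousAt.add ((hV z hzZ).continuousAt (hZo.mem_nhds hzZ))
      apply ContinuousAt.mul continuousAt_const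
      apply ContinuousAt.log (hgan z hz).continuousAt.norm
      simpa using hgne z hz hzZ
    have hS : {z | z ∈ U ∧ m ≤ W z} = T ∩ W ⁻¹' (Ici m) := by
      ext z
      constructor
      · rintro ⟨⟨hz1, hz2⟩, hz3⟩
        refine ⟨⟨show r ≤ dist z p0 from le_of_lt hz1, ?_⟩, hz3⟩
        simp only [mem_preimage, mem_Ici]
        have h1 : 0 < ‖g z‖ := norm_pos_iff.mpr (hgne z (le_of_lt hz1) hz2)
        rw [hκ, ← Real.le_log_iff_exp_le h1]
        rw [div_le_iff₀ hε]
        have := hM z hz2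
        simp only [W, h] at hz3
        linarith
      · rintro ⟨hzT, hz3⟩
        refine ⟨⟨?_, hTZ z hzT⟩, hz3⟩
        rcases lt_or_eq_of_le (show r ≤ dist z p0 from hzT.1) with hlt' | heq
        · exact hlt'
        · exfalso
          have h1 := hmax (show z ∈ Metric.closedBall p0 r from heq.symm.le)
          have h2 := hh0 z hzT.1
          simp only [mem_ofPred_eq] at h1
          simp only [mem_preimage, mem_Ici, W] at hz3
          have : ε * h z ≤ 0 := mul_nonpos_of_nonneg_of_nonpos hε.le h2
          linarith
    refine superlevel_false hUo (W := W) (fun z hz => (hWc z (le_of_lt hz.1) hz.2).continuousWithinAt)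
      ?_ m ?_ ⟨q0, ⟨hq0r, hq0⟩, le_refl _⟩
    · rintro z ⟨hz1, hz2⟩
      obtain ⟨F, hF, hF2⟩ := log_norm_local (hgan z (le_of_lt hz1)) (hgne z (le_of_lt hz1) hz2)
      refine (hs z hz2).add (F := fun q => (ε : ℂ) * F q) (analyticAt_const.mul hF) ?_
      filter_upwards [hF2] with q hq
      simp [h, hq]
    · rw [hS]
      refine hTcomp.of_isClosed_subset ?_ inter_subset_left
      exact ContinuousOn.preimage_isClosed_of_isClosed
        (fun z hz => (hWc z hz.1 (hTZ z hz)).continuousWithinAt) hTc isClosed_Ici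
  refine ⟨V p1, ?_⟩
  have hu : IsOpen {z | z ∉ Z ∧ V z = V p1} := by
    rw [isOpen_iff_mem_nhds]
    rintro z ⟨hz, e⟩
    have h1 : ∀ᶠ q in 𝓝 z, q ∉ Z := hZo.mem_nhds hz
    have h2 : ∀ᶠ q in 𝓝 z, V q ≤ V z := by
      filter_upwards [h1] with q hq
      rw [e]; exact key q hq
    filter_upwards [h1, (hs z hz).eventually_eq h2] with q a b
    exact ⟨a, b.trans e⟩
  have hv : IsOpen {z | z ∉ Z ∧ V z < V p1} := by
    have := hV.isOpen_inter_preimage hZo (isOpen_Iio (a := V p1))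
    exact this
  have hsub : Zᶜ ⊆ {z | z ∉ Z ∧ V z = V p1} := by
    refine hconn.isPreconnected.subset_left_of_subset_union hu hv ?_ ?_ ?_
    · rw [Set.disjoint_left]
      rintro z ⟨_, h1⟩ ⟨_, h2⟩
      exact h2.ne h1
    · intro z hz
      rcases lt_or_eq_of_le (key z hz) with h | h
      · exact Or.inr ⟨hz, h⟩
      · exact Or.inl ⟨hz, h⟩
    · exact ⟨p1, hball hp1, hball hp1, rfl⟩
  exact fun z hz => (hsub hz).2

end PG

/-! Part C: abstract uniqueness -/

namespace PG
open Filter Topology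

variable {n : ℕ} {Z : Set ℂ}

/-- A curve through `Z` with its arcs and its angle functions. -/
structure Sys (n : ℕ) (Z : Set ℂ) where
  Γ : Set ℂ
  γ : Fin n → Set ℂ
  α : Fin n → ℂ → ℝ
  closed : IsClosed Γ
  Zsub : Z ⊆ Γ
  ne : ∃ q, q ∉ Γ
  union : ∀ p ∈ Γ, p ∉ Z → ∃ k, p ∈ γ k
  sub : ∀ k, ∀ p ∈ γ k, p ∈ Γ ∧ p ∉ Z
  nonempty : ∀ k, (γ k).Nonempty
  cont : ∀ k, ContinuousOn (α k) Zᶜ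
  ang : ∀ p, p ∉ Z → Ang (fun k => α k p)
  zero_iff : ∀ p, p ∉ Z → ∀ k, (α k p = 0 ↔ p ∈ γ k)
  one : ∀ j k, j ≠ k → ∀ p ∈ γ k, α j p = 1
  harm : ∀ p, p ∉ Γ → ∀ k, ∃ G : ℂ → ℂ, AnalyticAt ℂ G p ∧ ∀ᶠ q in 𝓝 p, α k q = (G q).re
  side : ∀ q, q ∉ Γ → ∃ Ω : Set ℂ, IsOpen Ω ∧ IsPreconnected Ω ∧ q ∈ Ω ∧ Ω ⊆ Γᶜ ∧
    ∀ j, γ j ⊆ closure Ω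

/-- local toggling data at `p` -/
def LocTog (S : Sys n Z) (k : Fin n) (y : ℂ → Bool) (p : ℂ) : Prop :=
  (p ∈ S.γ k ∧ ∃ G : ℂ → ℂ, AnalyticAt ℂ G p ∧ ∀ᶠ q in 𝓝 p, S.α k q = |(G q).re| ∧
    (y q = true → 0 ≤ (G q).re) ∧ (y q = false → (G q).re ≤ 0)) ∨
  (p ∉ S.Γ ∧ ∀ᶠ q in 𝓝 p, y q = false)

/-- conditional toggle -/
def tg (f : List (Fin n) → List (Fin n)) (b : Bool) (u : List (Fin n)) : List (Fin n) :=
  if b then f u else u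

/-- word data -/
def WD (S S' : Sys n Z) (w : ℂ → List (Fin n)) : Prop :=
  ∀ p, p ∉ Z → ∃ (k l : Fin n) (u : List (Fin n)) (y x : ℂ → Bool), Red u ∧
    LocTog S k y p ∧ LocTog S' l x p ∧ ∀ᶠ q in 𝓝 p, w q = tg (Lt l) (x q) (tg (Rt k) (y q) u)

lemma WD.symm {S S' : Sys n Z} {w : ℂ → List (Fin n)} (h : WD S S' w) :
    WD S' S (fun q => (w q).reverse) := by
  intro p hp
  obtain ⟨k, l, u, y, x, hu, h1, h2, h3⟩ := h p hp
  refine ⟨l, k, u.reverse, x, y, hu.reverse, h2, h1, ?_⟩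
  filter_upwards [h3] with q hq
  rw [hq]
  cases x q <;> cases y q <;> simp [tg, Lt_reverse, Rt_reverse, Lt_Rt_comm]

lemma tg_red_R (k : Fin n) (b : Bool) {u : List (Fin n)} (h : Red u) : Red (tg (Rt k) b u) := by
  cases b
  · exact h
  · exact Rt_red k h

lemma tg_red_L (k : Fin n) (b : Bool) {u : List (Fin n)} (h : Red u) : Red (tg (Lt k) b u) := by
  cases b
  · exact h
  · exact Lt_red k h

/-- the value function -/
noncomputable def VV (S S' : Sys n Z) (w : ℂ → List (Fin n)) (q : ℂ) : ℝ :=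
  Phi (fun k => S.α k q) (fun k => S'.α k q) (w q)

lemma VV_symm (S S' : Sys n Z) (w : ℂ → List (Fin n)) (q : ℂ) :
    VV S' S (fun q => (w q).reverse) q = VV S S' w q := Phi_reverse _ _ _

/-- Toggling does not change the potential at a point of local toggling. -/
lemma Phi_tg_R {S S' : Sys n Z} {k : Fin n} {y : ℂ → Bool} {p : ℂ} (hp : p ∈ S.γ k)
    (b : Bool) {u : List (Fin n)} (hu : Red u) :
    Phi (fun k => S.α k p) (fun k => S'.α k p) (tg (Rt k) b u)
      = Phi (fun k => S.α k p) (fun k => S'.α k p) u := by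
  cases b
  · rfl
  · have hZ := (S.sub k p hp).2
    exact Phi_A (S.ang p hZ) (S'.ang p hZ) k ((S.zero_iff p hZ k).mpr hp)
      (fun j hj => S.one j k hj p hp) hu

lemma Phi_tg_L {S S' : Sys n Z} {k : Fin n} {y : ℂ → Bool} {p : ℂ} (hp : p ∈ S'.γ k)
    (b : Bool) {u : List (Fin n)} (hu : Red u) :
    Phi (fun k => S.α k p) (fun k => S'.α k p) (tg (Lt k) b u)
      = Phi (fun k => S.α k p) (fun k => S'.α k p) u := by
  cases b
  · rfl
  · have hZ := (S'.sub k p hp).2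
    exact Phi_A' (S.ang p hZ) (S'.ang p hZ) k ((S'.zero_iff p hZ k).mpr hp)
      (fun j hj => S'.one j k hj p hp) hu

lemma exists_norm_eq (hn : 0 < n) (a b : Fin n → ℝ) : ∃ j, ‖a - b‖ = |a j - b j| := by
  have : Nonempty (Fin n) := ⟨⟨0, hn⟩⟩
  obtain ⟨j, hj⟩ := Finite.exists_max (fun j => |a j - b j|)
  refine ⟨j, le_antisymm ?_ (abs_le_nrm a b j)⟩
  rw [pi_norm_le_iff_of_nonneg (abs_nonneg _)]
  intro i
  simpa using hj i

lemma Phi_continuousAt (S S' : Sys n Z) (hZ : IsOpen Zᶜ) {p : ℂ} (hp : p ∉ Z)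
    (v : List (Fin n)) :
    ContinuousAt (fun q => Phi (fun k => S.α k q) (fun k => S'.α k q) v) p := by
  have h1 : ∀ k, ContinuousAt (S.α k) p := fun k => (S.cont k).continuousAt (hZ.mem_nhds hp)
  have h2 : ∀ k, ContinuousAt (S'.α k) p := fun k => (S'.cont k).continuousAt (hZ.mem_nhds hp)
  by_cases hv : v = []
  · subst hv
    simp only [Phi_nil]
    exact ((continuousAt_pi.mpr h1).sub (continuousAt_pi.mpr h2)).norm
  · simp only [Phi_ne _ _ hv]
    exact (continuousAt_const.add (h2 _)).add (h1 _)

/-- At `p`, all locally relevant words have the same potential. -/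
lemma VV_cont {S S' : Sys n Z} {w : ℂ → List (Fin n)} (hZ : IsOpen Zᶜ) (h : WD S S' w) :
    ContinuousOn (VV S S' w) Zᶜ := by
  intro p hp
  apply ContinuousAt.continuousWithinAt
  obtain ⟨k, l, u, y, x, hu, h1, h2, h3⟩ := h p hp
  have key : ∀ q, (p ∉ S.Γ → y q = false) → (p ∉ S'.Γ → x q = false) →
      Phi (fun k => S.α k p) (fun k => S'.α k p) (tg (Lt l) (x q) (tg (Rt k) (y q) u))
      = Phi (fun k => S.α k p) (fun k => S'.α k p) u := by
    intro q hy hx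
    have e1 : Phi (fun k => S.α k p) (fun k => S'.α k p) (tg (Rt k) (y q) u)
      = Phi (fun k => S.α k p) (fun k => S'.α k p) u := by
      rcases h1 with h1 | h1
      · exact Phi_tg_R (y := y) h1.1 _ hu
      · rw [hy h1.1]; rfl
    rw [← e1]
    rcases h2 with h2 | h2
    · exact Phi_tg_L (y := y) h2.1 _ (tg_red_R k _ hu)
    · rw [hx h2.1]; rfl
  have hy : ∀ᶠ q in 𝓝 p, (p ∉ S.Γ → y q = false) := by
    rcases h1 with h1 | h1
    · exact Eventually.of_forall fun q hq => absurd (S.sub k p h1.1).1 hq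
    · filter_upwards [h1.2] with q hq _ using hq
  have hx : ∀ᶠ q in 𝓝 p, (p ∉ S'.Γ → x q = false) := by
    rcases h2 with h1 | h1
    · exact Eventually.of_forall fun q hq => absurd (S'.sub l p h1.1).1 hq
    · filter_upwards [h1.2] with q hq _ using hq
  have hVp : VV S S' w p = Phi (fun k => S.α k p) (fun k => S'.α k p) u := by
    unfold VV
    rw [h3.self_of_nhds]
    exact key p hy.self_of_nhds hx.self_of_nhds
  rw [Metric.continuousAt_iff']
  intro ε hε
  have hc : ∀ᶠ q in 𝓝 p, ∀ b1 b2 : Bool,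
      dist (Phi (fun k => S.α k q) (fun k => S'.α k q) (tg (Lt l) b1 (tg (Rt k) b2 u)))
        (Phi (fun k => S.α k p) (fun k => S'.α k p) (tg (Lt l) b1 (tg (Rt k) b2 u))) < ε := by
    rw [eventually_all]; intro b1
    rw [eventually_all]; intro b2
    exact Metric.continuousAt_iff'.mp (Phi_continuousAt S S' hZ hp _) ε hε
  filter_upwards [hc, h3, hx, hy] with q a1 a2 a3 a4
  have := a1 (x q) (y q)
  rw [key q a4 a3] at this
  rw [hVp]
  unfold VV
  rw [a2]; exact this

/-- normalise the local data at a crossing so that `u` does not end with `k` -/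
lemma LocTog.normalize {S : Sys n Z} {k : Fin n} {y : ℂ → Bool} {p : ℂ} (h : LocTog S k y p)
    (hp : p ∈ S.Γ) {u : List (Fin n)} (hu : Red u) :
    ∃ (u' : List (Fin n)) (y' : ℂ → Bool), Red u' ∧ LocTog S k y' p ∧
      (∀ h : u' ≠ [], u'.getLast h ≠ k) ∧ ∀ q, tg (Rt k) (y q) u = tg (Rt k) (y' q) u' := by
  rcases Rt_cases k hu with h1 | h1
  · exact ⟨u, y, hu, h, h1, fun q => rfl⟩
  · refine ⟨Rt k u, fun q => !(y q), Rt_red k hu, ?_, h1, ?_⟩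
    · rcases h with ⟨h2, G, hG, h3⟩ | h
      · refine Or.inl ⟨h2, fun q => - G q, hG.neg, ?_⟩
        filter_upwards [h3] with q hq
        refine ⟨by rw [neg_re, abs_neg]; exact hq.1, ?_, ?_⟩
        · intro e; rw [neg_re]; linarith [hq.2.2 (by simpa using e)]
        · intro e; rw [neg_re]; linarith [hq.2.1 (by simpa using e)]
      · exact absurd hp h.1
    · intro q
      cases hy : y q <;> simp [tg, hy, Rt_invol k hu]

/-- Explicit description near a point of `γ_k` off the other curve. -/
lemma cross_local {S S' : Sys n Z} {w : ℂ → List (Fin n)} (h : WD S S' w) {p : ℂ} (hp : p ∉ Z)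
    (hpΓ : p ∈ S.Γ) (hpΓ' : p ∉ S'.Γ) :
    ∃ (k : Fin n) (u : List (Fin n)) (y : ℂ → Bool) (G : ℂ → ℂ), Red u ∧ p ∈ S.γ k ∧
      (∀ h : u ≠ [], u.getLast h ≠ k) ∧ AnalyticAt ℂ G p ∧
      (∀ᶠ q in 𝓝 p, S.α k q = |(G q).re| ∧
        (y q = true → 0 ≤ (G q).re) ∧ (y q = false → (G q).re ≤ 0)) ∧
      (∀ᶠ q in 𝓝 p, w q = tg (Rt k) (y q) u) := by
  obtain ⟨k, l, u, y, x, hu, h1, h2, h3⟩ := h p hp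
  obtain ⟨u', y', hu', h1', hlast, he⟩ := h1.normalize hpΓ hu
  rcases h2 with h2 | h2
  · exact absurd (S'.sub _ _ h2.1).1 hpΓ'
  rcases h1' with ⟨hk, G, hG, hev⟩ | h1'
  · refine ⟨k, u', y', G, hu', hk, hlast, hG, hev, ?_⟩
    filter_upwards [h2.2, h3] with q a b
    rw [b, a, he]; rfl
  · exact absurd hpΓ h1'.1

lemma supp_cross {S S' : Sys n Z} {w : ℂ → List (Fin n)} (hZ : IsOpen Zᶜ) {p : ℂ} (hp : p ∉ Z)
    (hpΓ' : p ∉ S'.Γ) {k : Fin n} {u : List (Fin n)} {y : ℂ → Bool} {G : ℂ → ℂ}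
    (hu : Red u) (hk : p ∈ S.γ k)
    (hlast : ∀ h : u ≠ [], u.getLast h ≠ k) (hG : AnalyticAt ℂ G p)
    (hev : ∀ᶠ q in 𝓝 p, S.α k q = |(G q).re| ∧
        (y q = true → 0 ≤ (G q).re) ∧ (y q = false → (G q).re ≤ 0))
    (hw : ∀ᶠ q in 𝓝 p, w q = tg (Rt k) (y q) u) :
    ∃ F : ℂ → ℂ, AnalyticAt ℂ F p ∧ VV S S' w p = (F p).re ∧ (∀ᶠ q in 𝓝 p, (F q).re ≤ VV S S' w q)
      ∧ ∀ᶠ q in 𝓝 p, (F q).re = u.length + S'.α ((u ++ [k]).head (by simp)) q + (G q).re := by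
  obtain ⟨G', hG', hev'⟩ := S'.harm p hpΓ' ((u ++ [k]).head (by simp))
  have hZn : ∀ᶠ q in 𝓝 p, q ∉ Z := hZ.mem_nhds hp
  have hGp : (G p).re = 0 := by
    have h1 := hev.self_of_nhds.1
    rw [(S.zero_iff p hp k).mpr hk] at h1
    exact abs_eq_zero.mp h1.symm
  refine ⟨fun q => u.length + G' q + G q, (analyticAt_const.add hG').add hG, ?_, ?_, ?_⟩
  · unfold VV
    rw [hw.self_of_nhds, Phi_tg_R (y := y) hk _ hu]
    rw [← Phi_tg_R (y := y) hk true hu]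
    simp only [tg, if_true]
    rw [Rt_not_last u k hlast, Phi_concat, (S.zero_iff p hp k).mpr hk, hev'.self_of_nhds]
    simp [hGp]
  · filter_upwards [hev, hw, hev', hZn] with q a b c d
    unfold VV
    rw [b]
    simp only [add_re, natCast_re]
    rw [← c]
    cases hy : y q with
    | true =>
      simp only [tg, if_true]
      rw [Rt_not_last u k hlast, Phi_concat, a.1, abs_of_nonneg (a.2.1 hy)]
    | false =>
      simp only [tg]
      have := Phi_B1 (b := fun k => S'.α k q) (S.ang q d) u k hlast
      rw [a.1, abs_of_nonpos (a.2.2 hy)] at this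
      simp only [Bool.false_eq_true, if_false]
      linarith
  · filter_upwards [hev'] with q c
    simp [c]

lemma VV_supp {S S' : Sys n Z} {w : ℂ → List (Fin n)} (hn : 0 < n) (hZ : IsOpen Zᶜ)
    (h : WD S S' w) {p : ℂ} (hp : p ∉ Z) : Supp (VV S S' w) p := by
  by_cases hΓ : p ∈ S.Γ
  · by_cases hΓ' : p ∈ S'.Γ
    · -- both
      obtain ⟨k, l, u, y, x, hu, h1, h2, h3⟩ := h p hp
      obtain ⟨u1, y1, hu1, h1', hlast1, he1⟩ := h1.normalize hΓ hu
      obtain ⟨u2r, x1, hu2, h2', hhead, he2⟩ := h2.normalize hΓ' hu1.reverse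
      set u2 := u2r.reverse with hu2def
      have hr2 : Red u2 := hu2.reverse
      have he2' : ∀ q, tg (Lt l) (x q) u1 = tg (Lt l) (x1 q) u2 := by
        intro q
        have := congrArg List.reverse (he2 q)
        rw [hu2def]
        cases hx : x q <;> cases hx1 : x1 q <;> rw [hx, hx1] at this <;>
          simpa [tg, Rt_reverse] using this
      have hwq : ∀ᶠ q in 𝓝 p, w q = tg (Lt l) (x1 q) (tg (Rt k) (y1 q) u2) := by
        filter_upwards [h3] with q hq
        rw [hq, he1]
        have hcomm : ∀ (b1 b2 : Bool) (v : List (Fin n)),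
            tg (Lt l) b1 (tg (Rt k) b2 v) = tg (Rt k) b2 (tg (Lt l) b1 v) := by
          intro b1 b2 v
          cases b1 <;> cases b2 <;> simp [tg, Lt_Rt_comm]
        rw [hcomm, he2', ← hcomm]
      have hhead2 : ∀ h : u2 ≠ [], u2.head h ≠ l := by
        intro h
        simp only [hu2def, List.head_reverse]
        exact hhead _
      -- one more normalisation: `u2` does not end with `k`
      have hlast2 : ∀ h : u2 ≠ [], u2.getLast h ≠ k := by
        -- `u2` equals `u1` or its tail
        have hcase : u2 = u1 ∨ u2 = Lt l u1 := by
          have := he2' p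
          cases hx : x p <;> cases hx1 : x1 p <;> rw [hx, hx1] at this <;>
            simp only [tg, if_true, if_false, Bool.false_eq_true] at this
          · exact Or.inl this.symm
          · right; rw [this, Lt_invol l hr2]
          · exact Or.inr this.symm
          · left; rw [← Lt_invol l hr2, ← this, Lt_invol l hu1]
        rcases hcase with e | e
        · rw [e]; exact hlast1
        · intro h
          cases hu1e : u1 with
          | nil =>
            exfalso
            rw [hu1e] at e
            have e' : u2 = [l] := e
            apply hhead2 h
            simp [e']
          | cons a t =>
            rw [hu1e, Lt_cons] at e
            split_ifs at e with hal
            · have hne : u1 ≠ [] := by rw [hu1e]; simp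
              have := hlast1 hne
              have ht : t ≠ [] := by rw [← e]; exact h
              simp only [hu1e, List.getLast_cons ht] at this
              simp only [e]; exact this
            · exfalso
              apply hhead2 h
              simp [e]
      rcases h1' with ⟨hk, G, hG, hev⟩ | h1'
      swap
      · exact absurd hΓ h1'.1
      rcases h2' with ⟨hl, G', hG', hev'⟩ | h2'
      swap
      · exact absurd hΓ' h2'.1
      have hZn : ∀ᶠ q in 𝓝 p, q ∉ Z := hZ.mem_nhds hp
      have ak : S.α k p = 0 := (S.zero_iff p hp k).mpr hk
      have bl : S'.α l p = 0 := (S'.zero_iff p hp l).mpr hl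
      have hGp : (G p).re = 0 := by
        have h1 := hev.self_of_nhds.1
        rw [ak] at h1
        exact abs_eq_zero.mp h1.symm
      have hGp' : (G' p).re = 0 := by
        have h1 := hev'.self_of_nhds.1
        rw [bl] at h1
        exact abs_eq_zero.mp h1.symm
      have hVp : ∀ b1 b2, VV S S' w p = Phi (fun k => S.α k p) (fun k => S'.α k p)
          (tg (Lt l) b1 (tg (Rt k) b2 u2)) := by
        intro b1 b2
        unfold VV
        rw [hwq.self_of_nhds, Phi_tg_L (y := y) hl _ (tg_red_R k _ hr2), Phi_tg_R (y := y) hk _ hr2,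
          Phi_tg_L (y := y) hl _ (tg_red_R k _ hr2), Phi_tg_R (y := y) hk _ hr2]
      by_cases hdeg : u2 = [] ∧ k = l
      · obtain ⟨e1, e2⟩ := hdeg
        refine ⟨fun _ => 0, analyticAt_const, ?_, ?_⟩
        · rw [hVp false true]
          simp only [tg, if_true, Bool.false_eq_true, if_false]
          rw [e1, Rt_nil, Phi_ne _ _ (by simp)]
          simp [ak, e2, bl]
          rw [← e2]; exact ak
        · filter_upwards [hZn] with q hq
          simpa [VV] using Phi_nonneg (S.ang q hq) (S'.ang q hq) (w q)
      · have hkl : u2 = [] → k ≠ l := fun e1 e2 => hdeg ⟨e1, e2⟩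
        refine ⟨fun q => u2.length + 1 + G' q + G q,
          ((analyticAt_const.add hG').add hG), ?_, ?_⟩
        · rw [hVp true true]
          simp only [tg, if_true]
          rw [← (Phi_B2 (S.ang p hp) (S'.ang p hp) u2 k l hlast2 hhead2 hkl).1, ak, bl]
          simp [hGp, hGp']
        · filter_upwards [hwq, hev, hev', hZn] with q a b c d
          unfold VV
          rw [a]
          obtain ⟨i1, i2, i3, i4⟩ := Phi_B2 (S.ang q d) (S'.ang q d) u2 k l hlast2 hhead2 hkl
          simp only [add_re, natCast_re, one_re]
          cases hy : y1 q <;> cases hx : x1 q <;>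
            simp only [tg, if_true, Bool.false_eq_true, if_false]
          · rw [b.1, c.1, abs_of_nonpos (b.2.2 hy), abs_of_nonpos (c.2.2 hx)] at i4
            linarith
          · rw [b.1, c.1, abs_of_nonpos (b.2.2 hy), abs_of_nonneg (c.2.1 hx)] at i2
            linarith
          · rw [b.1, c.1, abs_of_nonneg (b.2.1 hy), abs_of_nonpos (c.2.2 hx)] at i3
            linarith
          · rw [b.1, c.1, abs_of_nonneg (b.2.1 hy), abs_of_nonneg (c.2.1 hx)] at i1
            linarith
    · obtain ⟨k, u, y, G, hu, hk, hlast, hG, hev, hw⟩ := cross_local h hp hΓ hΓ'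
      obtain ⟨F, h1, h2, h3, _⟩ := supp_cross (w := w) hZ hp hΓ' hu hk hlast hG hev hw
      exact ⟨F, h1, h2, h3⟩
  · by_cases hΓ' : p ∈ S'.Γ
    · obtain ⟨k, u, y, G, hu, hk, hlast, hG, hev, hw⟩ := cross_local h.symm hp hΓ' hΓ
      obtain ⟨F, h1, h2, h3, _⟩ := supp_cross (w := fun q => (w q).reverse) hZ hp hΓ hu hk hlast hG hev hw
      refine ⟨F, h1, ?_, ?_⟩
      · rw [← h2, VV_symm]
      · filter_upwards [h3] with q hq
        rwa [VV_symm] at hq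
    · -- off both curves
      obtain ⟨k, l, u, y, x, hu, h1, h2, h3⟩ := h p hp
      rcases h1 with h1 | h1
      · exact absurd (S.sub _ _ h1.1).1 hΓ
      rcases h2 with h2 | h2
      · exact absurd (S'.sub _ _ h2.1).1 hΓ'
      have hw : ∀ᶠ q in 𝓝 p, w q = u := by
        filter_upwards [h1.2, h2.2, h3] with q a b c
        rw [c, a, b]; rfl
      choose G hG hev using S.harm p hΓ
      choose G' hG' hev' using S'.harm p hΓ'
      by_cases hu0 : u = []
      · obtain ⟨j, hj⟩ := exists_norm_eq hn (fun k => S.α k p) (fun k => S'.α k p)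
        have hV : ∀ᶠ q in 𝓝 p, VV S S' w q = ‖(fun k => S.α k q) - (fun k => S'.α k q)‖ := by
          filter_upwards [hw] with q hq
          unfold VV; rw [hq, hu0, Phi_nil]
        rcases abs_choice (S.α j p - S'.α j p) with e | e
        · refine ⟨fun q => G j q - G' j q, (hG j).sub (hG' j), ?_, ?_⟩
          · rw [hV.self_of_nhds, hj, e, sub_re, (hev j).self_of_nhds, (hev' j).self_of_nhds]
          · filter_upwards [hV, hev j, hev' j] with q a b c
            rw [a, sub_re, ← b, ← c]
            exact (le_abs_self _).trans (abs_le_nrm (fun k => S.α k q) (fun k => S'.α k q) j)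
        · refine ⟨fun q => -(G j q - G' j q), ((hG j).sub (hG' j)).neg, ?_, ?_⟩
          · rw [hV.self_of_nhds, hj, e, neg_re, sub_re, (hev j).self_of_nhds, (hev' j).self_of_nhds]
          · filter_upwards [hV, hev j, hev' j] with q a b c
            rw [a, neg_re, sub_re, ← b, ← c]
            exact (neg_le_abs _).trans (abs_le_nrm (fun k => S.α k q) (fun k => S'.α k q) j)
      · have hV : ∀ᶠ q in 𝓝 p, VV S S' w q = 
            (((u.length : ℂ) - 1) + G' (u.head hu0) q + G (u.getLast hu0) q).re := by
          filter_upwards [hw, hev (u.getLast hu0), hev' (u.head hu0)] with q a b c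
          unfold VV; rw [a, Phi_ne _ _ hu0]
          simp [b, c]
        refine ⟨fun q => ((u.length : ℂ) - 1) + G' (u.head hu0) q + G (u.getLast hu0) q,
          ((analyticAt_const.add (hG' (u.head hu0))).add (hG (u.getLast hu0))), ?_, ?_⟩
        · exact hV.self_of_nhds
        · filter_upwards [hV] with q hq
          exact hq.symm.le

/-- propagation along a side -/
lemma side_const (hZ : IsOpen Zᶜ) {f : ℂ → ℝ} (hf : ContinuousOn f Zᶜ) {Ω : Set ℂ} (hΩ : IsOpen Ω)
    (hpre : IsPreconnected Ω) (hsub : Ω ⊆ Zᶜ) {c : ℝ} {q0 : ℂ} (hq0 : q0 ∈ Ω) (h0 : f q0 = c)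
    (hloc : ∀ q ∈ Ω, f q = c → ∀ᶠ q' in 𝓝 q, f q' = c) {p : ℂ} (hp : p ∈ closure Ω) (hpZ : p ∉ Z) :
    f p = c := by
  have hu : IsOpen {q | q ∈ Ω ∧ f q = c} := by
    rw [isOpen_iff_mem_nhds]
    rintro q ⟨h1, h2⟩
    filter_upwards [hloc q h1 h2, hΩ.mem_nhds h1] with q' a b
    exact ⟨b, a⟩
  have hv : IsOpen {q | q ∈ Ω ∧ f q ≠ c} :=
    (hf.mono hsub).isOpen_inter_preimage hΩ (isOpen_compl_singleton (x := c))
  have hall : Ω ⊆ {q | q ∈ Ω ∧ f q = c} := by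
    refine hpre.subset_left_of_subset_union hu hv ?_ ?_ ⟨q0, hq0, hq0, h0⟩
    · rw [Set.disjoint_left]
      rintro z ⟨_, h1⟩ ⟨_, h2⟩
      exact h2 h1
    · intro z hz
      by_cases h : f z = c
      · exact Or.inl ⟨hz, h⟩
      · exact Or.inr ⟨hz, h⟩
  have hc : ContinuousAt f p := hf.continuousAt (hZ.mem_nhds hpZ)
  by_contra hne
  have h1 : ∀ᶠ q in 𝓝 p, f q ≠ c := hc.eventually_ne hne
  obtain ⟨q, hq1, hq2⟩ := mem_closure_iff_nhds.mp hp _ h1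
  exact hq1 (hall hq2).2

lemma strict (S : Sys n Z) (hn : 3 ≤ n) (hZ : IsOpen Zᶜ) {k l : Fin n} (hkl : k ≠ l) {q : ℂ}
    (hq : q ∉ S.Γ) : 1 < S.α k q + S.α l q := by
  have hqZ : q ∉ Z := fun h => hq (S.Zsub h)
  rcases lt_or_eq_of_le ((S.ang q hqZ).add k l hkl) with h | h
  · exact h
  exfalso
  obtain ⟨Ω, hΩ, hpre, hqΩ, hsub, hcl⟩ := S.side q hq
  have hsubZ : Ω ⊆ Zᶜ := fun x hx h => hsub hx (S.Zsub h)
  obtain ⟨m, hm⟩ : ∃ m : Fin n, m ≠ k ∧ m ≠ l := by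
    have : ({k, l} : Finset (Fin n)).card < Fintype.card (Fin n) := by
      refine lt_of_le_of_lt Finset.card_le_two ?_
      simp; omega
    by_contra hcon
    push Not at hcon
    have hall : ({k, l} : Finset (Fin n)) = Finset.univ := by
      ext m
      simp only [Finset.mem_insert, Finset.mem_singleton, Finset.mem_univ, iff_true]
      by_cases hmk : m = k
      · exact Or.inl hmk
      · exact Or.inr (hcon m hmk)
    rw [hall] at this
    simp at this
  obtain ⟨p, hp⟩ := S.nonempty m
  have := side_const hZ ((S.cont k).add (S.cont l)) hΩ hpre hsubZ hqΩ h.symm ?_ (hcl m hp)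
    (S.sub m p hp).2
  · simp only [Pi.add_apply, S.one k m hm.1.symm p hp, S.one l m hm.2.symm p hp] at this
    norm_num at this
  · intro q' hq' e
    obtain ⟨G, hG, hev⟩ := S.harm q' (hsub hq') k
    obtain ⟨G', hG', hev'⟩ := S.harm q' (hsub hq') l
    have hloc : ∀ᶠ x in 𝓝 q', (-(G x + G' x)).re ≤ (-(G q' + G' q')).re := by
      filter_upwards [hev, hev', hZ.mem_nhds (hsubZ hq')] with x a b d
      simp only [neg_re, add_re, ← a, ← b, ← hev.self_of_nhds, ← hev'.self_of_nhds]
      have h1 := (S.ang x d).add k l hkl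
      simp only [Pi.add_apply] at e
      linarith
    filter_upwards [eventually_const_of_re_le (hG.add hG').neg hloc, hev, hev'] with x a b d
    have := congrArg Complex.re a
    simp only [Pi.neg_apply, Pi.add_apply, neg_re, add_re, ← b, ← d, ← hev.self_of_nhds,
      ← hev'.self_of_nhds] at this
    simp only [Pi.add_apply] at e ⊢
    linarith

lemma diff_ne {S S' : Sys n Z} {w : ℂ → List (Fin n)} (hn : 3 ≤ n) (hZ : IsOpen Zᶜ) {c : ℝ} (hc : 0 < c)
    (hV : ∀ z ∉ Z, VV S S' w z = c) (k : Fin n) {q : ℂ} (hq : q ∉ S.Γ) :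
    S'.α k q - S.α k q ≠ c := by
  intro h
  obtain ⟨Ω, hΩ, hpre, hqΩ, hsub, hcl⟩ := S.side q hq
  have hsubZ : Ω ⊆ Zᶜ := fun x hx h => hsub hx (S.Zsub h)
  have hle : ∀ z ∉ Z, ∀ j, |S.α j z - S'.α j z| ≤ c := by
    intro z hz j
    rw [← hV z hz]
    exact abs_sub_le_Phi (S.ang z hz) (S'.ang z hz) (w z) j
  obtain ⟨j, hj⟩ : ∃ j : Fin n, j ≠ k := by
    have : Nontrivial (Fin n) := Fin.nontrivial_iff_two_le.mpr (by omega)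
    exact exists_ne k
  obtain ⟨p, hp⟩ := S.nonempty j
  have hpZ := (S.sub j p hp).2
  have := side_const hZ ((S'.cont k).sub (S.cont k)) hΩ hpre hsubZ hqΩ h ?_ (hcl j hp) hpZ
  · simp only [Pi.sub_apply, S.one k j hj.symm p hp] at this
    have := (S'.ang p hpZ).le_one k
    linarith
  · intro q' hq' e
    have hq'Z := hsubZ hq'
    simp only [Pi.sub_apply] at e
    by_cases hΓ' : q' ∈ S'.Γ
    · exfalso
      obtain ⟨i, hi⟩ := S'.union q' hΓ' hq'Z
      have h0 := (S'.zero_iff q' hq'Z i).mpr hi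
      have hik : i ≠ k := by
        rintro rfl
        rw [h0] at e
        have := (S.ang q' hq'Z).nonneg i
        linarith
      have h1 := S'.one k i hik.symm q' hi
      have h2 := strict S hn hZ hik (hsub hq')
      have h3 := (abs_le.mp (hle q' hq'Z i)).2
      linarith
    · obtain ⟨G, hG, hev⟩ := S.harm q' (hsub hq') k
      obtain ⟨G', hG', hev'⟩ := S'.harm q' hΓ' k
      have hloc : ∀ᶠ x in 𝓝 q', (G' x - G x).re ≤ (G' q' - G q').re := by
        filter_upwards [hev, hev', hZ.mem_nhds (hsubZ hq')] with x a b d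
        simp only [sub_re, ← a, ← b, ← hev.self_of_nhds, ← hev'.self_of_nhds]
        have := (abs_le.mp (hle x d k)).1
        linarith
      filter_upwards [eventually_const_of_re_le (hG'.sub hG) hloc, hev, hev'] with x a b d
      have := congrArg Complex.re a
      simp only [Pi.sub_apply, sub_re, ← b, ← d, ← hev.self_of_nhds, ← hev'.self_of_nhds] at this
      simp only [Pi.sub_apply]
      linarith

lemma gamma_sub {S S' : Sys n Z} {w : ℂ → List (Fin n)} (hn : 3 ≤ n) (hZ : IsOpen Zᶜ)
    (h : WD S S' w) {c : ℝ} (hV : ∀ z ∉ Z, VV S S' w z = c) : S.Γ ⊆ S'.Γ := by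
  intro p hpΓ
  by_cases hpZ : p ∈ Z
  · exact S'.Zsub hpZ
  have hc0 : 0 ≤ c := by rw [← hV p hpZ]; exact Phi_nonneg (S.ang p hpZ) (S'.ang p hpZ) _
  rcases hc0.eq_or_lt with hc | hc
  · obtain ⟨k, hk⟩ := S.union p hpΓ hpZ
    have hVp := hV p hpZ
    unfold VV at hVp
    by_cases hw : w p = []
    · rw [hw, Phi_nil, ← hc] at hVp
      have h1 := abs_le_nrm (fun k => S.α k p) (fun k => S'.α k p) k
      rw [hVp] at h1
      have h2 := abs_nonpos_iff.mp h1
      simp only [(S.zero_iff p hpZ k).mpr hk] at h2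
      exact (S'.sub k p ((S'.zero_iff p hpZ k).mp (by linarith))).1
    · rw [Phi_ne _ _ hw, ← hc] at hVp
      have h1 : 1 ≤ (w p).length := List.length_pos_iff.mpr hw
      have h1' : (1:ℝ) ≤ (w p).length := by exact_mod_cast h1
      have h2 := (S.ang p hpZ).nonneg ((w p).getLast hw)
      have h3 := (S'.ang p hpZ).nonneg ((w p).head hw)
      exact (S'.sub _ p ((S'.zero_iff p hpZ ((w p).head hw)).mp (by linarith))).1
  · by_contra hpΓ'
    obtain ⟨k, u, y, G, hu, hk, hlast, hG, hev, hw⟩ := cross_local h hpZ hpΓ hpΓ'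
    obtain ⟨F, hF, hF1, hF2, hF3⟩ := supp_cross (w := w) hZ hpZ hpΓ' hu hk hlast hG hev hw
    have hZn : ∀ᶠ q in 𝓝 p, q ∉ Z := hZ.mem_nhds hpZ
    have hΓ'n : ∀ᶠ q in 𝓝 p, q ∉ S'.Γ := S'.closed.isOpen_compl.mem_nhds hpΓ'
    have hFc : ∀ᶠ q in 𝓝 p, F q = F p := by
      apply eventually_const_of_re_le hF
      filter_upwards [hF2, hZn] with q a b
      rw [hV q b] at a
      rw [← hF1, hV p hpZ]; exact a
    have ak : S.α k p = 0 := (S.zero_iff p hpZ k).mpr hk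
    have hGp : (G p).re = 0 := by
      have h1 := hev.self_of_nhds.1
      rw [ak] at h1
      exact abs_eq_zero.mp h1.symm
    -- points with negative real part
    have hneg : ∃ᶠ q in 𝓝 p, (G q).re < 0 := by
      rcases hG.eventually_constant_or_nhds_le_map_nhds with h1 | h1
      · exfalso
        have h2 : ∀ᶠ q in 𝓝 p, q ∈ S.Γ := by
          filter_upwards [h1, hev, hZn] with q a b d
          have : S.α k q = 0 := by rw [b.1, a, hGp, abs_zero]
          exact (S.sub k q ((S.zero_iff q d k).mp this)).1
        obtain ⟨q0, hq0⟩ := S.ne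
        obtain ⟨Ω, hΩ, hpre, hqΩ, hsub, hcl⟩ := S.side q0 hq0
        obtain ⟨x, hx1, hx2⟩ := mem_closure_iff_nhds.mp (hcl k hk) _ h2
        exact hsub hx2 hx1
      · intro hcon
        have h2 : {v : ℂ | ¬ v.re < 0} ∈ 𝓝 (G p) := h1 (mem_map.mpr hcon)
        rw [Metric.mem_nhds_iff] at h2
        obtain ⟨ε, hε, hb⟩ := h2
        have h3 : G p - ((ε / 2 : ℝ) : ℂ) ∈ Metric.ball (G p) ε := by
          rw [Metric.mem_ball, dist_eq_norm, sub_sub_cancel_left, norm_neg, Complex.norm_real,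
            Real.norm_eq_abs, abs_of_pos (by linarith)]
          linarith
        have h4 := hb h3
        simp only [mem_ofPred_eq, sub_re, ofReal_re, hGp] at h4
        linarith
    have hlt1 : ∀ᶠ q in 𝓝 p, S.α k q < 1 := by
      have : ContinuousAt (S.α k) p := (S.cont k).continuousAt (hZ.mem_nhds hpZ)
      exact this.eventually_lt_const (by rw [ak]; norm_num)
    obtain ⟨q, hqneg, hqw, hqev, hqF, hqF3, hqZ, hqΓ', hq1⟩ :=
      (hneg.and_eventually (hw.and (hev.and (hFc.and (hF3.and (hZn.and (hΓ'n.and hlt1))))))).exists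
    have hqΓ : q ∉ S.Γ := by
      intro hq
      obtain ⟨j, hj⟩ := S.union q hq hqZ
      by_cases hjk : k = j
      · subst hjk
        have := (S.zero_iff q hqZ k).mpr hj
        rw [hqev.1, abs_of_neg hqneg] at this
        linarith
      · have := S.one k j hjk q hj
        linarith
    have hy : y q = false := by
      by_contra hy
      have := hqev.2.1 (by simpa using hy)
      linarith
    have hwu : w q = u := by rw [hqw, hy]; rfl
    have hu0 : u ≠ [] := by
      intro hu0
      have hVq := hV q hqZ
      unfold VV at hVq
      rw [hwu, hu0, Phi_nil] at hVq
      obtain ⟨j, hj⟩ := exists_norm_eq (by omega) (fun k => S.α k q) (fun k => S'.α k q)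
      rw [hj] at hVq
      rcases abs_choice (S.α j q - S'.α j q) with e | e
      · have hV' : ∀ z ∉ Z, VV S' S (fun q => (w q).reverse) z = c := by
          intro z hz; rw [VV_symm]; exact hV z hz
        exact diff_ne hn hZ hc hV' j hqΓ' (by rw [← e]; exact hVq)
      · exact diff_ne hn hZ hc hV j hqΓ (by rw [← hVq, e]; ring)
    have e1 : (F q).re = c := by rw [hqF, ← hF1, hV p hpZ]
    have e2 := hV q hqZ
    unfold VV at e2
    rw [hwu, Phi_ne _ _ hu0] at e2
    rw [e1, List.head_append_of_ne_nil hu0] at hqF3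
    have e3 := hqev.1
    rw [abs_of_neg hqneg] at e3
    have e4 := strict S hn hZ (hlast hu0) hqΓ
    linarith

theorem abstract_uniqueness {S S' : Sys n Z} {w : ℂ → List (Fin n)} (hn : 3 ≤ n) (hZ : Z.Finite)
    (h : WD S S' w) {M : ℕ} (hM : ∀ z ∉ Z, (w z).length ≤ M) : S.Γ = S'.Γ := by
  have hZo : IsOpen Zᶜ := hZ.isClosed.isOpen_compl
  obtain ⟨c, hc⟩ := maxPrinciple hZ (VV_cont hZo h) (M := M + 1) (fun z hz => by
    refine (Phi_le (S.ang z hz) (S'.ang z hz) (w z)).trans ?_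
    have : ((w z).length : ℝ) ≤ M := by exact_mod_cast hM z hz
    linarith) (fun z hz => VV_supp (by omega) hZo h hz)
  apply Subset.antisymm
  · exact gamma_sub hn hZo h hc
  · exact gamma_sub hn hZo h.symm (c := c) (fun z hz => by rw [VV_symm]; exact hc z hz)

end PG

/-! Part D1: complex analysis lemmas -/

namespace PG
open Filter Topology

lemma inj_open {U : Set ℂ} (hU : IsOpen U) {f : ℂ → ℂ} (hf : DifferentiableOn ℂ f U)
    (hinj : InjOn f U) {z : ℂ} (hz : z ∈ U) : 𝓝 (f z) ≤ map f (𝓝 z) := by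
  have han : AnalyticAt ℂ f z := hf.analyticAt (hU.mem_nhds hz)
  rcases han.eventually_constant_or_nhds_le_map_nhds with h | h
  · exfalso
    have h1 : ∀ᶠ w in 𝓝 z, w = z := by
      filter_upwards [h, hU.mem_nhds hz] with w a b
      exact hinj b hz a
    have h2 : ∀ᶠ w in 𝓝[≠] z, w = z := h1.filter_mono nhdsWithin_le_nhds
    have h3 : ∀ᶠ w in 𝓝[≠] z, w ≠ z := eventually_mem_nhdsWithin
    obtain ⟨w, a, b⟩ := (h2.and h3).exists
    exact b a
  · exact h

lemma inj_image_open {U : Set ℂ} (hU : IsOpen U) {f : ℂ → ℂ} (hf : DifferentiableOn ℂ f U)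
    (hinj : InjOn f U) {V : Set ℂ} (hV : IsOpen V) (hVU : V ⊆ U) : IsOpen (f '' V) := by
  rw [isOpen_iff_mem_nhds]
  rintro _ ⟨z, hz, rfl⟩
  apply inj_open hU hf hinj (hVU hz)
  exact mem_map.mpr (mem_of_superset (hV.mem_nhds hz) (subset_preimage_image f V))

lemma inv_analytic {U : Set ℂ} (hU : IsOpen U) {f g : ℂ → ℂ} (hf : DifferentiableOn ℂ f U)
    (hg : ∀ z ∈ U, g (f z) = z) {z : ℂ} (hz : z ∈ U) : AnalyticAt ℂ g (f z) := by
  have hinj : InjOn f U := fun a ha b hb h => by rw [← hg a ha, ← hg b hb, h]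
  have hcont : ∀ z ∈ U, ContinuousAt g (f z) := by
    intro z hz
    rw [ContinuousAt, hg z hz]
    intro V hV
    have h1 : f '' (V ∩ U) ∈ 𝓝 (f z) := by
      apply inj_open hU hf hinj hz
      exact mem_map.mpr (mem_of_superset (inter_mem hV (hU.mem_nhds hz)) (subset_preimage_image f _))
    rw [mem_map]
    filter_upwards [h1]
    rintro _ ⟨x, ⟨hx1, hx2⟩, rfl⟩
    rw [mem_preimage, hg x hx2]; exact hx1
  have himg : ∀ z ∈ U, f '' U ∈ 𝓝 (f z) := fun z hz =>
    (inj_image_open hU hf hinj hU Subset.rfl).mem_nhds (mem_image_of_mem f hz)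
  apply analyticAt_of_differentiable_on_punctured_nhds_of_continuousAt _ (hcont z hz)
  have han : AnalyticAt ℂ f z := hf.analyticAt (hU.mem_nhds hz)
  have hd : ∀ᶠ w in 𝓝[≠] z, deriv f w ≠ 0 := by
    rcases han.deriv.eventually_eq_zero_or_eventually_ne_zero with h | h
    · exfalso
      obtain ⟨r, hr, hb⟩ := Metric.mem_nhds_iff.mp (inter_mem h (hU.mem_nhds hz))
      have hconst : ∀ w ∈ Metric.ball z r, f w = f z := by
        intro w hw
        have := Metric.isOpen_ball.eqOn_of_deriv_eq (𝕜 := ℂ) (f := f) (g := fun _ => f z)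
          (convex_ball z r).isPreconnected (hf.mono fun x hx => (hb hx).2) (differentiableOn_const _)
          (fun x hx => by
            have h1 : deriv f x = 0 := (hb hx).1
            simp [h1]) (Metric.mem_ball_self hr) rfl
        exact this hw
      have h1 : ∀ᶠ w in 𝓝[≠] z, w ∈ Metric.ball z r :=
        mem_nhdsWithin_of_mem_nhds (Metric.ball_mem_nhds z hr)
      have h3 : ∀ᶠ w in 𝓝[≠] z, w ≠ z := eventually_mem_nhdsWithin
      obtain ⟨w, a, b⟩ := (h1.and h3).exists
      exact b (hinj (hb a).2 hz (hconst w a))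
    · exact h
  rw [eventually_nhdsWithin_iff] at hd ⊢
  have ht : Tendsto g (𝓝 (f z)) (𝓝 z) := by
    have := hcont z hz
    rwa [ContinuousAt, hg z hz] at this
  filter_upwards [ht.eventually hd, himg z hz] with w h1 h2 h3
  obtain ⟨x, hx, rfl⟩ := h2
  rw [hg x hx] at h1
  have hxz : x ≠ z := by rintro rfl; exact h3 rfl
  have hdx : HasDerivAt f (deriv f x) (g (f x)) := by
    rw [hg x hx]
    exact (hf.differentiableAt (hU.mem_nhds hx)).hasDerivAt
  refine (HasDerivAt.of_local_left_inverse (hcont x hx) hdx (h1 hxz) ?_).differentiableAt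
  filter_upwards [himg x hx]
  rintro _ ⟨y, hy, rfl⟩
  rw [hg y hy]

/-- punctured connectedness -/
lemma preconn_punctured_ball (x : ℂ) (r : ℝ) : IsPreconnected (Metric.ball x r \ {x}) := by
  have h1 : IsPreconnected ((Ioo (0:ℝ) r) ×ˢ (univ : Set ℝ)) :=
    isPreconnected_Ioo.prod isPreconnected_univ
  have h2 := h1.image (fun p : ℝ × ℝ => x + p.1 * Complex.exp (p.2 * I)) (by fun_prop)
  convert h2 using 1
  ext z
  simp only [Set.mem_sdiff, Metric.mem_ball, mem_singleton_iff, mem_image, mem_prod, mem_Ioo, mem_univ,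
    and_true, Prod.exists]
  constructor
  · rintro ⟨h3, h4⟩
    refine ⟨‖z - x‖, arg (z - x), ⟨norm_pos_iff.mpr (sub_ne_zero.mpr h4), ?_⟩, ?_⟩
    · rwa [← dist_eq_norm]
    · rw [norm_mul_exp_arg_mul_I]; ring
  · rintro ⟨a, b, ⟨h3, h4⟩, rfl⟩
    constructor
    · rw [dist_eq_norm, add_sub_cancel_left, norm_mul, norm_exp_ofReal_mul_I, mul_one,
        Complex.norm_real, Real.norm_eq_abs, abs_of_pos h3]
      exact h4
    · intro h
      have : (a : ℂ) * Complex.exp (b * I) = 0 := by simpa using h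
      rcases mul_eq_zero.mp this with h | h
      · exact h3.ne' (by exact_mod_cast h)
      · exact Complex.exp_ne_zero _ h

lemma preconn_diff_point {U : Set ℂ} (hU : IsOpen U) (hc : IsPreconnected U) (x : ℂ) :
    IsPreconnected (U \ {x}) := by
  by_cases hx : x ∈ U
  swap
  · rwa [sdiff_singleton_eq_self hx]
  obtain ⟨r, hr, hb⟩ := Metric.isOpen_iff.mp hU x hx
  have hP := preconn_punctured_ball x r
  have key : ∀ u v : Set ℂ, IsOpen u → IsOpen v → U \ {x} ⊆ u ∪ v → (U \ {x}) ∩ (u ∩ v) = ∅ →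
      Metric.ball x r \ {x} ⊆ u → U \ {x} ⊆ u := by
    intro u v hu hv hcov hdis hPu
    have h1 : U ⊆ (u ∪ Metric.ball x r) ∪ (v \ {x} ∩ U) := by
      intro z hz
      by_cases hzx : z = x
      · subst hzx; exact Or.inl (Or.inr (Metric.mem_ball_self hr))
      · rcases hcov ⟨hz, hzx⟩ with h | h
        · exact Or.inl (Or.inl h)
        · exact Or.inr ⟨⟨h, hzx⟩, hz⟩
    have hdd : U ∩ ((u ∪ Metric.ball x r) ∩ (v \ {x} ∩ U)) = ∅ := by
      rw [Set.eq_empty_iff_forall_notMem]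
      rintro z ⟨hz, h2, ⟨h3, h4⟩, _⟩
      have h5 : z ∈ u := by
        rcases h2 with h2 | h2
        · exact h2
        · exact hPu ⟨h2, h4⟩
      have : z ∈ (U \ {x}) ∩ (u ∩ v) := ⟨⟨hz, h4⟩, h5, h3⟩
      rw [hdis] at this; exact this
    rcases isPreconnected_iff_subset_of_disjoint.mp hc _ _ (hu.union Metric.isOpen_ball)
      ((hv.sdiff (isClosed_singleton (x := x))).inter hU) h1 hdd with h | h
    · rintro z ⟨hz, hzx⟩
      rcases h hz with h' | h'
      · exact h'
      · exact hPu ⟨h', hzx⟩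
    · exact absurd rfl (h hx).1.2
  rw [isPreconnected_iff_subset_of_disjoint]
  intro u v hu hv hcov hdis
  have hsubP : Metric.ball x r \ {x} ⊆ U \ {x} := sdiff_subset_sdiff_left hb
  rcases isPreconnected_iff_subset_of_disjoint.mp hP u v hu hv (hsubP.trans hcov)
    (by
      rw [Set.eq_empty_iff_forall_notMem] at hdis ⊢
      exact fun z hz => hdis z ⟨hsubP hz.1, hz.2⟩) with h | h
  · exact Or.inl (key u v hu hv hcov hdis h)
  · exact Or.inr (key v u hv hu (by rwa [union_comm]) (by rwa [inter_comm v u]) h)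

/-- algebra for disjoint half-plane geodesics -/
lemma mob_alg {a b c d : ℝ} (hdet : 0 < a * d - b * c)
    (hx : ∀ x : ℝ, 0 < x → (a * x + b) * (c * x + d) ≤ 0) (r x : ℝ) (hr : 0 ≤ r) (hxr : |x| ≤ r) :
    a * c * r ^ 2 + 2 * (a * d) * x + b * d ≤ 0 := by
  have hQ : ∀ x : ℝ, 0 < x → (a * c) * x ^ 2 + (a * d + b * c) * x + b * d ≤ 0 := by
    intro x h
    have := hx x h
    nlinarith
  have hbd : b * d ≤ 0 := by
    by_contra h
    push Not at h
    have hlim : Tendsto (fun x : ℝ => (a * x + b) * (c * x + d)) (𝓝[>] 0) (𝓝 ((a * 0 + b) * (c * 0 + d))) := by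
      apply Tendsto.mono_left _ nhdsWithin_le_nhds
      have : Continuous (fun x : ℝ => (a * x + b) * (c * x + d)) := by fun_prop
      exact this.tendsto 0
    have := le_of_tendsto hlim (eventually_mem_nhdsWithin.mono fun x hx' => hx x hx')
    simp at this
    linarith
  have hac : a * c ≤ 0 := by
    by_contra h
    push Not at h
    have hlim : Tendsto (fun x : ℝ => (b * x + a) * (d * x + c)) (𝓝[>] 0) (𝓝 ((b * 0 + a) * (d * 0 + c))) := by
      apply Tendsto.mono_left _ nhdsWithin_le_nhds
      have : Continuous (fun x : ℝ => (b * x + a) * (d * x + c)) := by fun_prop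
      exact this.tendsto 0
    have := le_of_tendsto (b := 0) hlim (eventually_mem_nhdsWithin.mono fun x hx' => by
      have hx0 : (0:ℝ) < x := hx'
      have h1 := hx x⁻¹ (inv_pos.mpr hx0)
      have h2 : (b * x + a) * (d * x + c) = ((a * x⁻¹ + b) * (c * x⁻¹ + d)) * x ^ 2 := by
        field_simp; ring
      rw [h2]
      exact mul_nonpos_of_nonpos_of_nonneg h1 (by positivity))
    simp at this
    linarith
  rcases le_or_gt (a * d) 0 with had | had
  · have h1 : 2 * (a * d) * x ≤ 2 * (-(a * d)) * r := by
      have : -(a*d) * (-x) ≤ -(a*d) * r := mul_le_mul_of_nonneg_left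
        ((neg_le_abs x).trans hxr) (by linarith)
      linarith
    have h2 : (a * d) ^ 2 ≤ (a * c) * (b * d) := by nlinarith
    set A := -(a * c)
    set B := -(b * d)
    set C := -(a * d)
    have hA : 0 ≤ A := by simp only [A]; linarith
    have hB : 0 ≤ B := by simp only [B]; linarith
    have hC : C ^ 2 ≤ A * B := by simp only [A, B, C]; nlinarith
    suffices h : 2 * C * r ≤ A * r ^ 2 + B by
      have e1 : a * c = -A := by simp [A]
      have e2 : b * d = -B := by simp [B]
      have e3 : a * d = -C := by simp [C]
      rw [e1, e2]
      have : 2 * (-(a * d)) * r = 2 * C * r := by simp [C]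
      linarith
    have h3 : C ≤ Real.sqrt A * Real.sqrt B := by
      rw [← Real.sqrt_mul hA]
      exact Real.le_sqrt_of_sq_le hC
    have h4 := Real.sq_sqrt hA
    have h5 := Real.sq_sqrt hB
    nlinarith [sq_nonneg (Real.sqrt A * r - Real.sqrt B), mul_le_mul_of_nonneg_right h3 hr]
  · exfalso
    have hbc : 0 ≤ b * c := by
      have : 0 ≤ (a * d) * (b * c) := by nlinarith [mul_nonneg_of_nonpos_of_nonpos hac hbd]
      exact nonneg_of_mul_nonneg_right this had
    rcases eq_or_lt_of_le hac with h0 | h0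
    · have h1 := hQ ((1 - b * d) / (a * d + b * c)) (div_pos (by linarith) (by linarith))
      rw [h0] at h1
      have : (a * d + b * c) * ((1 - b * d) / (a * d + b * c)) = 1 - b * d := by
        field_simp
      rw [this] at h1
      linarith
    · have hs : 0 < a * d + b * c := by linarith
      have h1 := hQ ((a * d + b * c) / (2 * (-(a * c)))) (div_pos hs (by linarith))
      have hne : a * c ≠ 0 := h0.ne
      have h2 : (a * c) * ((a * d + b * c) / (2 * (-(a * c)))) ^ 2 +
          (a * d + b * c) * ((a * d + b * c) / (2 * (-(a * c)))) + b * d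
          = ((a * d + b * c) ^ 2 / (4 * (-(a * c)))) + b * d := by
        have h3 : 2 * (-(a * c)) ≠ 0 := by linarith
        have h4 : 4 * (-(a * c)) ≠ 0 := by linarith
        generalize a * c = t at *
        field_simp
        ring
      rw [h2] at h1
      have h5 : (a * d + b * c) ^ 2 / (4 * (-(a * c))) ≤ -(b * d) := by linarith
      rw [div_le_iff₀ (by linarith)] at h5
      nlinarith [mul_pos hdet hdet]

end PG

/-! Part D2: automorphisms of the half plane -/

namespace PG
open Filter Topology

/-- upper half plane as a set -/
def UH : Set ℂ := {z | 0 < z.im}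

lemma UH_open : IsOpen UH := isOpen_lt continuous_const Complex.continuous_im

lemma UH_add_I {z : ℂ} (hz : z ∈ UH) : z + I ≠ 0 := by
  intro h
  have := congrArg Complex.im h
  simp at this
  have h2 : 0 < z.im := hz
  linarith

lemma cay_norm {z : ℂ} (hz : z ∈ UH) : ‖(z - I) / (z + I)‖ < 1 := by
  have h2 : 0 < z.im := hz
  rw [norm_div, div_lt_one (norm_pos_iff.mpr (UH_add_I hz))]
  apply lt_of_pow_lt_pow_left₀ 2 (norm_nonneg _)
  rw [Complex.sq_norm, Complex.sq_norm, normSq_apply, normSq_apply]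
  simp
  nlinarith

lemma one_sub_ne {w : ℂ} (hw : ‖w‖ < 1) : 1 - w ≠ 0 := by
  intro h
  have : w = 1 := by linear_combination -h
  rw [this] at hw; simp at hw

lemma cayinv_mem {w : ℂ} (hw : ‖w‖ < 1) : I * (1 + w) / (1 - w) ∈ UH := by
  show 0 < (I * (1 + w) / (1 - w)).im
  have h1 := one_sub_ne hw
  have h2 : I * (1 + w) / (1 - w) = (I * (1 + w) * (starRingEnd ℂ) (1 - w)) / (normSq (1 - w) : ℂ) := by
    rw [Complex.normSq_eq_conj_mul_self]
    have h3 : (starRingEnd ℂ) (1 - w) ≠ 0 := (map_ne_zero _).mpr h1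
    field_simp
  rw [h2, Complex.div_ofReal_im]
  apply div_pos _ (Complex.normSq_pos.mpr h1)
  have h4 : ‖w‖ ^ 2 < 1 := by nlinarith [norm_nonneg w]
  rw [Complex.sq_norm, normSq_apply] at h4
  simp
  nlinarith

lemma cay_cayinv {w : ℂ} (hw : ‖w‖ < 1) :
    (I * (1 + w) / (1 - w) - I) / (I * (1 + w) / (1 - w) + I) = w := by
  have h1 := one_sub_ne hw
  have h2 : I * (1 + w) / (1 - w) + I ≠ 0 := UH_add_I (cayinv_mem hw)
  rw [div_eq_iff h2]
  field_simp
  ring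

lemma cayinv_cay {z : ℂ} (hz : z ∈ UH) :
    I * (1 + (z - I) / (z + I)) / (1 - (z - I) / (z + I)) = z := by
  have h1 := one_sub_ne (cay_norm hz)
  have h2 := UH_add_I hz
  rw [div_eq_iff h1]
  field_simp
  ring

/-- the Cayley conjugate of a self-map of the half plane -/
noncomputable def cayConj (k : ℂ → ℂ) (w : ℂ) : ℂ :=
  (k (I * (1 + w) / (1 - w)) - I) / (k (I * (1 + w) / (1 - w)) + I)

lemma cayConj_maps {k : ℂ → ℂ} (hm : MapsTo k UH UH) :
    MapsTo (cayConj k) (Metric.ball 0 1) (Metric.ball 0 1) := by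
  intro w hw
  rw [mem_ball_zero_iff] at hw ⊢
  exact cay_norm (hm (cayinv_mem hw))

lemma cayConj_diff {k : ℂ → ℂ} (hd : DifferentiableOn ℂ k UH) (hm : MapsTo k UH UH) :
    DifferentiableOn ℂ (cayConj k) (Metric.ball 0 1) := by
  have h1 : DifferentiableOn ℂ (fun w : ℂ => I * (1 + w) / (1 - w)) (Metric.ball 0 1) := by
    apply DifferentiableOn.div (by fun_prop) (by fun_prop)
    intro w hw
    exact one_sub_ne (by simpa using hw)
  have h2 : DifferentiableOn ℂ (fun w : ℂ => k (I * (1 + w) / (1 - w))) (Metric.ball 0 1) :=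
    hd.comp h1 (fun w hw => cayinv_mem (by simpa using hw))
  apply DifferentiableOn.div (h2.sub_const I) (h2.add_const I)
  intro w hw
  exact UH_add_I (hm (cayinv_mem (by simpa using hw)))

lemma cayConj_zero {k : ℂ → ℂ} (hI : k I = I) : cayConj k 0 = 0 := by
  simp [cayConj, hI]

lemma cayConj_inv {k k' : ℂ → ℂ} (hm : MapsTo k UH UH) (hi : ∀ z ∈ UH, k' (k z) = z) {w : ℂ}
    (hw : ‖w‖ < 1) : cayConj k' (cayConj k w) = w := by
  have : cayConj k' (cayConj k w) =
      (k' (k (I * (1 + w) / (1 - w))) - I) / (k' (k (I * (1 + w) / (1 - w))) + I) := by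
    simp only [cayConj]
    rw [cayinv_cay (hm (cayinv_mem hw))]
  rw [this, hi _ (cayinv_mem hw), cay_cayinv hw]

lemma aut_rot {k k' : ℂ → ℂ} (hd : DifferentiableOn ℂ k UH) (hd' : DifferentiableOn ℂ k' UH)
    (hm : MapsTo k UH UH) (hm' : MapsTo k' UH UH) (hi : ∀ z ∈ UH, k' (k z) = z)
    (hI : k I = I) (hI' : k' I = I) :
    ∃ l : ℂ, ‖l‖ = 1 ∧ ∀ z ∈ UH, (k z - I) / (k z + I) = l * ((z - I) / (z + I)) := by
  have hT : ∀ w ∈ Metric.ball (0 : ℂ) 1, ‖cayConj k w‖ = ‖w‖ := by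
    intro w hw
    have hw1 : ‖w‖ < 1 := by simpa using hw
    apply le_antisymm
    · exact Complex.norm_le_norm_of_mapsTo_ball (cayConj_diff hd hm) ((cayConj_maps hm).mono_right Metric.ball_subset_closedBall) (cayConj_zero hI) hw1
    · have h1 := cayConj_maps hm hw
      rw [mem_ball_zero_iff] at h1
      have := Complex.norm_le_norm_of_mapsTo_ball (cayConj_diff hd' hm') ((cayConj_maps hm').mono_right Metric.ball_subset_closedBall) (cayConj_zero hI') h1
      rwa [cayConj_inv hm hi hw1] at this
  have h0 := cayConj_zero hI
  have hhalf : (1/2 : ℂ) ∈ Metric.ball (0:ℂ) 1 := by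
    rw [mem_ball_zero_iff]; norm_num
  obtain ⟨l, hl⟩ : ∃ l : ℂ, ∀ w ∈ Metric.ball (0:ℂ) 1, cayConj k w = l * w := by
    have := Complex.affine_of_mapsTo_ball_of_exists_norm_dslope_eq_div' (f := cayConj k)
      (c := 0) (R₁ := 1) (R₂ := 1) (cayConj_diff hd hm) (by rw [h0]; exact (cayConj_maps hm).mono_right Metric.ball_subset_closedBall)
      ⟨1/2, hhalf, by
        rw [dslope_of_ne _ (by norm_num), slope_def_field, h0]
        rw [norm_div, sub_zero, sub_zero, hT _ hhalf]; norm_num⟩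
    obtain ⟨C, _, hC⟩ := this
    refine ⟨C, fun w hw => ?_⟩
    rw [hC hw, h0]; simp [mul_comm]
  refine ⟨l, ?_, ?_⟩
  · have h1 := hT _ hhalf
    rw [hl _ hhalf, norm_mul] at h1
    have h2 : ‖(1/2 : ℂ)‖ ≠ 0 := by norm_num
    exact (mul_eq_right₀ h2).mp h1
  · intro z hz
    have h1 := hl ((z - I) / (z + I)) (by rw [mem_ball_zero_iff]; exact cay_norm hz)
    rw [← h1, cayConj, cayinv_cay hz]

lemma aut_rot' {k k' : ℂ → ℂ} (hd : DifferentiableOn ℂ k UH) (hd' : DifferentiableOn ℂ k' UH)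
    (hm : MapsTo k UH UH) (hm' : MapsTo k' UH UH) (hi : ∀ z ∈ UH, k' (k z) = z)
    (hI : k I = I) (hI' : k' I = I) :
    ∃ c s : ℝ, c ^ 2 + s ^ 2 = 1 ∧ ∀ z ∈ UH, k z * (-s * z + c) = c * z + s := by
  obtain ⟨l, hl, h⟩ := aut_rot hd hd' hm hm' hi hI hI'
  set β := arg l / 2
  have hl2 : l = Complex.exp (β * I) * Complex.exp (β * I) := by
    rw [← Complex.exp_add]
    have := norm_mul_exp_arg_mul_I l
    rw [hl] at this
    simp only [ofReal_one, one_mul] at this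
    rw [← this]
    congr 1
    simp only [β]; push_cast; ring
  refine ⟨Real.cos β, Real.sin β, by nlinarith [Real.sin_sq_add_cos_sq β], fun z hz => ?_⟩
  have h1 := h z hz
  have h2 := UH_add_I hz
  have h3 := UH_add_I (hm hz)
  rw [hl2, Complex.exp_mul_I, ← Complex.ofReal_cos, ← Complex.ofReal_sin, div_eq_iff h3] at h1
  have h4 : (Real.cos β : ℂ)^2 + (Real.sin β : ℂ) ^ 2 = 1 := by
    have := Real.sin_sq_add_cos_sq β
    have h5 : ((Real.sin β ^ 2 + Real.cos β ^ 2 : ℝ) : ℂ) = 1 := by rw [this]; simp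
    push_cast at h5 ⊢
    linear_combination h5
  generalize (Real.cos β : ℂ) = c at *
  generalize (Real.sin β : ℂ) = s at *
  have h5 : (k z - I) * (z + I) = (c + s * I) * (c + s * I) * (z - I) * (k z + I) := by
    have : (k z - I) * (z + I) = ((c + s * I) * (c + s * I) * ((z - I) / (z + I)) * (k z + I)) * (z + I) := by rw [← h1]
    rw [this]; field_simp
  have hcs : (c - s * I) * (c + s * I) = 1 := by linear_combination h4 - s ^ 2 * I_sq
  have h6 : (k z - I) * (z + I) * (c - s * I) = (c + s * I) * (z - I) * (k z + I) := by
    linear_combination (c - s * I) * h5 + (c + s * I) * (z - I) * (k z + I) * hcs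
  have h7 : 2 * I * (k z * (-s * z + c)) = 2 * I * (c * z + s) := by
    linear_combination h6 - 2 * I * s * I_sq
  have h8 : (2 * I : ℂ) ≠ 0 := by simp
  exact mul_left_cancel₀ h8 h7

lemma aut_UH {h h' : ℂ → ℂ} (hd : DifferentiableOn ℂ h UH) (hd' : DifferentiableOn ℂ h' UH)
    (hm : MapsTo h UH UH) (hm' : MapsTo h' UH UH) (hi : ∀ z ∈ UH, h' (h z) = z) :
    ∃ a b c d : ℝ, 0 < a * d - b * c ∧ ∀ z ∈ UH, h z * (c * z + d) = a * z + b := by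
  have hI : I ∈ UH := by show 0 < I.im; simp
  set u := (h I).re
  set v := (h I).im
  have hv : 0 < v := hm hI
  have hvc : (v : ℂ) ≠ 0 := by exact_mod_cast hv.ne'
  have huv : h I = u + v * I := (Complex.re_add_im _).symm
  have hmem : ∀ z ∈ UH, (v * z + u : ℂ) ∈ UH := by
    intro z hz
    show 0 < (v * z + u : ℂ).im
    simp; exact mul_pos hv hz
  obtain ⟨c, s, hcs, hk⟩ := aut_rot' (k := fun z => (h z - u) / v) (k' := fun z => h' (v * z + u))
    (by
      exact (hd.sub_const (u:ℂ)).div_const (v:ℂ))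
    (by exact hd'.comp (by fun_prop) hmem)
    (by
      intro z hz
      show 0 < ((h z - u) / v : ℂ).im
      rw [Complex.div_ofReal_im]
      apply div_pos _ hv
      simp; exact hm hz)
    (fun z hz => hm' (hmem z hz))
    (by
      intro z hz
      show h' (v * ((h z - u) / v) + u) = z
      rw [mul_div_cancel₀ _ hvc, sub_add_cancel, hi z hz])
    (by show (h I - u) / v = I
        rw [huv]; field_simp; ring)
    (by show h' (v * I + u) = I
        rw [show (v * I + u : ℂ) = h I by rw [huv]; ring, hi _ hI])
  refine ⟨v * c - u * s, v * s + u * c, -s, c, ?_, ?_⟩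
  · have : (v * c - u * s) * c - (v * s + u * c) * (-s) = v * (c ^ 2 + s ^ 2) := by ring
    rw [this, hcs]; linarith
  · intro z hz
    have h1 := hk z hz
    have h2 : (h z - u) / v * v = h z - u := div_mul_cancel₀ _ hvc
    push_cast
    linear_combination v * h1 - (-s * z + c) * h2

end PG

/-! Part D3: geodesic data -/

namespace PG
open Filter Topology

/-- the strip -/
def Str : Set ℂ := {z | |z.im| < 1}

lemma Str_open : IsOpen Str := isOpen_lt (by fun_prop) continuous_const

/-- upper half of the strip -/
def HS : Set ℂ := {z | 0 < z.im ∧ z.im < 1}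

lemma HS_open : IsOpen HS :=
  (isOpen_lt continuous_const Complex.continuous_im).inter
    (isOpen_lt Complex.continuous_im continuous_const)

lemma HS_sub : HS ⊆ Str := by
  rintro z ⟨h1, h2⟩
  show |z.im| < 1
  rw [abs_of_pos h1]; exact h2

lemma HS_preconn : IsPreconnected HS := by
  have : HS = {z : ℂ | 0 < z.im} ∩ {z : ℂ | z.im < 1} := rfl
  rw [this]
  exact ((convex_halfSpace_im_gt 0).inter (convex_halfSpace_im_lt 1)).isPreconnected

/-- geodesic data for an arc -/
structure Geo (Γ A : Set ℂ) where
  p : ℂ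
  f : ℂ → ℂ
  g : ℂ → ℂ
  pΓ : p ∈ Γ
  pA : p ∉ A
  fd : DifferentiableOn ℂ f Str
  gf : ∀ ζ ∈ Str, g (f ζ) = ζ
  zer : ∃ ζ ∈ Str, f ζ = 0
  fw : ∀ ζ ∈ Str, f ζ ≠ 0 → (f ζ)⁻¹ + p ∈ Γᶜ ∪ A
  bw : ∀ q ∈ Γᶜ ∪ A, g ((q - p)⁻¹) ∈ Str ∧ f (g ((q - p)⁻¹)) = (q - p)⁻¹
  real : ∀ ζ ∈ Str, ζ.im = 0 → f ζ ≠ 0 ∧ (f ζ)⁻¹ + p ∈ A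
  bwr : ∀ q ∈ A, (g ((q - p)⁻¹)).im = 0

variable {Γ A B : Set ℂ}

/-- reflect the strip -/
def Geo.flip (K : Geo Γ A) : Geo Γ A where
  p := K.p
  f := fun z => K.f (-z)
  g := fun z => - K.g z
  pΓ := K.pΓ
  pA := K.pA
  fd := by
    apply K.fd.comp (by fun_prop)
    intro z hz
    show |(-z).im| < 1
    rw [neg_im, abs_neg]; exact hz
  gf := by
    intro z hz
    rw [K.gf, neg_neg]
    show |(-z).im| < 1
    rw [neg_im, abs_neg]; exact hz
  zer := by
    obtain ⟨z, h1, h2⟩ := K.zer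
    refine ⟨-z, ?_, by simpa using h2⟩
    show |(-z).im| < 1
    rw [neg_im, abs_neg]; exact h1
  fw := by
    intro z hz
    apply K.fw
    show |(-z).im| < 1
    rw [neg_im, abs_neg]; exact hz
  bw := by
    intro q hq
    obtain ⟨h1, h2⟩ := K.bw q hq
    refine ⟨?_, by simpa using h2⟩
    show |(-_ : ℂ).im| < 1
    rw [neg_im, abs_neg]; exact h1
  real := by
    intro z hz h0
    apply K.real
    · show |(-z).im| < 1
      rw [neg_im, abs_neg]; exact hz
    · rw [neg_im, h0, neg_zero]
  bwr := by
    intro q hq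
    rw [neg_im, K.bwr q hq, neg_zero]

/-- the uniformising coordinate -/
noncomputable def Geo.φ (K : Geo Γ A) (q : ℂ) : ℂ := K.g ((q - K.p)⁻¹)

lemma Geo.flip_φ (K : Geo Γ A) (q : ℂ) : K.flip.φ q = - K.φ q := rfl

lemma Geo.ne_p (K : Geo Γ A) {q : ℂ} (hq : q ∈ Γᶜ ∪ A) : q - K.p ≠ 0 := by
  intro h
  rw [sub_eq_zero] at h
  subst h
  rcases hq with h | h
  · exact h K.pΓ
  · exact K.pA h

lemma Geo.inj (K : Geo Γ A) : InjOn K.f Str := by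
  intro a ha b hb h
  rw [← K.gf a ha, ← K.gf b hb, h]

lemma Geo.φF (K : Geo Γ A) {ζ : ℂ} (h : ζ ∈ Str) : K.φ ((K.f ζ)⁻¹ + K.p) = ζ := by
  simp only [Geo.φ, add_sub_cancel_right, inv_inv]
  exact K.gf ζ h

lemma Geo.φ_mem (K : Geo Γ A) {q : ℂ} (hq : q ∈ Γᶜ ∪ A) : K.φ q ∈ Str := (K.bw q hq).1

lemma Geo.fφ (K : Geo Γ A) {q : ℂ} (hq : q ∈ Γᶜ ∪ A) : K.f (K.φ q) = (q - K.p)⁻¹ := (K.bw q hq).2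

lemma Geo.fφ_ne (K : Geo Γ A) {q : ℂ} (hq : q ∈ Γᶜ ∪ A) : K.f (K.φ q) ≠ 0 := by
  rw [K.fφ hq]; exact inv_ne_zero (K.ne_p hq)

lemma Geo.Fφ (K : Geo Γ A) {q : ℂ} (hq : q ∈ Γᶜ ∪ A) : (K.f (K.φ q))⁻¹ + K.p = q := by
  rw [K.fφ hq]; simp

lemma Geo.im_zero (K : Geo Γ A) {q : ℂ} (hq : q ∈ Γᶜ ∪ A) : (K.φ q).im = 0 ↔ q ∈ A := by
  constructor
  · intro h
    have := (K.real _ (K.φ_mem hq) h).2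
    rwa [K.Fφ hq] at this
  · exact K.bwr q

lemma Geo.D_open (K : Geo Γ A) : IsOpen (Γᶜ ∪ A) := by
  rw [isOpen_iff_mem_nhds]
  intro q hq
  have h1 : K.f '' Str ∈ 𝓝 ((q - K.p)⁻¹) :=
    (inj_image_open Str_open K.fd K.inj Str_open Subset.rfl).mem_nhds
      ⟨K.φ q, K.φ_mem hq, K.fφ hq⟩
  have h2 : ContinuousAt (fun q => (q - K.p)⁻¹) q :=
    ContinuousAt.inv₀ (by fun_prop) (K.ne_p hq)
  have h3 : ∀ᶠ q' in 𝓝 q, q' - K.p ≠ 0 :=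
    (ContinuousAt.eventually_ne (g := fun q' => q' - K.p) (by fun_prop) (K.ne_p hq))
  filter_upwards [h2 h1, h3] with q' h4 h5
  obtain ⟨ζ, hζ, h6⟩ := h4
  have := K.fw ζ hζ (by rw [h6]; exact inv_ne_zero h5)
  rw [h6] at this
  simpa using this

lemma Geo.φ_an (K : Geo Γ A) {q : ℂ} (hq : q ∈ Γᶜ ∪ A) : AnalyticAt ℂ K.φ q := by
  have h1 : AnalyticAt ℂ K.g ((q - K.p)⁻¹) := by
    rw [← K.fφ hq]
    exact inv_analytic Str_open K.fd K.gf (K.φ_mem hq)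
  have h2 : AnalyticAt ℂ (fun q => (q - K.p)⁻¹) q :=
    (analyticAt_id.sub analyticAt_const).inv (K.ne_p hq)
  exact AnalyticAt.comp (g := K.g) h1 h2

/-- positive side -/
def Geo.Om (K : Geo Γ A) : Set ℂ := {q | q ∉ Γ ∧ 0 < (K.φ q).im}

lemma Geo.F_mem (K : Geo Γ A) (hA : A ⊆ Γ) {ζ : ℂ} (hζ : ζ ∈ Str) (h0 : K.f ζ ≠ 0)
    (him : ζ.im ≠ 0) : (K.f ζ)⁻¹ + K.p ∉ Γ := by
  have h1 := K.fw ζ hζ h0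
  rcases h1 with h | h
  · exact h
  · exfalso
    have := K.bwr _ h
    simp only [add_sub_cancel_right, inv_inv, K.gf ζ hζ] at this
    exact him this

lemma Geo.Om_eq (K : Geo Γ A) (hA : A ⊆ Γ) :
    ∃ z : ℂ, K.Om = (fun ζ => (K.f ζ)⁻¹ + K.p) '' (HS \ {z}) ∧ K.f z = 0 := by
  obtain ⟨z, hz, hz0⟩ := K.zer
  refine ⟨z, ?_, hz0⟩
  ext q
  constructor
  · rintro ⟨h1, h2⟩
    have hq : q ∈ Γᶜ ∪ A := Or.inl h1
    refine ⟨K.φ q, ⟨⟨h2, (abs_lt.mp (K.φ_mem hq)).2⟩, ?_⟩, K.Fφ hq⟩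
    intro h3
    rw [mem_singleton_iff] at h3
    apply K.fφ_ne hq
    rw [h3]; exact hz0
  · rintro ⟨ζ, ⟨h1, h2⟩, rfl⟩
    have h3 := HS_sub h1
    have h4 : K.f ζ ≠ 0 := by
      intro h
      exact h2 (K.inj h3 hz (h.trans hz0.symm))
    refine ⟨K.F_mem hA h3 h4 h1.1.ne', ?_⟩
    simp only
    rw [K.φF h3]; exact h1.1

lemma Geo.F_cont (K : Geo Γ A) {ζ : ℂ} (hζ : ζ ∈ Str) (h0 : K.f ζ ≠ 0) :
    ContinuousAt (fun ζ => (K.f ζ)⁻¹ + K.p) ζ :=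
  ((K.fd.continuousOn.continuousAt (Str_open.mem_nhds hζ)).inv₀ h0).add continuousAt_const

lemma Geo.Om_preconn (K : Geo Γ A) (hA : A ⊆ Γ) : IsPreconnected K.Om := by
  obtain ⟨z, h, hz⟩ := K.Om_eq hA
  rw [h]
  apply (preconn_diff_point HS_open HS_preconn z).image
  rintro ζ ⟨h1, h2⟩
  by_cases h0 : K.f ζ = 0
  · exfalso
    obtain ⟨z', hz', hz0⟩ := K.zer
    have h3 : ζ ≠ z := h2
    have hOm : (K.f ζ)⁻¹ + K.p ∈ K.Om := by rw [h]; exact ⟨ζ, ⟨h1, h2⟩, rfl⟩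
    rw [h0, inv_zero, zero_add] at hOm
    exact hOm.1 K.pΓ
  · exact (K.F_cont (HS_sub h1) h0).continuousWithinAt

lemma Geo.Om_open (K : Geo Γ A) (hΓ : IsClosed Γ) : IsOpen K.Om := by
  rw [isOpen_iff_mem_nhds]
  rintro q ⟨h1, h2⟩
  have h3 := (K.φ_an (Or.inl h1)).continuousAt
  have h4 : ContinuousAt (fun q => (K.φ q).im) q := Complex.continuous_im.continuousAt.comp h3
  filter_upwards [hΓ.isOpen_compl.mem_nhds h1, h4.eventually (lt_mem_nhds h2)] with x a b
  exact ⟨a, b⟩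

lemma Geo.A_closure (K : Geo Γ A) (hA : A ⊆ Γ) : A ⊆ closure K.Om := by
  intro q hq
  have hqD : q ∈ Γᶜ ∪ A := Or.inr hq
  have h0 := K.fφ_ne hqD
  have h1 := K.φ_mem hqD
  have him := (K.im_zero hqD).mpr hq
  have hc := K.F_cont h1 h0
  have ht : Tendsto (fun t : ℝ => K.φ q + t * I) (𝓝[>] 0) (𝓝 (K.φ q)) := by
    have : Continuous (fun t : ℝ => K.φ q + t * I) := by fun_prop
    have h2 := this.tendsto 0
    simp only [ofReal_zero, zero_mul, add_zero] at h2
    exact h2.mono_left nhdsWithin_le_nhds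
  have ht2 := hc.tendsto.comp ht
  simp only [K.Fφ hqD] at ht2
  apply mem_closure_of_tendsto ht2
  have hfc : ContinuousAt K.f (K.φ q) := K.fd.continuousOn.continuousAt (Str_open.mem_nhds h1)
  filter_upwards [ht.eventually (hfc.eventually_ne h0), eventually_mem_nhdsWithin,
    ht.eventually (Str_open.mem_nhds h1)] with t h3 h4 h5
  have h4' : (0:ℝ) < t := h4
  have him2 : (K.φ q + t * I).im = t := by simp [him]
  refine ⟨K.F_mem hA h5 h3 (by rw [him2]; exact h4'.ne'), ?_⟩
  simp only [Function.comp]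
  rw [K.φF h5, him2]; exact h4'

lemma Geo.Om_cover (K : Geo Γ A) (hA : A ⊆ Γ) : Γᶜ ⊆ K.Om ∪ K.flip.Om := by
  intro q hq
  have h1 : (K.φ q).im ≠ 0 := by
    intro h
    exact hq (hA ((K.im_zero (Or.inl hq)).mp h))
  rcases lt_or_gt_of_ne h1 with h | h
  · right
    refine ⟨hq, ?_⟩
    rw [K.flip_φ, neg_im]; linarith
  · exact Or.inl ⟨hq, h⟩

lemma Geo.Om_disj (K : Geo Γ A) : Disjoint K.Om K.flip.Om := by
  rw [Set.disjoint_left]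
  rintro q ⟨_, h1⟩ ⟨_, h2⟩
  rw [K.flip_φ, neg_im] at h2
  linarith

lemma Geo.Om_sub (K : Geo Γ A) (L : Geo Γ B) (hΓ : IsClosed Γ) (hA : A ⊆ Γ) (hB : B ⊆ Γ) {q : ℂ}
    (hk : q ∈ K.Om) (hl : q ∈ L.Om) : K.Om ⊆ L.Om := by
  apply IsPreconnected.subset_left_of_subset_union (L.Om_open hΓ) (L.flip.Om_open hΓ) L.Om_disj
    (Subset.trans (fun x hx => hx.1) (L.Om_cover hB)) ⟨q, hk, hl⟩ (K.Om_preconn hA)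

lemma Geo.Om_eq_Om (K : Geo Γ A) (L : Geo Γ B) (hΓ : IsClosed Γ) (hA : A ⊆ Γ) (hB : B ⊆ Γ) {q : ℂ}
    (hk : q ∈ K.Om) (hl : q ∈ L.Om) : K.Om = L.Om :=
  (K.Om_sub L hΓ hA hB hk hl).antisymm (L.Om_sub K hΓ hB hA hl hk)

/-- transition map -/
noncomputable def trans (K : Geo Γ A) (L : Geo Γ B) (ζ : ℂ) : ℂ :=
  L.g (K.f ζ / (1 + (K.p - L.p) * K.f ζ))

lemma trans_den (K : Geo Γ A) (L : Geo Γ B) (hA : A ⊆ Γ) {ζ : ℂ} (hζ : ζ ∈ HS) :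
    1 + (K.p - L.p) * K.f ζ ≠ 0 := by
  intro h
  by_cases h0 : K.f ζ = 0
  · rw [h0] at h; simp at h
  have h1 := K.F_mem hA (HS_sub hζ) h0 hζ.1.ne'
  apply h1
  have : (K.f ζ)⁻¹ + K.p = L.p := by
    field_simp
    linear_combination h
  rw [this]; exact L.pΓ

lemma trans_spec (K : Geo Γ A) (L : Geo Γ B) (hA : A ⊆ Γ) (hB : B ⊆ Γ)
    (hKL : K.Om = L.Om) {ζ : ℂ} (hζ : ζ ∈ HS) :
    trans K L ζ ∈ HS ∧ L.f (trans K L ζ) = K.f ζ / (1 + (K.p - L.p) * K.f ζ) := by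
  have hden := trans_den K L hA hζ
  by_cases h0 : K.f ζ = 0
  · have hT : trans K L ζ = L.g 0 := by simp [trans, h0]
    obtain ⟨z, hz, hz0⟩ := L.zer
    have hg0 : L.g 0 = z := by rw [← hz0, L.gf z hz]
    have hzim : z.im ≠ 0 := fun h => (L.real z hz h).1 hz0
    have hzpos : 0 ≤ z.im := by
      -- points near `∞`
      have hgan : AnalyticAt ℂ L.g 0 := by
        rw [← hz0]; exact inv_analytic Str_open L.fd L.gf hz
      have hfc : ContinuousAt K.f ζ := K.fd.continuousOn.continuousAt (Str_open.mem_nhds (HS_sub hζ))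
      have hm : ContinuousAt (fun x => K.f x / (1 + (K.p - L.p) * K.f x)) ζ := by
        apply ContinuousAt.div hfc (continuousAt_const.add (continuousAt_const.mul hfc)) hden
      have hTc : Tendsto (trans K L) (𝓝[≠] ζ) (𝓝 z) := by
        have h1 : ContinuousAt L.g (K.f ζ / (1 + (K.p - L.p) * K.f ζ)) := by
          rw [h0, zero_div]; exact hgan.continuousAt
        have h2 : ContinuousAt (trans K L) ζ := ContinuousAt.comp (g := L.g) h1 hm
        have h3 := h2.tendsto
        rw [hT, hg0] at h3
        exact h3.mono_left nhdsWithin_le_nhds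
      have hTi : Tendsto (fun x => (trans K L x).im) (𝓝[≠] ζ) (𝓝 z.im) :=
        (Complex.continuous_im.tendsto z).comp hTc
      apply ge_of_tendsto hTi
      filter_upwards [mem_nhdsWithin_of_mem_nhds (HS_open.mem_nhds hζ), eventually_mem_nhdsWithin]
        with x hx hne
      have hx0 : K.f x ≠ 0 := by
        intro h
        exact hne (K.inj (HS_sub hx) (HS_sub hζ) (h.trans h0.symm))
      have hxO : (K.f x)⁻¹ + K.p ∈ K.Om :=
        ⟨K.F_mem hA (HS_sub hx) hx0 hx.1.ne', by rw [K.φF (HS_sub hx)]; exact hx.1⟩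
      rw [hKL] at hxO
      have h2 := hxO.2
      have : L.φ ((K.f x)⁻¹ + K.p) = trans K L x := by
        simp only [Geo.φ, trans]
        congr 1
        rw [inv_eq_one_div, div_eq_div_iff]
        · field_simp; ring
        · exact L.ne_p (Or.inl hxO.1)
        · exact trans_den K L hA hx
      rw [← this]; exact h2.le
    refine ⟨?_, ?_⟩
    · rw [hT, hg0]
      exact ⟨lt_of_le_of_ne hzpos hzim.symm, (abs_lt.mp hz).2⟩
    · rw [hT, hg0, hz0, h0]; simp
  · have hxO : (K.f ζ)⁻¹ + K.p ∈ K.Om :=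
        ⟨K.F_mem hA (HS_sub hζ) h0 hζ.1.ne', by rw [K.φF (HS_sub hζ)]; exact hζ.1⟩
    rw [hKL] at hxO
    have h2 := hxO.2
    have hinv : ((K.f ζ)⁻¹ + K.p - L.p)⁻¹ = K.f ζ / (1 + (K.p - L.p) * K.f ζ) := by
      rw [inv_eq_one_div, div_eq_div_iff]
      · field_simp; ring
      · exact L.ne_p (Or.inl hxO.1)
      · exact hden
    have h3 : L.φ ((K.f ζ)⁻¹ + K.p) = trans K L ζ := by
      simp only [Geo.φ, trans]
      rw [hinv]
    have h4 := L.fφ (Or.inl hxO.1)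
    have h5 := L.φ_mem (Or.inl hxO.1)
    rw [h3] at h4 h5 h2
    exact ⟨⟨h2, (abs_lt.mp h5).2⟩, by rw [h4, hinv]⟩

lemma trans_diff (K : Geo Γ A) (L : Geo Γ B) (hA : A ⊆ Γ) (hB : B ⊆ Γ)
    (hKL : K.Om = L.Om) : DifferentiableOn ℂ (trans K L) HS := by
  intro ζ hζ
  have h1 := trans_spec K L hA hB hKL hζ
  have h2 : AnalyticAt ℂ L.g (K.f ζ / (1 + (K.p - L.p) * K.f ζ)) := by
    rw [← h1.2]; exact inv_analytic Str_open L.fd L.gf (HS_sub h1.1)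
  have hfc : DifferentiableAt ℂ K.f ζ := K.fd.differentiableAt (Str_open.mem_nhds (HS_sub hζ))
  have h3 : DifferentiableAt ℂ (fun x => K.f x / (1 + (K.p - L.p) * K.f x)) ζ :=
    hfc.div ((differentiableAt_const _).add ((differentiableAt_const _).mul hfc)) (trans_den K L hA hζ)
  exact (DifferentiableAt.comp (g := L.g) ζ h2.differentiableAt h3).differentiableWithinAt

lemma trans_trans (K : Geo Γ A) (L : Geo Γ B) (hA : A ⊆ Γ) (hB : B ⊆ Γ)
    (hKL : K.Om = L.Om) {ζ : ℂ} (hζ : ζ ∈ HS) : trans L K (trans K L ζ) = ζ := by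
  have h1 := trans_spec K L hA hB hKL hζ
  have h2 := trans_den K L hA hζ
  rw [trans, h1.2]
  have : K.f ζ / (1 + (K.p - L.p) * K.f ζ) / (1 + (L.p - K.p) * (K.f ζ / (1 + (K.p - L.p) * K.f ζ))) = K.f ζ := by
    have h3 : 1 + (L.p - K.p) * (K.f ζ / (1 + (K.p - L.p) * K.f ζ)) = 1 / (1 + (K.p - L.p) * K.f ζ) := by
      rw [eq_div_iff h2, add_mul, mul_assoc, div_mul_cancel₀ _ h2]
      ring
    rw [h3, div_div_eq_mul_div, div_one, div_mul_cancel₀ _ h2]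
  rw [this, K.gf _ (HS_sub hζ)]

end PG

/-! Part D4: angle inequality -/

namespace PG
open Filter Topology

variable {Γ A B : Set ℂ}

lemma pi_ne : (Real.pi : ℂ) ≠ 0 := by exact_mod_cast Real.pi_ne_zero

lemma exp_UH {ζ : ℂ} (h : ζ ∈ HS) : Complex.exp (Real.pi * ζ) ∈ UH := by
  show 0 < (Complex.exp (Real.pi * ζ)).im
  rw [Complex.exp_im]
  apply mul_pos (Real.exp_pos _)
  apply Real.sin_pos_of_pos_of_lt_pi
  · simp; exact mul_pos Real.pi_pos h.1
  · simp
    have := mul_lt_mul_of_pos_left h.2 Real.pi_pos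
    linarith

lemma log_exp_HS {ζ : ℂ} (h : ζ ∈ Str) : Complex.log (Complex.exp (Real.pi * ζ)) = Real.pi * ζ := by
  have h' : -1 < ζ.im ∧ ζ.im < 1 := abs_lt.mp h
  apply Complex.log_exp
  · simp
    have := mul_lt_mul_of_pos_left h'.1 Real.pi_pos
    linarith
  · simp
    have := mul_lt_mul_of_pos_left h'.2 Real.pi_pos
    linarith

lemma log_HS {z : ℂ} (h : z ∈ UH) : Complex.log z / Real.pi ∈ HS := by
  have h1 : 0 < z.im := h
  have h2 : (Complex.log z / Real.pi).im = arg z / Real.pi := by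
    rw [Complex.div_ofReal_im, Complex.log_im]
  have h3 : 0 < arg z := by
    rcases lt_or_eq_of_le (Complex.arg_nonneg_iff.mpr h1.le) with h | h
    · exact h
    · exfalso
      have := (Complex.arg_eq_zero_iff.mp h.symm).2
      linarith
  have h4 : arg z < Real.pi := by
    rcases lt_or_eq_of_le (Complex.arg_le_pi z) with h | h
    · exact h
    · exfalso
      have := (Complex.arg_eq_pi_iff.mp h).2
      linarith
  constructor
  · rw [h2]; exact div_pos h3 Real.pi_pos
  · rw [h2, div_lt_one Real.pi_pos]; exact h4

lemma UH_slit {z : ℂ} (h : z ∈ UH) : z ∈ slitPlane := Or.inr (ne_of_gt h)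

lemma UH_ne {z : ℂ} (h : z ∈ UH) : z ≠ 0 := slitPlane_ne_zero (UH_slit h)

lemma exp_pi_log {z : ℂ} (h : z ≠ 0) : Complex.exp (Real.pi * (Complex.log z / Real.pi)) = z := by
  rw [mul_div_cancel₀ _ pi_ne, Complex.exp_log h]

/-- the transition conjugated to the half plane -/
noncomputable def hmap (K : Geo Γ A) (L : Geo Γ B) (z : ℂ) : ℂ :=
  Complex.exp (Real.pi * trans K L (Complex.log z / Real.pi))

lemma hmap_maps (K : Geo Γ A) (L : Geo Γ B) (hA : A ⊆ Γ) (hB : B ⊆ Γ)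
    (hKL : K.Om = L.Om) : MapsTo (hmap K L) UH UH := by
  intro z hz
  exact exp_UH (trans_spec K L hA hB hKL (log_HS hz)).1

lemma hmap_diff (K : Geo Γ A) (L : Geo Γ B) (hA : A ⊆ Γ) (hB : B ⊆ Γ)
    (hKL : K.Om = L.Om) : DifferentiableOn ℂ (hmap K L) UH := by
  have h1 : DifferentiableOn ℂ (fun z => Complex.log z / Real.pi) UH := by
    intro z hz
    exact ((Complex.differentiableAt_log (UH_slit hz)).div_const _).differentiableWithinAt
  have h2 := (trans_diff K L hA hB hKL).comp h1 (fun z hz => log_HS hz)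
  exact (h2.const_mul (Real.pi : ℂ)).cexp

lemma hmap_inv (K : Geo Γ A) (L : Geo Γ B) (hA : A ⊆ Γ) (hB : B ⊆ Γ)
    (hKL : K.Om = L.Om) : ∀ z ∈ UH, hmap L K (hmap K L z) = z := by
  intro z hz
  have h1 := (trans_spec K L hA hB hKL (log_HS hz)).1
  rw [hmap, hmap, log_exp_HS (HS_sub h1), mul_div_cancel_left₀ _ pi_ne,
    trans_trans K L hA hB hKL (log_HS hz), exp_pi_log (UH_ne hz)]

lemma trans_im (K : Geo Γ A) (L : Geo Γ B) (hA : A ⊆ Γ) (hB : B ⊆ Γ) (hAB : Disjoint A B)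
    (hKL : K.Om = L.Om) {ζ : ℂ} (hζ : ζ ∈ HS) : 1 ≤ ζ.im + (trans K L ζ).im := by
  obtain ⟨a, b, c, d, hdet, hmob⟩ := aut_UH (hmap_diff K L hA hB hKL) (hmap_diff L K hB hA hKL.symm)
    (hmap_maps K L hA hB hKL) (hmap_maps L K hB hA hKL.symm) (hmap_inv K L hA hB hKL)
  have hx : ∀ x : ℝ, 0 < x → (a * x + b) * (c * x + d) ≤ 0 := by
    intro x hx
    by_contra hcon
    push Not at hcon
    have hcd : c * x + d ≠ 0 := by
      intro h; rw [h, mul_zero] at hcon; exact lt_irrefl _ hcon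
    have hy : 0 < (a * x + b) / (c * x + d) := by
      have : (a * x + b) / (c * x + d) = ((a * x + b) * (c * x + d)) / (c * x + d) ^ 2 := by
        field_simp
      rw [this]
      exact div_pos hcon (by positivity)
    set y := (a * x + b) / (c * x + d) with hydef
    have hcdc : (c * x + d : ℂ) ≠ 0 := by exact_mod_cast hcd
    have ht : Tendsto (fun t : ℝ => (x : ℂ) + t * I) (𝓝[>] 0) (𝓝 (x : ℂ)) := by
      have : Continuous (fun t : ℝ => (x : ℂ) + t * I) := by fun_prop
      have h2 := this.tendsto 0
      simp only [ofReal_zero, zero_mul, add_zero] at h2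
      exact h2.mono_left nhdsWithin_le_nhds
    have hUH : ∀ᶠ t : ℝ in 𝓝[>] 0, (x : ℂ) + t * I ∈ UH := by
      filter_upwards [eventually_mem_nhdsWithin] with t ht
      show 0 < ((x : ℂ) + t * I).im
      simpa using ht
    have hxs : (x : ℂ) ∈ slitPlane := Or.inl (by simpa using hx)
    have hys : (y : ℂ) ∈ slitPlane := Or.inl (by simpa using hy)
    have hζt : Tendsto (fun t : ℝ => Complex.log ((x : ℂ) + t * I) / Real.pi) (𝓝[>] 0)
        (𝓝 (Complex.log x / Real.pi)) :=
      ((continuousAt_clog hxs).tendsto.comp ht).div_const _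
    have hh : Tendsto (fun t : ℝ => hmap K L ((x : ℂ) + t * I)) (𝓝[>] 0) (𝓝 (y : ℂ)) := by
      have h1 : ContinuousAt (fun z : ℂ => (a * z + b) / (c * z + d)) (x : ℂ) :=
        ContinuousAt.div (by fun_prop) (by fun_prop) hcdc
      have h2 := h1.tendsto.comp ht
      have h3 : (a * x + b : ℂ) / (c * x + d) = y := by rw [hydef]; push_cast; rfl
      simp only [h3] at h2
      apply h2.congr'
      have h4 : ∀ᶠ z : ℂ in 𝓝 (x : ℂ), (c * z + d : ℂ) ≠ 0 :=
        ContinuousAt.eventually_ne (g := fun z : ℂ => c * z + d) (by fun_prop) hcdc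
      filter_upwards [hUH, ht.eventually h4] with t h5 h6
      simp only [Function.comp]
      rw [div_eq_iff h6, hmob _ h5]
    have hΨ : Tendsto (fun t : ℝ => trans K L (Complex.log ((x : ℂ) + t * I) / Real.pi)) (𝓝[>] 0)
        (𝓝 (Complex.log y / Real.pi)) := by
      have h1 := ((continuousAt_clog hys).tendsto.comp hh).div_const (Real.pi : ℂ)
      apply h1.congr'
      filter_upwards [hUH] with t h2
      simp only [Function.comp]
      rw [hmap, log_exp_HS (HS_sub (trans_spec K L hA hB hKL (log_HS h2)).1),
        mul_div_cancel_left₀ _ pi_ne]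
    have hreal : ∀ s : ℝ, 0 < s → (Complex.log s / Real.pi).im = 0 := by
      intro s hs
      rw [← Complex.ofReal_log hs.le, ← Complex.ofReal_div, Complex.ofReal_im]
    have hstr : ∀ s : ℝ, 0 < s → Complex.log s / Real.pi ∈ Str := by
      intro s hs
      show |_| < (1:ℝ)
      rw [hreal s hs]; simp
    have hfK : ContinuousAt K.f (Complex.log x / Real.pi) :=
      K.fd.continuousOn.continuousAt (Str_open.mem_nhds (hstr x hx))
    have hfL : ContinuousAt L.f (Complex.log y / Real.pi) :=
      L.fd.continuousOn.continuousAt (Str_open.mem_nhds (hstr y hy))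
    have hK := hfK.tendsto.comp hζt
    have hL := hfL.tendsto.comp hΨ
    have hlim := hL.mul ((tendsto_const_nhds (x := (1:ℂ))).add ((tendsto_const_nhds (x := K.p - L.p)).mul hK))
    have heq := tendsto_nhds_unique (hlim.congr' (by
      filter_upwards [hUH] with t h2
      simp only [Function.comp]
      have h3 := (trans_spec K L hA hB hKL (log_HS h2)).2
      rw [h3, div_mul_cancel₀ _ (trans_den K L hA (log_HS h2))])) hK
    obtain ⟨hk0, hkA⟩ := K.real _ (hstr x hx) (hreal x hx)
    obtain ⟨hl0, hlB⟩ := L.real _ (hstr y hy) (hreal y hy)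
    apply Set.disjoint_left.mp hAB hkA
    have : (K.f (Complex.log x / Real.pi))⁻¹ + K.p = (L.f (Complex.log y / Real.pi))⁻¹ + L.p := by
      field_simp
      linear_combination heq
    rw [this]; exact hlB
  have hz := exp_UH hζ
  set z := Complex.exp (Real.pi * ζ) with hzdef
  have h1 := hmob z hz
  have hT := (trans_spec K L hA hB hKL hζ).1
  have hmz : hmap K L z = Complex.exp (Real.pi * trans K L ζ) := by
    rw [hmap, hzdef, log_exp_HS (HS_sub hζ), mul_div_cancel_left₀ _ pi_ne]
  have h2 := mob_alg hdet hx ‖z‖ z.re (norm_nonneg _) (Complex.abs_re_le_norm z)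
  have hden : (c * z + d : ℂ) ≠ 0 := by
    intro h
    have h3 : (c * z + d : ℂ).im = 0 := by rw [h]; rfl
    simp at h3
    have hzi : z.im ≠ 0 := ne_of_gt hz
    rcases h3 with h3 | h3
    · rw [h3] at h
      have hd0 : d = 0 := by simpa using h
      rw [h3, hd0] at hdet; simp at hdet
    · exact hzi h3
  have h4 : (z * hmap K L z).im ≤ 0 := by
    have h5 : z * hmap K L z = (z * (a * z + b) * (starRingEnd ℂ) (c * z + d)) / (normSq (c * z + d) : ℂ) := by
      rw [Complex.normSq_eq_conj_mul_self, ← h1]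
      have h3 : (starRingEnd ℂ) (c * z + d) ≠ 0 := (map_ne_zero _).mpr hden
      rw [eq_div_iff (mul_ne_zero h3 hden)]
      ring
    rw [h5, Complex.div_ofReal_im]
    apply div_nonpos_of_nonpos_of_nonneg _ (Complex.normSq_nonneg _)
    have h6 : (z * (a * z + b) * (starRingEnd ℂ) (c * z + d)).im
        = z.im * (a * c * ‖z‖ ^ 2 + 2 * (a * d) * z.re + b * d) := by
      rw [Complex.sq_norm, Complex.normSq_apply]
      simp
      ring
    rw [h6]
    exact mul_nonpos_of_nonneg_of_nonpos (le_of_lt hz) h2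
  rw [hmz, hzdef, ← Complex.exp_add, Complex.exp_im] at h4
  have h5 : Real.sin ((Real.pi * ζ + Real.pi * trans K L ζ : ℂ).im) ≤ 0 := by
    by_contra h
    push Not at h
    have := mul_pos (Real.exp_pos ((Real.pi * ζ + Real.pi * trans K L ζ : ℂ).re)) h
    linarith
  by_contra hcon
  push Not at hcon
  have h6 : (Real.pi * ζ + Real.pi * trans K L ζ : ℂ).im = Real.pi * (ζ.im + (trans K L ζ).im) := by
    simp; ring
  rw [h6] at h5
  have := Real.sin_pos_of_pos_of_lt_pi (mul_pos Real.pi_pos (add_pos hζ.1 hT.1))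
    (by nlinarith [Real.pi_pos])
  linarith

lemma trans_φ (K : Geo Γ A) (L : Geo Γ B) {q : ℂ} (hq : q ∉ Γ) : trans K L (K.φ q) = L.φ q := by
  have h1 := K.fφ (Or.inl hq)
  have h2 := K.ne_p (Or.inl hq)
  have h3 := L.ne_p (Or.inl hq)
  rw [trans, h1, Geo.φ]
  congr 1
  have h4 : 1 + (K.p - L.p) * (q - K.p)⁻¹ = (q - L.p) / (q - K.p) := by
    field_simp; ring
  rw [h4]; field_simp

lemma angle_ineq (K : Geo Γ A) (L : Geo Γ B) (hΓ : IsClosed Γ) (hA : A ⊆ Γ) (hB : B ⊆ Γ)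
    (hAB : Disjoint A B) {q : ℂ} (hq : q ∉ Γ) : 1 ≤ |(K.φ q).im| + |(L.φ q).im| := by
  have key : ∀ (K : Geo Γ A) (L : Geo Γ B), q ∈ K.Om → q ∈ L.Om →
      1 ≤ |(K.φ q).im| + |(L.φ q).im| := by
    intro K L h1 h2
    have h3 := K.φ_mem (Or.inl hq)
    have := trans_im K L hA hB hAB (K.Om_eq_Om L hΓ hA hB h1 h2) (ζ := K.φ q)
      ⟨h1.2, (abs_lt.mp h3).2⟩
    rw [trans_φ K L hq] at this
    rw [abs_of_pos h1.2, abs_of_pos h2.2]; exact this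
  rcases K.Om_cover hA hq with h1 | h1 <;> rcases L.Om_cover hB hq with h2 | h2
  · exact key K L h1 h2
  · have := key K L.flip h1 h2
    rwa [L.flip_φ, neg_im, abs_neg] at this
  · have := key K.flip L h1 h2
    rwa [K.flip_φ, neg_im, abs_neg] at this
  · have := key K.flip L.flip h1 h2
    rwa [K.flip_φ, L.flip_φ, neg_im, neg_im, abs_neg, abs_neg] at this

end PG

/-! Part D5: the system of a piecewise geodesic curve -/

namespace PG
open Filter Topology

variable {n : ℕ} {Z Γ A : Set ℂ} {γ : Fin n → Set ℂ}

open Classical in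
/-- the angle function -/
noncomputable def Geo.α (K : Geo Γ A) (q : ℂ) : ℝ := if q ∈ Γᶜ ∪ A then |(K.φ q).im| else 1

lemma Geo.α_in (K : Geo Γ A) {q : ℂ} (h : q ∈ Γᶜ ∪ A) : K.α q = |(K.φ q).im| := if_pos h

lemma Geo.α_out (K : Geo Γ A) {q : ℂ} (h : q ∉ Γᶜ ∪ A) : K.α q = 1 := if_neg h

lemma Geo.α_nonneg (K : Geo Γ A) (q : ℂ) : 0 ≤ K.α q := by
  by_cases h : q ∈ Γᶜ ∪ A
  · rw [K.α_in h]; positivity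
  · rw [K.α_out h]; norm_num

lemma Geo.α_le (K : Geo Γ A) (q : ℂ) : K.α q ≤ 1 := by
  by_cases h : q ∈ Γᶜ ∪ A
  · rw [K.α_in h]; exact le_of_lt (K.φ_mem h)
  · rw [K.α_out h]

lemma Geo.α_cont (K : Geo Γ A) {q : ℂ} (h : q ∈ Γᶜ ∪ A) : ContinuousAt K.α q := by
  have h1 : ContinuousAt (fun q => |(K.φ q).im|) q :=
    (Complex.continuous_im.continuousAt.comp (K.φ_an h).continuousAt).abs
  apply h1.congr
  filter_upwards [K.D_open.mem_nhds h] with x hx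
  exact (K.α_in hx).symm

lemma Geo.α_zero (K : Geo Γ A) (q : ℂ) : K.α q = 0 ↔ q ∈ A := by
  by_cases h : q ∈ Γᶜ ∪ A
  · rw [K.α_in h, abs_eq_zero, K.im_zero h]
  · rw [K.α_out h]
    constructor
    · intro h; norm_num at h
    · intro h'; exact absurd (Or.inr h') h

/-- system from geodesic data -/
noncomputable def mkSys (hn : 0 < n) (hΓ : IsClosed Γ) (hZ : Z ⊆ Γ) (hne : ∃ q, q ∉ Γ)
    (hun : ∀ p ∈ Γ, p ∉ Z → ∃ k, p ∈ γ k) (hsub : ∀ k, ∀ p ∈ γ k, p ∈ Γ ∧ p ∉ Z)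
    (hnon : ∀ k, (γ k).Nonempty) (hdis : ∀ j k, j ≠ k → Disjoint (γ j) (γ k))
    (K : ∀ k, Geo Γ (γ k)) : Sys n Z := by
  have hγ : ∀ k, γ k ⊆ Γ := fun k p hp => (hsub k p hp).1
  have hone : ∀ j k, j ≠ k → ∀ p ∈ γ k, (K j).α p = 1 := by
    intro j k hjk p hp
    apply (K j).α_out
    rintro (h | h)
    · exact h (hγ k hp)
    · exact Set.disjoint_left.mp (hdis j k hjk) h hp
  have hang : ∀ p, p ∉ Z → Ang (fun k => (K k).α p) := by
    intro p hp
    refine ⟨fun k => (K k).α_nonneg p, fun k => (K k).α_le p, ?_⟩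
    intro i j hij
    by_cases hpΓ : p ∈ Γ
    · obtain ⟨k, hk⟩ := hun p hpΓ hp
      by_cases hik : i = k
      · have := hone j k (by rintro rfl; exact hij hik) p hk
        have h2 := (K i).α_nonneg p
        linarith
      · have := hone i k hik p hk
        have h2 := (K j).α_nonneg p
        linarith
    · rw [(K i).α_in (Or.inl hpΓ), (K j).α_in (Or.inl hpΓ)]
      exact angle_ineq (K i) (K j) hΓ (hγ i) (hγ j) (hdis i j hij) hpΓ
  exact
  { Γ := Γ
    γ := γ
    α := fun k => (K k).α
    closed := hΓ
    Zsub := hZ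
    ne := hne
    union := hun
    sub := hsub
    nonempty := hnon
    cont := by
      intro k p hp
      by_cases hpD : p ∈ Γᶜ ∪ γ k
      · exact ((K k).α_cont hpD).continuousWithinAt
      · have hpΓ : p ∈ Γ := by
          by_contra h; exact hpD (Or.inl h)
        obtain ⟨j, hj⟩ := hun p hpΓ hp
        have hkj : k ≠ j := by rintro rfl; exact hpD (Or.inr hj)
        have h1 := ((K j).α_cont (Or.inr hj)).tendsto
        rw [((K j).α_zero p).mpr hj] at h1
        have h2 : Tendsto (fun q => 1 - (K j).α q) (𝓝[Zᶜ] p) (𝓝 1) := by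
          have := (tendsto_const_nhds (x := (1:ℝ))).sub h1
          rw [sub_zero] at this
          exact this.mono_left nhdsWithin_le_nhds
        rw [ContinuousWithinAt, (K k).α_out hpD]
        apply tendsto_of_tendsto_of_tendsto_of_le_of_le' h2 tendsto_const_nhds
        · filter_upwards [eventually_mem_nhdsWithin] with q hq
          have := (hang q hq).add k j hkj
          linarith
        · exact Eventually.of_forall fun q => (K k).α_le q
    ang := hang
    zero_iff := fun p _ k => (K k).α_zero p
    one := hone
    harm := by
      intro p hp k
      have han := (K k).φ_an (Or.inl hp)
      have hne : ((K k).φ p).im ≠ 0 := fun h => hp (hγ k (((K k).im_zero (Or.inl hp)).mp h))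
      have hc : ContinuousAt (fun q => ((K k).φ q).im) p :=
        Complex.continuous_im.continuousAt.comp han.continuousAt
      rcases lt_or_gt_of_ne hne with h | h
      · refine ⟨fun q => I * (K k).φ q, analyticAt_const.mul han, ?_⟩
        filter_upwards [hΓ.isOpen_compl.mem_nhds hp, hc.eventually (gt_mem_nhds h)] with q h1 h2
        rw [(K k).α_in (Or.inl h1), abs_of_neg h2]
        simp
      · refine ⟨fun q => -I * (K k).φ q, analyticAt_const.mul han, ?_⟩
        filter_upwards [hΓ.isOpen_compl.mem_nhds hp, hc.eventually (lt_mem_nhds h)] with q h1 h2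
        rw [(K k).α_in (Or.inl h1), abs_of_pos h2]
        simp
    side := by
      intro q hq
      have key : ∀ k : Fin n, ∃ L : Geo Γ (γ k), q ∈ L.Om := by
        intro k
        rcases (K k).Om_cover (hγ k) hq with h | h
        · exact ⟨_, h⟩
        · exact ⟨_, h⟩
      choose L hL using key
      refine ⟨(L ⟨0, hn⟩).Om, (L _).Om_open hΓ, (L _).Om_preconn (hγ _), hL _, fun x hx => hx.1, ?_⟩
      intro j
      rw [(L ⟨0, hn⟩).Om_eq_Om (L j) hΓ (hγ _) (hγ _) (hL _) (hL _)]
      exact (L j).A_closure (hγ j) }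

lemma exists_geo (h : IsHypGeodesicArc Γ A) (hA : A ⊆ Γ) : Nonempty (Geo Γ A) := by
  obtain ⟨p, hp, hpA, f, hfd, hbij, him⟩ := h
  have hpA' : p ∉ A := fun h => hpA (subset_closure h)
  have hinv : ∀ ζ ∈ Str, Function.invFunOn f Str (f ζ) = ζ :=
    fun ζ hζ => hbij.injOn.leftInvOn_invFunOn hζ
  have hE : ∀ q ∈ Γᶜ ∪ A, ∃ ζ ∈ Str, f ζ = (q - p)⁻¹ := by
    intro q hq
    obtain ⟨ζ, h1, h2⟩ := hbij.surjOn (Or.inl ⟨q, hq, rfl⟩)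
    exact ⟨ζ, h1, by rw [h2]; simp⟩
  have hne : ∀ q ∈ Γᶜ ∪ A, q - p ≠ 0 := by
    intro q hq h0
    rw [sub_eq_zero] at h0
    subst h0
    rcases hq with h | h
    · exact h hp
    · exact hpA' h
  refine ⟨⟨p, f, Function.invFunOn f Str, hp, hpA', hfd, hinv, ?_, ?_, ?_, ?_, ?_⟩⟩
  · obtain ⟨ζ, h1, h2⟩ := hbij.surjOn (Or.inr rfl)
    exact ⟨ζ, h1, h2⟩
  · intro ζ hζ h0
    rcases hbij.mapsTo hζ with ⟨q, hq, h1⟩ | h1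
    · rw [← h1]; simpa using hq
    · exact absurd h1 h0
  · intro q hq
    obtain ⟨ζ, h1, h2⟩ := hE q hq
    rw [← h2, hinv ζ h1]
    exact ⟨h1, rfl⟩
  · intro ζ hζ h0
    have h1 : f ζ ∈ f '' {z : ℂ | z.im = 0} := ⟨ζ, h0, rfl⟩
    rw [him] at h1
    obtain ⟨q, hq, h2⟩ := h1
    simp only at h2
    rw [← h2]
    refine ⟨?_, by simpa using hq⟩
    rw [one_div]; exact inv_ne_zero (hne q (Or.inr hq))
  · intro q hq
    have h1 : (fun w => 1 / (w - p)) q ∈ (fun w => 1 / (w - p)) '' A := ⟨q, hq, rfl⟩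
    rw [← him] at h1
    obtain ⟨ζ, h2, h3⟩ := h1
    have h2' : ζ.im = 0 := h2
    simp only [one_div] at h3
    rw [← h3, hinv ζ (by show |ζ.im| < 1; rw [h2']; simp), h2']

end PG

/-! Part E1: transport of a locally defined cocycle along the isotopy -/

namespace PG
open Filter Topology

/-- the unit interval -/
abbrev UI : Type := unitInterval

section Transport
variable {G : Type*} [Group G] (σ : UI × ℂ → UI × ℂ → G)

/-- compatibility of the local models -/
def Compat (Z : Set ℂ) : Prop := ∀ x : UI × ℂ, x.2 ∉ Z → ∀ᶠ y in 𝓝 x, ∃ a : G,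
  ∀ᶠ y' in 𝓝 y, σ x y' = a * σ y y'

def Adm (U : Set (UI × ℂ)) (g : UI × ℂ → G) : Prop :=
  ∀ x ∈ U, ∃ a : G, ∀ᶠ y in 𝓝[U] x, g y = a * σ x y

variable {σ}

lemma Adm.mono {U V : Set (UI × ℂ)} {g : UI × ℂ → G} (h : Adm σ V g) (hUV : U ⊆ V) : Adm σ U g := by
  intro x hx
  obtain ⟨a, ha⟩ := h x (hUV hx)
  exact ⟨a, ha.filter_mono (nhdsWithin_mono _ hUV)⟩

lemma Adm.uniq {U : Set (UI × ℂ)} (hU : IsPreconnected U) {g g' : UI × ℂ → G} (h : Adm σ U g)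
    (h' : Adm σ U g') {x y : UI × ℂ} (hx : x ∈ U) (hy : y ∈ U) :
    (g x)⁻¹ * g y = (g' x)⁻¹ * g' y := by
  have hloc : ∀ x ∈ U, ∀ᶠ y in 𝓝[U] x, g' y * (g y)⁻¹ = g' x * (g x)⁻¹ := by
    intro x hx
    obtain ⟨a, ha⟩ := h x hx
    obtain ⟨b, hb⟩ := h' x hx
    have ha0 := ha.self_of_nhdsWithin hx
    have hb0 := hb.self_of_nhdsWithin hx
    filter_upwards [ha, hb] with y h1 h2
    rw [h1, h2, ha0, hb0]; group
  have hconst : g' x * (g x)⁻¹ = g' y * (g y)⁻¹ := by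
    have hp : PreconnectedSpace U := isPreconnected_iff_preconnectedSpace.mp hU
    have hlc : IsLocallyConstant (fun u : U => g' u * (g u)⁻¹) := by
      rw [IsLocallyConstant.iff_eventually_eq]
      rintro ⟨u, hu⟩
      rw [nhds_subtype_eq_comap]
      have := hloc u hu
      rw [eventually_nhdsWithin_iff] at this
      filter_upwards [preimage_mem_comap this] with v hv
      exact hv v.2
    exact hlc.apply_eq_of_isPreconnected isPreconnected_univ (x := ⟨x, hx⟩) (y := ⟨y, hy⟩) trivial trivial
  have : g' y = g' x * (g x)⁻¹ * g y := by rw [hconst]; group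
  rw [this]; group

variable {Z : Set ℂ}

/-- transport up to time `s` -/
def Q (σ : UI × ℂ → UI × ℂ → G) (p : ℂ) (s : UI) : Prop :=
  ∃ r : ℝ, 0 < r ∧ ∃ g : UI × ℂ → G, Adm σ (Iic s ×ˢ Metric.ball p r) g

lemma compat_box (hc : Compat σ Z) {x : UI × ℂ} (hx : x.2 ∉ Z) :
    ∃ N ∈ 𝓝 x.1, ∃ r > 0, ∀ y ∈ N ×ˢ Metric.ball x.2 r, ∃ a : G,
      ∀ᶠ y' in 𝓝 y, σ x y' = a * σ y y' := by
  have h := hc x hx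
  rw [← Prod.mk.eta (p := x), nhds_prod_eq] at h
  obtain ⟨N, hN, M, hM, hsub⟩ := Filter.mem_prod_iff.mp h
  obtain ⟨r, hr, hb⟩ := Metric.mem_nhds_iff.mp hM
  refine ⟨N, hN, r, hr, ?_⟩
  rintro y ⟨h1, h2⟩
  exact hsub ⟨h1, hb h2⟩

lemma Q_step (hc : Compat σ Z) {p : ℂ} (hp : p ∉ Z) (s : UI) :
    ∃ N ∈ 𝓝 s, ∀ s₁ ∈ N, ∀ s₂ ∈ N, Q σ p s₁ → Q σ p s₂ := by
  obtain ⟨N, hN, r₀, hr₀, hbox⟩ := compat_box hc (x := (s, p)) hp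
  obtain ⟨N', hN', hN'N, hord⟩ : ∃ N' ∈ 𝓝 s, N' ⊆ N ∧ N'.OrdConnected := by
    obtain ⟨ε, hε, hb⟩ := Metric.mem_nhds_iff.mp hN
    refine ⟨Metric.ball s ε, Metric.ball_mem_nhds s hε, hb, ?_⟩
    have h1 : (Metric.ball (s : ℝ) ε).OrdConnected := (convex_ball (s : ℝ) ε).ordConnected
    exact h1.preimage_mono (Subtype.mono_coe _)
  refine ⟨N', hN', ?_⟩
  intro s₁ hs₁ s₂ hs₂ hQ
  obtain ⟨r, hr, g, hg⟩ := hQ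
  rcases le_total s₂ s₁ with hle | hle
  · exact ⟨r, hr, g, hg.mono (prod_mono (Iic_subset_Iic.mpr hle) Subset.rfl)⟩
  obtain ⟨a, ha⟩ := hg (s₁, p) ⟨mem_Iic.mpr le_rfl, Metric.mem_ball_self hr⟩
  obtain ⟨b, hb⟩ := hbox (s₁, p) ⟨hN'N hs₁, Metric.mem_ball_self hr₀⟩
  have hslice : ∀ᶠ q in 𝓝 p, g (s₁, q) = a * b⁻¹ * σ (s, p) (s₁, q) := by
    have hcq : Tendsto (fun q : ℂ => (s₁, q)) (𝓝 p) (𝓝 (s₁, p)) :=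
      (Continuous.prodMk_right s₁).tendsto p
    rw [eventually_nhdsWithin_iff] at ha
    filter_upwards [hcq.eventually ha, hcq.eventually hb, Metric.ball_mem_nhds p hr] with q h1 h2 h3
    rw [h1 ⟨mem_Iic.mpr le_rfl, h3⟩, h2]; group
  obtain ⟨r', hr', hsl⟩ := Metric.mem_nhds_iff.mp hslice
  classical
  refine ⟨min r (min r₀ r'), by positivity, fun y => if y.1 ≤ s₁ then g y else a * b⁻¹ * σ (s, p) y, ?_⟩
  rintro ⟨t, q⟩ ⟨ht, hq⟩
  have ht' : t ≤ s₂ := ht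
  have hq' : dist q p < min r (min r₀ r') := hq
  have hqr : q ∈ Metric.ball p r := lt_of_lt_of_le hq' (min_le_left _ _)
  have hqr₀ : q ∈ Metric.ball p r₀ := lt_of_lt_of_le hq' ((min_le_right _ _).trans (min_le_left _ _))
  have hqr' : q ∈ Metric.ball p r' := lt_of_lt_of_le hq' ((min_le_right _ _).trans (min_le_right _ _))
  have hleft : t ≤ s₁ → ∃ c : G, ∀ᶠ y in 𝓝 (t, q), y.1 ≤ s₁ → g y = c * σ (t, q) y := by
    intro h
    obtain ⟨c, hc⟩ := hg (t, q) ⟨h, hqr⟩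
    refine ⟨c, ?_⟩
    rw [eventually_nhdsWithin_iff] at hc
    have hopen : ∀ᶠ y : UI × ℂ in 𝓝 (t, q), y.2 ∈ Metric.ball p r :=
      continuous_snd.continuousAt.eventually (Metric.isOpen_ball.mem_nhds hqr)
    filter_upwards [hc, hopen] with y h1 h2 h3
    exact h1 ⟨h3, h2⟩
  have hright : s₁ ≤ t → ∃ c : G, ∀ᶠ y in 𝓝 (t, q), a * b⁻¹ * σ (s, p) y = c * σ (t, q) y := by
    intro h
    obtain ⟨c, hc⟩ := hbox (t, q) ⟨hN'N (hord.out hs₁ hs₂ ⟨h, ht'⟩), hqr₀⟩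
    refine ⟨a * b⁻¹ * c, ?_⟩
    filter_upwards [hc] with y hy
    rw [hy]; group
  rcases lt_trichotomy t s₁ with hlt | heq | hgt
  · obtain ⟨c, hc⟩ := hleft hlt.le
    refine ⟨c, Filter.Eventually.filter_mono nhdsWithin_le_nhds ?_⟩
    have : ∀ᶠ y : UI × ℂ in 𝓝 (t, q), y.1 < s₁ :=
      continuous_fst.continuousAt.eventually (gt_mem_nhds hlt)
    filter_upwards [hc, this] with y h1 h2
    rw [if_pos h2.le, h1 h2.le]
  · subst heq
    obtain ⟨c, hc⟩ := hleft le_rfl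
    obtain ⟨d, hd⟩ := hright le_rfl
    have hc0 := hc.self_of_nhds le_rfl
    have hd0 := hd.self_of_nhds
    have h0 : g (t, q) = a * b⁻¹ * σ (s, p) (t, q) := hsl hqr'
    have hcd : c = d := by
      have : c * σ (t, q) (t, q) = d * σ (t, q) (t, q) := by rw [← hc0, ← hd0, h0]
      exact mul_right_cancel this
    refine ⟨c, Filter.Eventually.filter_mono nhdsWithin_le_nhds ?_⟩
    filter_upwards [hc, hd] with y h1 h2
    by_cases hy : y.1 ≤ t
    · rw [if_pos hy, h1 hy]
    · rw [if_neg hy, h2, hcd]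
  · obtain ⟨c, hc⟩ := hright hgt.le
    refine ⟨c, Filter.Eventually.filter_mono nhdsWithin_le_nhds ?_⟩
    have : ∀ᶠ y : UI × ℂ in 𝓝 (t, q), s₁ < y.1 :=
      continuous_fst.continuousAt.eventually (lt_mem_nhds hgt)
    filter_upwards [hc, this] with y h1 h2
    rw [if_neg h2.not_ge, h1]

lemma Q_all (hc : Compat σ Z) {p : ℂ} (hp : p ∉ Z) (s : UI) : Q σ p s := by
  have hclopen : IsClopen {s | Q σ p s} := by
    rw [isClopen_iff_frontier_eq_empty, Set.eq_empty_iff_forall_notMem]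
    intro s hs
    obtain ⟨N, hN, hstep⟩ := Q_step hc hp s
    rw [frontier_eq_closure_inter_closure] at hs
    obtain ⟨u, hu1, hu2⟩ := mem_closure_iff_nhds.mp hs.1 N hN
    obtain ⟨v, hv1, hv2⟩ := mem_closure_iff_nhds.mp hs.2 N hN
    exact hv2 (hstep u hu1 v hv1 hu2)
  have h0 : Q σ p 0 := by
    obtain ⟨N, hN, r, hr, hbox⟩ := compat_box hc (x := ((0 : UI), p)) hp
    refine ⟨r, hr, σ (0, p), ?_⟩
    rintro ⟨t, q⟩ ⟨ht, hq⟩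
    have ht0 : t = 0 := le_antisymm ht bot_le
    subst ht0
    obtain ⟨a, ha⟩ := hbox (0, q) ⟨mem_of_mem_nhds hN, hq⟩
    exact ⟨a, ha.filter_mono nhdsWithin_le_nhds⟩
  have := hclopen.eq_univ ⟨0, h0⟩
  exact (this ▸ mem_univ s : s ∈ {s | Q σ p s})

theorem transport (hZc : IsClosed Z) (hc : Compat σ Z) : ∃ w : ℂ → G, ∀ p, p ∉ Z → ∃ u : G,
    ∀ᶠ q in 𝓝 p, w q = (σ (1, p) (1, q))⁻¹ * u * σ (0, p) (0, q) := by
  classical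
  have hex : ∀ q, q ∉ Z → ∃ g : UI × ℂ → G, Adm σ (univ ×ˢ {q}) g := by
    intro q hq
    obtain ⟨r, hr, g, hg⟩ := Q_all hc hq 1
    refine ⟨g, hg.mono ?_⟩
    rintro ⟨t, x⟩ ⟨_, hx⟩
    exact ⟨unitInterval.le_one', by rw [mem_singleton_iff.mp hx]; exact Metric.mem_ball_self hr⟩
  choose! γ hγ using hex
  refine ⟨fun q => (γ q (1, q))⁻¹ * γ q (0, q), ?_⟩
  intro p hp
  obtain ⟨r, hr, g, hg⟩ := Q_all hc hp 1
  have hIic : (Iic (1 : UI)) = univ := Iic_top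
  rw [hIic] at hg
  obtain ⟨a, ha⟩ := hg (0, p) ⟨trivial, Metric.mem_ball_self hr⟩
  obtain ⟨b, hb⟩ := hg (1, p) ⟨trivial, Metric.mem_ball_self hr⟩
  rw [eventually_nhdsWithin_iff] at ha hb
  refine ⟨b⁻¹ * a, ?_⟩
  have hcq : ∀ s : UI, Tendsto (fun q : ℂ => (s, q)) (𝓝 p) (𝓝 (s, p)) := fun s =>
    (Continuous.prodMk_right s).tendsto p
  have hZ : ∀ᶠ q in 𝓝 p, q ∉ Z := hZc.isOpen_compl.mem_nhds hp
  filter_upwards [(hcq 0).eventually ha, (hcq 1).eventually hb, Metric.ball_mem_nhds p hr, hZ]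
    with q h1 h2 h3 h4
  have hpc : IsPreconnected ((univ : Set UI) ×ˢ ({q} : Set ℂ)) :=
    isPreconnected_univ.prod isPreconnected_singleton
  have hgq : Adm σ (univ ×ˢ {q}) g := by
    apply hg.mono
    rintro ⟨t, x⟩ ⟨_, hx⟩
    exact ⟨trivial, by rw [mem_singleton_iff.mp hx]; exact h3⟩
  rw [(hγ q h4).uniq hpc hgq (x := (1, q)) (y := (0, q)) ⟨trivial, rfl⟩ ⟨trivial, rfl⟩,
    h1 ⟨trivial, h3⟩, h2 ⟨trivial, h3⟩]
  group

end Transport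
end PG

/-! Part E2: words from a family of arcs -/

namespace PG
open Filter Topology

variable {n : ℕ} {Z : Set ℂ}

lemma convex_sc {U : Set ℂ} (h : Convex ℝ U) (hne : U.Nonempty) : IsSimplyConnected U := by
  haveI := h.contractibleSpace hne
  exact SimplyConnectedSpace.ofContractible U

/-- two square roots of the same nonvanishing function agree up to a locally constant sign -/
lemma sqrt_alt {X : Type*} [TopologicalSpace X] {f g : X → ℂ} {y : X} (hf : ContinuousAt f y)
    (hg : ContinuousAt g y) (h0 : g y ≠ 0) (h : ∀ᶠ x in 𝓝 y, f x ^ 2 = g x ^ 2) :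
    (∀ᶠ x in 𝓝 y, f x = g x ∧ g x ≠ 0) ∨ (∀ᶠ x in 𝓝 y, f x = - g x ∧ g x ≠ 0) := by
  have hgne := hg.eventually_ne h0
  rcases sq_eq_sq_iff_eq_or_eq_neg.mp h.self_of_nhds with h1 | h1
  · left
    have : f y + g y ≠ 0 := by rw [h1, ← two_mul]; exact mul_ne_zero two_ne_zero h0
    filter_upwards [h, hgne, (hf.add hg).eventually_ne this] with x a b c
    rcases sq_eq_sq_iff_eq_or_eq_neg.mp a with h2 | h2
    · exact ⟨h2, b⟩
    · exfalso; apply c; show f x + g x = 0; rw [h2]; ring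
  · right
    have : f y - g y ≠ 0 := by
      rw [h1]
      intro h; apply h0; linear_combination (-1/2) * h
    filter_upwards [h, hgne, (hf.sub hg).eventually_ne this] with x a b c
    rcases sq_eq_sq_iff_eq_or_eq_neg.mp a with h2 | h2
    · exfalso; apply c; show f x - g x = 0; rw [h2]; ring
    · exact ⟨h2, b⟩

/-- A moving family of arcs together with square roots branching along them. -/
structure ArcFam (n : ℕ) (Z : Set ℂ) where
  arc : Fin n → UI → Set ℂ
  c : Fin n → ℂ → ℂ
  R : Fin n → UI × ℂ → ℂ
  Zclosed : IsClosed Z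
  c_cont : ∀ k q, q ∉ Z → ContinuousAt (c k) q
  c_ne : ∀ k q, q ∉ Z → c k q ≠ 0
  Rsq : ∀ k (x : UI × ℂ), x.2 ∉ Z → R k x ^ 2 = c k x.2
  Rcont : ∀ k (x : UI × ℂ), x.2 ∉ Z → x.2 ∉ arc k x.1 → ContinuousAt (R k) x
  closed : ∀ k (x : UI × ℂ), x.2 ∉ Z → x.2 ∉ arc k x.1 → ∀ᶠ y : UI × ℂ in 𝓝 x, y.2 ∉ arc k y.1
  disj : ∀ t j k, j ≠ k → Disjoint (arc j t) (arc k t)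

/-- a local branch of the square root near `p` -/
def LocRoot (c : ℂ → ℂ) (p : ℂ) (ρ : ℂ → ℂ) : Prop :=
  (∀ z, ρ z ^ 2 = c z) ∧ ∀ᶠ z in 𝓝 p, ContinuousAt ρ z

lemma exists_locRoot (A : ArcFam n Z) (k : Fin n) {p : ℂ} (hp : p ∉ Z) :
    ∃ ρ, LocRoot (A.c k) p ρ := by
  obtain ⟨r, hr, hb⟩ := Metric.mem_nhds_iff.mp (A.Zclosed.isOpen_compl.mem_nhds hp)
  have hsc : IsSimplyConnected (Metric.ball p r) :=
    convex_sc (convex_ball p r) ⟨p, Metric.mem_ball_self hr⟩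
  obtain ⟨ρ, h1, h2⟩ := exists_continuousOn_pow_eq hsc Metric.isOpen_ball (g := A.c k)
    (fun q hq => (A.c_cont k q (hb hq)).continuousWithinAt)
    (by rintro ⟨q, hq, h⟩; exact A.c_ne k q (hb hq) h) two_ne_zero
  refine ⟨ρ, h2, ?_⟩
  filter_upwards [Metric.ball_mem_nhds p hr] with z hz
  exact h1.continuousAt (Metric.isOpen_ball.mem_nhds hz)

/-- reduced words -/
abbrev RW (n : ℕ) : Type := {w : List (Fin n) // Red w}

/-- left toggles as permutations -/
def Lperm (k : Fin n) : Equiv.Perm (RW n) where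
  toFun w := ⟨Lt k w.1, Lt_red k w.2⟩
  invFun w := ⟨Lt k w.1, Lt_red k w.2⟩
  left_inv w := Subtype.ext (Lt_invol k w.2)
  right_inv w := Subtype.ext (Lt_invol k w.2)

/-- right toggles as permutations -/
def Rperm (k : Fin n) : Equiv.Perm (RW n) where
  toFun w := ⟨Rt k w.1, Rt_red k w.2⟩
  invFun w := ⟨Rt k w.1, Rt_red k w.2⟩
  left_inv w := Subtype.ext (Rt_invol k w.2)
  right_inv w := Subtype.ext (Rt_invol k w.2)

/-- the group of permutations commuting with right toggles -/
abbrev GG (n : ℕ) := Subgroup.centralizer (Set.range (Rperm (n := n)))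

/-- left toggle as a group element -/
def lam (k : Fin n) : GG n := ⟨Lperm k, by
  rw [Subgroup.mem_centralizer_iff]
  rintro _ ⟨j, rfl⟩
  ext1 w
  exact Subtype.ext (Lt_Rt_comm k j w.1).symm⟩

lemma lam_sq (k : Fin n) : lam k * lam k = 1 := by
  apply Subtype.ext
  ext1 w
  exact Subtype.ext (Lt_invol k w.2)

lemma lam_inv (k : Fin n) : (lam k)⁻¹ = lam k := inv_eq_of_mul_eq_one_left (lam_sq k)

/-- empty word -/
def nilw : RW n := ⟨[], by simp [Red]⟩

lemma act_lam (u : GG n) (k : Fin n) : ((u * lam k : GG n).1 nilw).1 = Rt k (u.1 nilw).1 := by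
  have h := Subgroup.mem_centralizer_iff.mp u.2 (Rperm k) ⟨k, rfl⟩
  have h1 := congrArg (fun e : Equiv.Perm (RW n) => (e nilw).1) h
  have h2 : (Rperm k : Equiv.Perm (RW n)) nilw = Lperm k nilw := by
    apply Subtype.ext
    show Rt k [] = Lt k []
    rw [Rt_nil]; rfl
  have h3 : ((Rperm k * u.1) nilw).1 = Rt k (u.1 nilw).1 := rfl
  have h4 : (u.1 * Rperm k) nilw = (u * lam k : GG n).1 nilw := by
    show u.1 (Rperm k nilw) = u.1 (Lperm k nilw)
    rw [h2]
  rw [← h4, ← h1]; rfl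

/-- group element of a bit -/
def bitg (k : Fin n) (b : Bool) : GG n := if b then lam k else 1

lemma bitg_act (k l : Fin n) (x y : Bool) (u : GG n) :
    (((bitg l x)⁻¹ * u * bitg k y : GG n).1 nilw).1 = tg (Lt l) x (tg (Rt k) y (u.1 nilw).1) := by
  have hL : ∀ v : GG n, ((lam l * v : GG n).1 nilw).1 = Lt l (v.1 nilw).1 := fun v => rfl
  cases x <;> cases y
  · simp [bitg, tg]
  · have := act_lam u k
    simpa [bitg, tg] using this
  · simp only [bitg, tg, lam_inv, if_true, mul_one, Bool.false_eq_true, if_false]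
    rw [hL]
  · simp only [bitg, tg, lam_inv, if_true]
    rw [mul_assoc, hL, act_lam]

namespace ArcFam
variable (A : ArcFam n Z)

/-- meaning of the bits -/
def IsBit (t : UI) (p : ℂ) (k : Fin n) (y : ℂ → Bool) : Prop :=
  (p ∈ A.arc k t ∧ ∃ ρ, LocRoot (A.c k) p ρ ∧ ∀ q, (y q = true ↔ A.R k (t, q) ≠ ρ q)) ∨
    ((∀ j, p ∉ A.arc j t) ∧ ∀ q, y q = false)

open Classical in
/-- chosen branch -/
noncomputable def rho (k : Fin n) (p : ℂ) : ℂ → ℂ :=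
  if h : ∃ ρ, LocRoot (A.c k) p ρ then h.choose else fun _ => 0

lemma rho_spec (k : Fin n) {p : ℂ} (hp : p ∉ Z) : LocRoot (A.c k) p (A.rho k p) := by
  have h := exists_locRoot A k hp
  rw [rho, dif_pos h]
  exact h.choose_spec

open Classical in
/-- the local models -/
noncomputable def sig (x y : UI × ℂ) : GG n :=
  if h : ∃ k, x.2 ∈ A.arc k x.1 then
    bitg h.choose (decide (A.R h.choose y ≠ A.rho h.choose x.2 y.2)) else 1

lemma sig_on {x : UI × ℂ} {k : Fin n} (h : x.2 ∈ A.arc k x.1) (y : UI × ℂ) :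
    open Classical in A.sig x y = bitg k (decide (A.R k y ≠ A.rho k x.2 y.2)) := by
  have hex : ∃ k, x.2 ∈ A.arc k x.1 := ⟨k, h⟩
  have : hex.choose = k := by
    by_contra hne
    exact Set.disjoint_left.mp (A.disj x.1 _ _ hne) hex.choose_spec h
  rw [sig, dif_pos hex, this]

lemma sig_off {x : UI × ℂ} (h : ∀ k, x.2 ∉ A.arc k x.1) (y : UI × ℂ) : A.sig x y = 1 := by
  rw [sig, dif_neg]
  rintro ⟨k, hk⟩
  exact h k hk

lemma compat : Compat A.sig Z := by
  classical
  intro x hx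
  have hZ : ∀ᶠ y : UI × ℂ in 𝓝 x, y.2 ∉ Z :=
    continuous_snd.continuousAt.eventually (A.Zclosed.isOpen_compl.mem_nhds hx)
  by_cases hex : ∃ k, x.2 ∈ A.arc k x.1
  · obtain ⟨k, hk⟩ := hex
    have hoth : ∀ᶠ y : UI × ℂ in 𝓝 x, ∀ j, j ≠ k → y.2 ∉ A.arc j y.1 := by
      rw [eventually_all]
      intro j
      by_cases hj : j = k
      · simp [hj]
      · filter_upwards [A.closed j x hx (Set.disjoint_right.mp (A.disj x.1 j k hj) hk)] with y hy _
        exact hy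
    have hρc : ∀ᶠ y : UI × ℂ in 𝓝 x, ContinuousAt (A.rho k x.2) y.2 :=
      continuous_snd.continuousAt.eventually (A.rho_spec k hx).2
    filter_upwards [hZ, hoth, hρc] with y h1 h2 h3
    have hZy : ∀ᶠ y' : UI × ℂ in 𝓝 y, y'.2 ∉ Z :=
      continuous_snd.continuousAt.eventually (A.Zclosed.isOpen_compl.mem_nhds h1)
    have h3' : ContinuousAt (fun y' : UI × ℂ => A.rho k x.2 y'.2) y :=
      ContinuousAt.comp (g := A.rho k x.2) h3 continuous_snd.continuousAt
    have hne : A.rho k x.2 y.2 ≠ 0 := by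
      intro h
      have := (A.rho_spec k hx).1 y.2
      rw [h] at this
      exact A.c_ne k _ h1 (by rw [← this]; simp)
    by_cases hyk : y.2 ∈ A.arc k y.1
    · have h4 : ContinuousAt (fun y' : UI × ℂ => A.rho k y.2 y'.2) y :=
        ContinuousAt.comp (g := A.rho k y.2) (A.rho_spec k h1).2.self_of_nhds continuous_snd.continuousAt
      rcases sqrt_alt h4 h3' hne (Eventually.of_forall fun y' => by
        rw [(A.rho_spec k hx).1, (A.rho_spec k h1).1]) with h5 | h5
      · refine ⟨1, ?_⟩
        filter_upwards [h5] with y' h6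
        rw [one_mul, A.sig_on hk, A.sig_on hyk, h6.1]
      · refine ⟨lam k, ?_⟩
        filter_upwards [h5, hZy] with y' h6 h7
        rw [A.sig_on hk, A.sig_on hyk, h6.1]
        have h8 : A.R k y' ^ 2 = A.rho k x.2 y'.2 ^ 2 := by
          rw [A.Rsq k y' h7, (A.rho_spec k hx).1]
        have h9 : A.rho k x.2 y'.2 ≠ - A.rho k x.2 y'.2 := by
          intro h; apply h6.2; linear_combination (1/2) * h
        rcases sq_eq_sq_iff_eq_or_eq_neg.mp h8 with h | h
        · rw [h]; simp [bitg, h9, lam_sq]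
        · rw [h]; simp [bitg, h9.symm]
    · have hR := A.Rcont k y h1 hyk
      have hoff : ∀ j, y.2 ∉ A.arc j y.1 := by
        intro j
        by_cases hj : j = k
        · rw [hj]; exact hyk
        · exact h2 j hj
      rcases sqrt_alt hR h3' hne (by
        filter_upwards [hZy] with y' h7
        rw [(A.rho_spec k hx).1, A.Rsq k y' h7]) with h5 | h5
      · refine ⟨1, ?_⟩
        filter_upwards [h5] with y' h6
        rw [A.sig_on hk, A.sig_off hoff, h6.1]
        simp [bitg]
      · refine ⟨lam k, ?_⟩
        filter_upwards [h5] with y' h6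
        have h9 : - A.rho k x.2 y'.2 ≠ A.rho k x.2 y'.2 := by
          intro h; apply h6.2; linear_combination (-1/2) * h
        rw [A.sig_on hk, A.sig_off hoff, h6.1]
        simp [bitg, h9]
  · push Not at hex
    have hoff : ∀ᶠ y : UI × ℂ in 𝓝 x, ∀ j, y.2 ∉ A.arc j y.1 := by
      rw [eventually_all]
      exact fun j => A.closed j x hx (hex j)
    filter_upwards [hoff] with y hy
    refine ⟨1, Eventually.of_forall fun y' => ?_⟩
    rw [A.sig_off hex, A.sig_off hy, one_mul]

lemma sig_bit (hn : 0 < n) (t : UI) {p : ℂ} (hp : p ∉ Z) : ∃ k y, A.IsBit t p k y ∧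
    ∀ q, A.sig (t, p) (t, q) = bitg k (y q) := by
  classical
  by_cases hex : ∃ k, p ∈ A.arc k t
  · obtain ⟨k, hk⟩ := hex
    refine ⟨k, fun q => decide (A.R k (t, q) ≠ A.rho k p q), Or.inl ⟨hk, A.rho k p, A.rho_spec k hp, ?_⟩, ?_⟩
    · intro q; simp
    · intro q
      have := A.sig_on (x := (t, p)) hk (t, q)
      simpa using this
  · push Not at hex
    refine ⟨⟨0, hn⟩, fun _ => false, Or.inr ⟨hex, fun _ => rfl⟩, fun q => ?_⟩
    rw [A.sig_off hex]; simp [bitg]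

theorem words (hn : 0 < n) : ∃ w : ℂ → List (Fin n), ∀ p, p ∉ Z →
    ∃ (k l : Fin n) (u : List (Fin n)) (y x : ℂ → Bool), Red u ∧ A.IsBit 0 p k y ∧
      A.IsBit 1 p l x ∧ ∀ᶠ q in 𝓝 p, w q = tg (Lt l) (x q) (tg (Rt k) (y q) u) := by
  obtain ⟨w, hw⟩ := transport A.Zclosed A.compat
  refine ⟨fun q => ((w q).1 nilw).1, fun p hp => ?_⟩
  obtain ⟨u, hu⟩ := hw p hp
  obtain ⟨k, y, hy, hy'⟩ := A.sig_bit hn 0 hp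
  obtain ⟨l, x, hx, hx'⟩ := A.sig_bit hn 1 hp
  refine ⟨k, l, (u.1 nilw).1, y, x, (u.1 nilw).2, hy, hx, ?_⟩
  filter_upwards [hu] with q hq
  rw [hq, hy', hx', bitg_act]

end ArcFam
end PG

/-! Part E3: square roots branching along one moving arc -/

namespace PG
open Filter Topology

lemma arc_open {P : UI × UI → ℂ} (hP : Continuous P) :
    IsOpen {x : UI × ℂ | ∀ u, P (x.1, u) ≠ x.2} := by
  have h1 : IsClosed {y : (UI × ℂ) × UI | P (y.1.1, y.2) = y.1.2} :=
    isClosed_eq (by fun_prop) (by fun_prop)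
  have h2 := isClosedMap_fst_of_compactSpace _ h1
  have : {x : UI × ℂ | ∀ u, P (x.1, u) ≠ x.2} =
      (Prod.fst '' {y : (UI × ℂ) × UI | P (y.1.1, y.2) = y.1.2})ᶜ := by
    ext x
    constructor
    · rintro h ⟨⟨x', u⟩, h3, rfl⟩
      exact h u h3
    · intro h u hu
      exact h ⟨(x, u), hu, rfl⟩
  rw [this]
  exact h2.isOpen_compl

lemma arc_root {P : UI × UI → ℂ} (hP : Continuous P) {a b : ℂ} (h0 : ∀ t, P (t, 0) = a)
    (h1 : ∀ t, P (t, 1) = b) :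
    ∃ R : UI × ℂ → ℂ, (∀ x, R x ^ 2 = (b - x.2) / (a - x.2)) ∧
      ∀ x : UI × ℂ, (∀ u, P (x.1, u) ≠ x.2) → ContinuousAt R x := by
  classical
  let A : Set (UI × ℂ) := {x : UI × ℂ | ∀ u, P (x.1, u) ≠ x.2}
  have hAo : IsOpen A := arc_open hP
  have hane : ∀ x : A, a - x.1.2 ≠ 0 := by
    intro x h
    apply x.2 0
    rw [h0]; exact sub_eq_zero.mp h
  have hne : ∀ x : UI × A, (P (x.2.1.1, x.1) - x.2.1.2) / (a - x.2.1.2) ≠ 0 := by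
    intro x
    exact div_ne_zero (sub_ne_zero.mpr (x.2.2 x.1)) (hane x.2)
  let HH : C(UI × A, {z : ℂ // z ≠ 0}) :=
    ⟨fun x => ⟨(P (x.2.1.1, x.1) - x.2.1.2) / (a - x.2.1.2), hne x⟩, by
      apply Continuous.subtype_mk
      apply Continuous.div
      · fun_prop
      · fun_prop
      · exact fun x => hane x.2⟩
  have H0 : ∀ x : A, HH (0, x) = (⟨Complex.exp ((0 : C(A, ℂ)) x), Complex.exp_ne_zero _⟩ : {z : ℂ // z ≠ 0}) := by
    intro x
    apply Subtype.ext
    show (P (x.1.1, 0) - x.1.2) / (a - x.1.2) = Complex.exp 0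
    rw [h0, div_self (hane x), Complex.exp_zero]
  let L := Complex.isCoveringMap_exp.liftHomotopy HH (0 : C(A, ℂ)) H0
  have hL : ∀ x : A, Complex.exp (L (1, x)) = (b - x.1.2) / (a - x.1.2) := by
    intro x
    have h := congrFun (Complex.isCoveringMap_exp.liftHomotopy_lifts HH (0 : C(A, ℂ)) H0) (1, x)
    have h2 := congrArg Subtype.val h
    have h3 : (HH (1, x)).1 = (b - x.1.2) / (a - x.1.2) := by
      show (P (x.1.1, 1) - x.1.2) / (a - x.1.2) = _
      rw [h1]
    rw [← h3, ← h2]; rfl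
  refine ⟨fun x => if h : x ∈ A then Complex.exp (L (1, ⟨x, h⟩) / 2) else
    ((b - x.2) / (a - x.2)) ^ (1 / (2 : ℕ) : ℂ), ?_, ?_⟩
  · intro x
    by_cases h : x ∈ A
    · simp only [h, dif_pos]
      rw [← hL ⟨x, h⟩, ← Complex.exp_nat_mul]
      congr 1; push_cast; ring
    · simp only [h, dif_neg, not_false_eq_true]
      rw [← Complex.cpow_mul_nat]; simp
  · intro x hx
    have hc : ContinuousOn (fun x : UI × ℂ => if h : x ∈ A then Complex.exp (L (1, ⟨x, h⟩) / 2) else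
      ((b - x.2) / (a - x.2)) ^ (1 / (2 : ℕ) : ℂ)) A := by
      rw [continuousOn_iff_continuous_domRestrict]
      have : Continuous fun x : A => Complex.exp (L (1, x) / 2) := by fun_prop
      convert this using 1
      ext x
      simp [Set.domRestrict]
    exact hc.continuousAt (hAo.mem_nhds hx)

end PG

/-! Part E4: the arcs of an isotopy -/

namespace PG
open Filter Topology

/-- a moving family of cyclic arcs -/
structure PathFam (n : ℕ) (Z Γ Γ' : Set ℂ) where
  P : Fin n → UI × UI → ℂ
  a : Fin n → ℂ
  b : Fin n → ℂ
  cont : ∀ k, Continuous (P k)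
  P0 : ∀ k t, P k (t, 0) = a k
  P1 : ∀ k t, P k (t, 1) = b k
  aZ : ∀ k, a k ∈ Z
  bZ : ∀ k, b k ∈ Z
  inj : ∀ k t, Function.Injective fun u => P k (t, u)
  disj : ∀ t j k, j ≠ k → ∀ u ∈ Ioo (0 : UI) 1, ∀ v ∈ Ioo (0 : UI) 1, P j (t, u) ≠ P k (t, v)
  avoid : ∀ k t, ∀ u ∈ Ioo (0 : UI) 1, P k (t, u) ∉ Z
  sub0 : ∀ k u, P k (0, u) ∈ Γ
  sub1 : ∀ k u, P k (1, u) ∈ Γ'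
  cover0 : ∀ p ∈ Γ, p ∉ Z → ∃ k, ∃ u ∈ Ioo (0 : UI) 1, P k (0, u) = p
  cover1 : ∀ p ∈ Γ', p ∉ Z → ∃ k, ∃ u ∈ Ioo (0 : UI) 1, P k (1, u) = p

lemma mod_eq {T : ℝ} (hT : 0 < T) {h : ℝ → ℂ} (hper : Function.Periodic h T)
    (hinj : ∀ s ∈ Ico (0 : ℝ) T, ∀ u ∈ Ico (0 : ℝ) T, h s = h u → s = u) {x y : ℝ}
    (hxy : h x = h y) : ∃ m : ℤ, x = y + m * T := by
  have e : ∀ x : ℝ, h (toIcoMod hT 0 x) = h x := by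
    intro x
    have := hper.sub_zsmul_eq (x := x) (toIcoDiv hT 0 x)
    rw [← this, toIcoMod]
  have := hinj _ (by simpa using toIcoMod_mem_Ico hT 0 x) _ (by simpa using toIcoMod_mem_Ico hT 0 y)
    (by rw [e, e, hxy])
  refine ⟨toIcoDiv hT 0 x - toIcoDiv hT 0 y, ?_⟩
  have h1 := toIcoMod_add_toIcoDiv_zsmul hT 0 x
  have h2 := toIcoMod_add_toIcoDiv_zsmul hT 0 y
  rw [← this] at h2
  simp only [zsmul_eq_mul] at h1 h2
  push_cast
  linarith

lemma mod_close {T x y : ℝ} (hT : 0 < T) (h : ∃ m : ℤ, x = y + m * T) (h1 : x < y + T)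
    (h2 : y < x + T) : x = y := by
  obtain ⟨m, hm⟩ := h
  have h3 : (m : ℝ) < 1 := by
    by_contra hc; push Not at hc; nlinarith
  have h4 : (-1 : ℝ) < m := by
    by_contra hc; push Not at hc; nlinarith
  have h5 : m < 1 := by exact_mod_cast h3
  have h6 : -1 < m := by exact_mod_cast h4
  have : m = 0 := by omega
  rw [hm, this]; simp

lemma track {T : ℝ} (hT : 0 < T) {H : UI × ℝ → ℂ} (hc : Continuous H)
    (hper : ∀ t, Function.Periodic (fun s => H (t, s)) T)
    (hinj : ∀ t, ∀ s ∈ Ico (0 : ℝ) T, ∀ u ∈ Ico (0 : ℝ) T, H (t, s) = H (t, u) → s = u)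
    {z : ℂ} (hz : ∀ t, ∃ s, H (t, s) = z) :
    ∃ s : UI → ℝ, Continuous s ∧ (∀ t, H (t, s t) = z) ∧ s 0 ∈ Ico 0 T := by
  haveI : Fact (0 < T) := ⟨hT⟩
  let π : ℝ → AddCircle T := fun x => (x : AddCircle T)
  have hπ : IsOpenQuotientMap π := QuotientAddGroup.isOpenQuotientMap_mk
  let hb : UI × AddCircle T → ℂ := fun x => (hper x.1).lift x.2
  have hb_apply : ∀ t s, hb (t, π s) = H (t, s) := fun t s => Function.Periodic.lift_coe (hper t) s
  have hbc : Continuous hb := by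
    have hq : IsOpenQuotientMap (Prod.map (id : UI → UI) π) := IsOpenQuotientMap.id.prodMap hπ
    rw [hq.isQuotientMap.continuous_iff]
    have : hb ∘ Prod.map (id : UI → UI) π = H := by
      ext ⟨t, s⟩; exact hb_apply t s
    rw [this]; exact hc
  have hbi : ∀ t x y, hb (t, x) = hb (t, y) → x = y := by
    intro t x y h
    obtain ⟨x, rfl⟩ := hπ.surjective x
    obtain ⟨y, rfl⟩ := hπ.surjective y
    rw [hb_apply, hb_apply] at h
    obtain ⟨m, hm⟩ := mod_eq hT (hper t) (hinj t) h
    show ((x : ℝ) : AddCircle T) = (y : AddCircle T)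
    rw [hm, AddCircle.coe_add]
    have : ((m * T : ℝ) : AddCircle T) = 0 := (AddCircle.coe_eq_zero_iff T).mpr ⟨m, by simp⟩
    rw [this, add_zero]
  have hx : ∀ t, ∃ x, hb (t, x) = z := by
    intro t
    obtain ⟨s, hs⟩ := hz t
    exact ⟨π s, by rw [hb_apply, hs]⟩
  choose x hx using hx
  have hxc : Continuous x := by
    rw [continuous_iff_isClosed]
    intro F hF
    have h1 : IsClosed {y : UI × AddCircle T | hb y = z ∧ y.2 ∈ F} :=
      (isClosed_eq hbc continuous_const).inter (hF.preimage continuous_snd)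
    have h2 := isClosedMap_fst_of_compactSpace _ h1
    convert h2 using 1
    ext t
    constructor
    · intro h; exact ⟨(t, x t), ⟨hx t, h⟩, rfl⟩
    · rintro ⟨⟨t', y⟩, ⟨h3, h4⟩, rfl⟩
      have := hbi t' y (x t') (by rw [h3, hx])
      show x t' ∈ F
      rw [← this]; exact h4
  obtain ⟨s0, hs0⟩ := hz 0
  have hs0' : H (0, toIcoMod hT 0 s0) = z := by
    have := (hper 0).sub_zsmul_eq (x := s0) (toIcoDiv hT 0 s0)
    rw [← hs0, ← this, toIcoMod]
  have hst : x 0 = ((toIcoMod hT 0 s0 : ℝ) : AddCircle T) := by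
    apply hbi 0
    rw [hx, ← hs0']
    exact (hb_apply _ _).symm
  have cov := AddCircle.isCoveringMap_coe T
  refine ⟨cov.liftPath ⟨x, hxc⟩ (toIcoMod hT 0 s0) hst, ContinuousMap.continuous _, ?_, ?_⟩
  · intro t
    have h := congrFun (cov.liftPath_lifts ⟨x, hxc⟩ (toIcoMod hT 0 s0) hst) t
    rw [← hb_apply, ← hx t]
    congr 1
    exact Prod.ext rfl h
  · rw [cov.liftPath_zero]
    simpa using toIcoMod_mem_Ico hT 0 s0

lemma stay_pos {f : UI → ℝ} (hf : Continuous f) (h0 : 0 < f 0) (hne : ∀ t, f t ≠ 0) (t : UI) :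
    0 < f t := by
  by_contra h
  push Not at h
  obtain ⟨u, hu⟩ := mem_range_of_exists_le_of_exists_ge hf ⟨t, h⟩ ⟨0, h0.le⟩
  exact hne u hu

/-- right endpoint -/
noncomputable def rend {n : ℕ} (T : ℝ) (s : Fin n → ℝ) (k : Fin n) : ℝ :=
  if h : k.1 + 1 < n then s ⟨k.1 + 1, h⟩ else s ⟨0, k.pos⟩ + T

section order
variable {n : ℕ} {T : ℝ} {s : Fin n → ℝ}

lemma rend_gt (hs : StrictMono s) (hsT : ∀ i j, s j < s i + T) (hT : 0 < T) (k : Fin n) : s k < rend T s k := by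
  unfold rend
  split_ifs with h
  · apply hs; rw [Fin.lt_def]; simp
  · exact hsT _ _

lemma rend_le (hs : StrictMono s) (hsT : ∀ i j, s j < s i + T) (k : Fin n) : rend T s k ≤ s ⟨0, k.pos⟩ + T := by
  unfold rend
  split_ifs with h
  · exact (hsT _ _).le
  · exact le_rfl

lemma rend_lt (hn : 2 ≤ n) (hs : StrictMono s) (hsT : ∀ i j, s j < s i + T) (k : Fin n) : rend T s k < s k + T := by
  unfold rend
  split_ifs with h
  · exact hsT _ _
  · have : s ⟨0, k.pos⟩ < s k := by
      apply hs; rw [Fin.lt_def]; have := k.2; simp; omega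
    linarith

lemma rend_le_of_lt (hs : StrictMono s) (hsT : ∀ i j, s j < s i + T) {j k : Fin n} (h : j < k) : rend T s j ≤ s k := by
  unfold rend
  rw [Fin.lt_def] at h
  have := k.2
  rw [dif_pos (by omega)]
  apply hs.monotone
  rw [Fin.le_def]; simp; omega

lemma rend_cover (hs : StrictMono s) (hsT : ∀ i j, s j < s i + T) (hn0 : 0 < n) (hT : 0 < T) (x : ℝ) (hx : ∀ j, ¬ ∃ m : ℤ, x = s j + m * T) :
    ∃ k, ∃ m : ℤ, s k < x + m * T ∧ x + m * T < rend T s k := by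
  classical
  let z : Fin n := ⟨0, hn0⟩
  let y := toIcoMod hT (s z) x
  have hy := toIcoMod_mem_Ico hT (s z) x
  have hyx : y = x + (- toIcoDiv hT (s z) x : ℤ) * T := by
    have h1 := toIcoMod_add_toIcoDiv_zsmul hT (s z) x
    simp only [zsmul_eq_mul] at h1
    push_cast
    show toIcoMod hT (s z) x = _
    linarith
  have hne : ∀ j, s j ≠ y := by
    intro j h
    apply hx j
    refine ⟨toIcoDiv hT (s z) x, ?_⟩
    rw [h, hyx]; push_cast; ring
  let F : Finset (Fin n) := Finset.univ.filter fun j => s j ≤ y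
  have hF : F.Nonempty := ⟨z, by simp [F]; exact hy.1⟩
  let k := F.max' hF
  have hk : s k ≤ y := by
    have := F.max'_mem hF
    simp only [F, Finset.mem_filter] at this
    exact this.2
  refine ⟨k, - toIcoDiv hT (s z) x, ?_⟩
  rw [← hyx]
  refine ⟨lt_of_le_of_ne hk (hne k), ?_⟩
  unfold rend
  split_ifs with h
  · by_contra hc
    push Not at hc
    have h1 : (⟨k.1 + 1, h⟩ : Fin n) ∈ F := by simp [F]; exact hc
    have h2 := F.le_max' _ h1
    have h3 : (⟨k.1 + 1, h⟩ : Fin n) ≤ k := h2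
    rw [Fin.le_def] at h3
    simp at h3
  · exact hy.2

end order

lemma sigma_mem {u : UI} {s e : ℝ} (h : s < e) (hu : u ∈ Ioo (0 : UI) 1) :
    s + u * (e - s) ∈ Ioo s e := by
  have h1 : (0 : ℝ) < u := hu.1
  have h2 : (u : ℝ) < 1 := hu.2
  constructor <;> nlinarith

theorem exists_pathFam {n : ℕ} (hn : 2 ≤ n) {z : Fin n → ℂ} (hz : Function.Injective z)
    {Γ Γ' : Set ℂ} (hiso : IsotopicRel Γ Γ' (Set.range z)) :
    Nonempty (PathFam n (Set.range z) Γ Γ') := by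
  obtain ⟨H₀, hc₀, hpi₀, hr0, hr1, hZ₀⟩ := hiso
  set T : ℝ := 2 * Real.pi with hTdef
  have hT : 0 < T := Real.two_pi_pos
  let H : UI × ℝ → ℂ := fun x => H₀ x.1 x.2
  have hc : Continuous H := by
    have h1 : Continuous fun x : UI × ℝ => ((x.1 : ℝ), x.2) := by fun_prop
    exact hc₀.comp_continuous h1 (fun x => ⟨x.1.2, trivial⟩)
  have hper : ∀ t, Function.Periodic (fun s => H (t, s)) T := fun t => (hpi₀ t t.2).1
  have hinj : ∀ t, ∀ s ∈ Ico (0 : ℝ) T, ∀ u ∈ Ico (0 : ℝ) T, H (t, s) = H (t, u) → s = u :=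
    fun t => (hpi₀ t t.2).2
  have htr : ∀ j, ∃ s : UI → ℝ, Continuous s ∧ (∀ t, H (t, s t) = z j) ∧ s 0 ∈ Ico 0 T := by
    intro j
    apply track hT hc hper hinj
    intro t
    obtain ⟨s, hs⟩ := hZ₀ t t.2 ⟨j, rfl⟩
    exact ⟨s, hs⟩
  choose s' hs'c hs'z hs'0 using htr
  let σ := Tuple.sort fun j => s' j 0
  let s : Fin n → UI → ℝ := fun j => s' (σ j)
  have hsc : ∀ j, Continuous (s j) := fun j => hs'c _
  have hsz : ∀ j t, H (t, s j t) = z (σ j) := fun j => hs'z _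
  have hne : ∀ i j t, i ≠ j → ¬ ∃ m : ℤ, s i t = s j t + m * T := by
    rintro i j t hij ⟨m, hm⟩
    apply hij
    apply σ.injective
    apply hz
    rw [← hsz i t, ← hsz j t, hm]
    have := (hper t).zsmul m (s j t)
    simpa using this
  have hmono0 : StrictMono fun j => s j 0 := by
    apply (Tuple.monotone_sort fun j => s' j 0).strictMono_of_injective
    intro i j h
    by_contra hij
    exact hne i j 0 hij ⟨0, by simpa using h⟩
  have hmono : ∀ t, StrictMono fun j => s j t := by
    intro t i j hij
    have := stay_pos (f := fun t => s j t - s i t) ((hsc j).sub (hsc i))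
      (sub_pos.mpr (hmono0 hij)) (fun t h => hne j i t hij.ne' ⟨0, by simp; linarith⟩) t
    exact sub_pos.mp this
  have hsT : ∀ t i j, s j t < s i t + T := by
    intro t i j
    by_cases hij : i = j
    · rw [hij]; linarith
    have := stay_pos (f := fun t => s i t + T - s j t) (((hsc i).add continuous_const).sub (hsc j))
      (by have h1 := (hs'0 (σ i)).1; have h2 := (hs'0 (σ j)).2
          show 0 < s' (σ i) 0 + T - s' (σ j) 0
          linarith) (fun t h => hne j i t (Ne.symm hij) ⟨1, by simp; linarith⟩) t
    exact sub_pos.mp this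
  let e : Fin n → UI → ℝ := fun k t => rend T (fun j => s j t) k
  have hec : ∀ k, Continuous (e k) := by
    intro k
    by_cases h : k.1 + 1 < n
    · have : e k = s ⟨k.1 + 1, h⟩ := by ext t; simp [e, rend, h]
      rw [this]; exact hsc _
    · have : e k = fun t => s ⟨0, k.pos⟩ t + T := by ext t; simp [e, rend, h]
      rw [this]; exact (hsc _).add continuous_const
  let nx : Fin n → Fin n := fun k => if h : k.1 + 1 < n then ⟨k.1 + 1, h⟩ else ⟨0, k.pos⟩
  have hez : ∀ k t, H (t, e k t) = z (σ (nx k)) := by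
    intro k t
    by_cases h : k.1 + 1 < n
    · have h1 : e k t = s ⟨k.1 + 1, h⟩ t := by simp [e, rend, h]
      rw [h1, hsz]; simp [nx, h]
    · have h1 : e k t = s ⟨0, k.pos⟩ t + T := by simp [e, rend, h]
      have h2 := hper t (s ⟨0, k.pos⟩ t)
      rw [h1]
      refine h2.trans ?_
      simp only [nx, h, dif_neg, not_false_eq_true]
      exact hsz _ _
  have hse : ∀ k t, s k t < e k t := fun k t => rend_gt (hmono t) (hsT t) hT k
  have hs0 : ∀ k t, s ⟨0, k.pos⟩ t ≤ s k t := fun k t => (hmono t).monotone (by rw [Fin.le_def]; simp)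
  have hmod : ∀ t x y, H (t, x) = H (t, y) → ∃ m : ℤ, x = y + m * T :=
    fun t x y h => mod_eq hT (hper t) (hinj t) h
  have hshift : ∀ t x (m : ℤ), H (t, x + m * T) = H (t, x) := by
    intro t x m
    have := (hper t).zsmul m x
    simpa using this
  have hcov : ∀ (t : UI) (p : ℂ), (∃ x, H (t, x) = p) → p ∉ Set.range z →
      ∃ k, ∃ u ∈ Ioo (0 : UI) 1, H (t, s k t + u * (e k t - s k t)) = p := by
    rintro t _ ⟨x, rfl⟩ hp
    obtain ⟨k, m, h1, h2⟩ := rend_cover (s := fun j => s j t) (hmono t) (hsT t) (by omega) hT x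
      (by rintro j ⟨m, hm⟩
          apply hp
          refine ⟨σ j, ?_⟩
          rw [hm, hshift, hsz])
    have h1' : s k t < x + m * T := h1
    have h2' : x + m * T < e k t := h2
    have h3 : 0 < e k t - s k t := sub_pos.mpr (hse k t)
    have hu0 : 0 < (x + m * T - s k t) / (e k t - s k t) := div_pos (by linarith) h3
    have hu1 : (x + m * T - s k t) / (e k t - s k t) < 1 := by rw [div_lt_one h3]; linarith
    refine ⟨k, ⟨(x + m * T - s k t) / (e k t - s k t), hu0.le, hu1.le⟩, ⟨hu0, hu1⟩, ?_⟩
    show H (t, s k t + (x + m * T - s k t) / (e k t - s k t) * (e k t - s k t)) = _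
    rw [div_mul_cancel₀ _ h3.ne', ← hshift t x m]
    congr 2; ring
  refine ⟨{ P := fun k x => H (x.1, s k x.1 + x.2 * (e k x.1 - s k x.1))
            a := fun k => z (σ k)
            b := fun k => z (σ (nx k))
            cont := ?_, P0 := ?_, P1 := ?_, aZ := fun k => ⟨_, rfl⟩, bZ := fun k => ⟨_, rfl⟩
            inj := ?_, disj := ?_, avoid := ?_, sub0 := ?_, sub1 := ?_, cover0 := ?_
            cover1 := ?_ }⟩
  · intro k
    have := hsc k
    have := hec k
    fun_prop
  · intro k t; simp [hsz]
  · intro k t; simp [hez]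
  · intro k t u v huv
    have h1 := hmod t _ _ huv
    have h2 : e k t < s k t + T := rend_lt hn (hmono t) (hsT t) k
    have h3 := hse k t
    have hu0 := u.2.1
    have hu1 := u.2.2
    have hv0 := v.2.1
    have hv1 := v.2.2
    have h4 := mod_close hT h1 (by nlinarith) (by nlinarith)
    have h5 : (u - v : ℝ) * (e k t - s k t) = 0 := by linarith
    rcases mul_eq_zero.mp h5 with h | h
    · apply Subtype.ext; linarith
    · linarith
  · intro t
    have key : ∀ j k, j < k → ∀ u ∈ Ioo (0 : UI) 1, ∀ v ∈ Ioo (0 : UI) 1,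
        H (t, s j t + u * (e j t - s j t)) ≠ H (t, s k t + v * (e k t - s k t)) := by
      intro j k hjk u hu v hv h
      have h1 := hmod t _ _ h
      have a1 := sigma_mem (hse j t) hu
      have a2 := sigma_mem (hse k t) hv
      have a3 : e j t ≤ s k t := rend_le_of_lt (hmono t) (hsT t) hjk
      have a4 : e k t ≤ s ⟨0, k.pos⟩ t + T := rend_le (hmono t) (hsT t) k
      have a5 := hs0 j t
      have := mod_close hT h1 (by linarith [a1.1, a1.2, a2.1, a2.2])
        (by linarith [a1.1, a1.2, a2.1, a2.2])
      linarith [a1.1, a1.2, a2.1, a2.2]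
    intro j k hjk u hu v hv
    rcases lt_or_gt_of_ne hjk with h | h
    · exact key j k h u hu v hv
    · exact (key k j h v hv u hu).symm
  · rintro k t u hu ⟨i, hi⟩
    obtain ⟨j, rfl⟩ := σ.surjective i
    rw [← hsz j t] at hi
    have h1 := hmod t _ _ hi
    have a1 := sigma_mem (hse k t) hu
    have a4 : e k t ≤ s ⟨0, k.pos⟩ t + T := rend_le (hmono t) (hsT t) k
    have a5 := hs0 j t
    have a6 := hs0 k t
    have a7 := hsT t ⟨0, k.pos⟩ j
    have h2 := mod_close hT h1 (by linarith [a1.1, a1.2]) (by linarith [a1.1, a1.2])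
    rcases le_or_gt j k with h | h
    · have := (hmono t).monotone h
      have this' : s j t ≤ s k t := this
      linarith [a1.1, a1.2]
    · have a3 : e k t ≤ s j t := rend_le_of_lt (hmono t) (hsT t) h
      linarith [a1.1, a1.2]
  · intro k u; rw [← hr0]; exact ⟨_, rfl⟩
  · intro k u; rw [← hr1]; exact ⟨_, rfl⟩
  · rintro p hp hpZ
    rw [← hr0] at hp
    obtain ⟨x, hx⟩ := hp
    exact hcov 0 p ⟨x, hx⟩ hpZ
  · rintro p hp hpZ
    rw [← hr1] at hp
    obtain ⟨x, hx⟩ := hp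
    exact hcov 1 p ⟨x, hx⟩ hpZ

end PG

/-! Part E5: arcs and components -/

namespace PG
open Filter Topology

namespace PathFam
variable {n : ℕ} {Z Γ Γ' : Set ℂ} (F : PathFam n Z Γ Γ')

def arc (k : Fin n) (t : UI) : Set ℂ := (fun u => F.P k (t, u)) '' Ioo (0 : UI) 1

/-- closed arc -/
def carc (k : Fin n) (t : UI) : Set ℂ := Set.range fun u => F.P k (t, u)

lemma arc_sub (k : Fin n) (t : UI) : F.arc k t ⊆ F.carc k t := by
  rintro _ ⟨u, _, rfl⟩; exact ⟨u, rfl⟩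

lemma carc_sub (k : Fin n) (t : UI) {q : ℂ} (h : q ∈ F.carc k t) (hq : q ∉ Z) : q ∈ F.arc k t := by
  obtain ⟨u, rfl⟩ := h
  refine ⟨u, ⟨?_, ?_⟩, rfl⟩
  · rcases eq_or_lt_of_le (show (0 : UI) ≤ u from u.2.1) with h | h
    · exfalso; apply hq; show F.P k (t, u) ∈ Z; rw [← h, F.P0]; exact F.aZ k
    · exact h
  · rcases eq_or_lt_of_le (show u ≤ (1 : UI) from u.2.2) with h | h
    · exfalso; apply hq; show F.P k (t, u) ∈ Z; rw [h, F.P1]; exact F.bZ k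
    · exact h

lemma carc_closed (k : Fin n) (t : UI) : IsClosed (F.carc k t) := by
  have : Continuous fun u => F.P k (t, u) := (F.cont k).comp (by fun_prop)
  exact (isCompact_range this).isClosed

lemma arc_avoid {k : Fin n} {t : UI} {q : ℂ} (h : q ∈ F.arc k t) : q ∉ Z := by
  obtain ⟨u, hu, rfl⟩ := h
  exact F.avoid k t u hu

lemma arc_disj (t : UI) (j k : Fin n) (h : j ≠ k) : Disjoint (F.arc j t) (F.arc k t) := by
  rw [Set.disjoint_left]
  rintro _ ⟨u, hu, rfl⟩ ⟨v, hv, h'⟩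
  exact F.disj t j k h u hu v hv h'.symm

lemma arc_preconn (k : Fin n) (t : UI) : IsPreconnected (F.arc k t) := by
  apply isPreconnected_Ioo.image
  exact ((F.cont k).comp (by fun_prop)).continuousOn

lemma arc_nonempty (k : Fin n) (t : UI) : (F.arc k t).Nonempty := by
  refine Set.Nonempty.image _ ⟨⟨1/2, by norm_num, by norm_num⟩, ?_, ?_⟩
  · show (0 : ℝ) < 1 / 2
    norm_num
  · show (1 / 2 : ℝ) < 1
    norm_num

lemma a_ne_b (k : Fin n) : F.a k ≠ F.b k := by
  rw [← F.P0 k 0, ← F.P1 k 0]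
  intro h
  have := F.inj k 0 h
  exact zero_ne_one this

lemma a_not_arc {k j : Fin n} {t : UI} : F.a k ∉ F.arc j t := fun h => F.arc_avoid h (F.aZ k)

lemma b_not_arc {k j : Fin n} {t : UI} : F.b k ∉ F.arc j t := fun h => F.arc_avoid h (F.bZ k)

/-- components of the curve minus the marked points are the arcs -/
lemma comp_eq {t : UI} {Δ : Set ℂ} (hsub : ∀ k, F.carc k t ⊆ Δ)
    (hcov : ∀ p ∈ Δ, p ∉ Z → ∃ k, p ∈ F.arc k t) {k : Fin n} {x : ℂ} (hx : x ∈ F.arc k t) :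
    connectedComponentIn (Δ \ Z) x = F.arc k t := by
  have hsub' : F.arc k t ⊆ Δ \ Z := fun q hq => ⟨hsub k (F.arc_sub k t hq), F.arc_avoid hq⟩
  apply Set.Subset.antisymm
  · have hpc : IsPreconnected (connectedComponentIn (Δ \ Z) x) := isPreconnected_connectedComponentIn
    have hCs : connectedComponentIn (Δ \ Z) x ⊆ Δ \ Z := connectedComponentIn_subset _ _
    have hxC : x ∈ connectedComponentIn (Δ \ Z) x := mem_connectedComponentIn (hsub' hx)
    have hV : IsClosed (⋃ j : {j : Fin n // j ≠ k}, F.carc j.1 t) :=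
      isClosed_iUnion_of_finite fun j => F.carc_closed _ _
    have hdj : ∀ q ∉ Z, q ∈ F.carc k t → q ∉ ⋃ j : {j : Fin n // j ≠ k}, F.carc j.1 t := by
      rintro q hq h1 h2
      obtain ⟨j, hj⟩ := Set.mem_iUnion.mp h2
      exact Set.disjoint_left.mp (F.arc_disj t j.1 k j.2) (F.carc_sub _ _ hj hq) (F.carc_sub _ _ h1 hq)
    rcases (isPreconnected_iff_subset_of_disjoint_closed.mp hpc) _ _ (F.carc_closed k t) hV
      (by intro q hq
          obtain ⟨j, hj⟩ := hcov q (hCs hq).1 (hCs hq).2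
          by_cases hjk : j = k
          · left; rw [← hjk]; exact F.arc_sub _ _ hj
          · right; exact Set.mem_iUnion.mpr ⟨⟨j, hjk⟩, F.arc_sub _ _ hj⟩)
      (by rw [Set.eq_empty_iff_forall_notMem]
          rintro q ⟨h1, h2, h3⟩
          exact hdj q (hCs h1).2 h2 h3) with h | h
    · intro q hq
      exact F.carc_sub _ _ (h hq) (hCs hq).2
    · exact absurd (h hxC) (hdj x (hCs hxC).2 (F.arc_sub _ _ hx))
  · exact (F.arc_preconn k t).subset_connectedComponentIn hx hsub'

noncomputable def Rt (k : Fin n) : UI × ℂ → ℂ :=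
  (arc_root (F.cont k) (F.P0 k) (F.P1 k)).choose

lemma Rt_sq (k : Fin n) (x : UI × ℂ) : F.Rt k x ^ 2 = (F.b k - x.2) / (F.a k - x.2) :=
  (arc_root (F.cont k) (F.P0 k) (F.P1 k)).choose_spec.1 x

lemma Rt_cont (k : Fin n) (x : UI × ℂ) (h : x.2 ∉ F.carc k x.1) : ContinuousAt (F.Rt k) x :=
  (arc_root (F.cont k) (F.P0 k) (F.P1 k)).choose_spec.2 x fun u hu => h ⟨u, hu⟩

/-- the family of arcs with square roots -/
noncomputable def toArcFam (hZ : IsClosed Z) : ArcFam n Z where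
  arc := F.arc
  c k q := (F.b k - q) / (F.a k - q)
  R := F.Rt
  Zclosed := hZ
  c_cont := by
    intro k q hq
    have : F.a k - q ≠ 0 := by
      intro h; apply hq; rw [← sub_eq_zero.mp h]; exact F.aZ k
    fun_prop (disch := assumption)
  c_ne := by
    intro k q hq
    apply div_ne_zero
    · intro h; apply hq; rw [← sub_eq_zero.mp h]; exact F.bZ k
    · intro h; apply hq; rw [← sub_eq_zero.mp h]; exact F.aZ k
  Rsq := fun k x _ => F.Rt_sq k x
  Rcont := fun k x h1 h2 => F.Rt_cont k x fun h => h2 (F.carc_sub _ _ h h1)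
  closed := by
    intro k x h1 h2
    have : x ∈ {x : UI × ℂ | ∀ u, F.P k (x.1, u) ≠ x.2} :=
      fun u hu => h2 (F.carc_sub _ _ ⟨u, hu⟩ h1)
    filter_upwards [(arc_open (F.cont k)).mem_nhds this] with y hy h
    obtain ⟨u, hu⟩ := F.arc_sub _ _ h
    exact hy u hu
  disj := F.arc_disj

end PathFam
end PG

/-! Part F: the square roots change sign across the arc -/

namespace PG
open Filter Topology

lemma no_sqrt {a b : ℂ} (hab : a ≠ b) {S : ℂ → ℂ} (hS : ∀ q, q ≠ a → q ≠ b → ContinuousAt S q)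
    (h2 : ∀ q, q ≠ a → q ≠ b → S q ^ 2 = (b - q) / (a - q)) : False := by
  have hba : b - a ≠ 0 := sub_ne_zero.mpr hab.symm
  let w : ℝ → ℂ := fun θ => Complex.exp (θ * Complex.I) / 2
  have hw : ∀ θ, ‖w θ‖ = 1 / 2 := by
    intro θ
    simp [w, Complex.norm_exp_ofReal_mul_I]
  have hw0 : ∀ θ, w θ ≠ 0 := by
    intro θ h
    have := hw θ
    rw [h] at this; norm_num at this
  have hw1 : ∀ θ, 1 - w θ ∈ Complex.slitPlane := by
    intro θ
    left
    have := (Complex.abs_re_le_norm (w θ)).trans (hw θ).le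
    have := (abs_le.mp this).2
    simp; linarith
  have hwc : Continuous w := by fun_prop
  let q : ℝ → ℂ := fun θ => a + (b - a) * w θ
  have hqc : Continuous q := by fun_prop
  have hqa : ∀ θ, q θ ≠ a := by
    intro θ h
    have : (b - a) * w θ = 0 := by simpa [q] using h
    rcases mul_eq_zero.mp this with h | h
    · exact hba h
    · exact hw0 θ h
  have hqb : ∀ θ, q θ ≠ b := by
    intro θ h
    have h3 : (b - a) * (1 - w θ) = 0 := by
      simp only [q] at h; linear_combination -h
    rcases mul_eq_zero.mp h3 with h | h
    · exact hba h
    · exact Complex.slitPlane_ne_zero (hw1 θ) h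
  obtain ⟨B, hB⟩ : ∃ B : ℂ, B ^ 2 = b - a := IsAlgClosed.exists_pow_nat_eq _ (by norm_num)
  let v : ℝ → ℂ := fun θ => B * (1 - w θ) ^ (1 / 2 : ℂ)
  have hvc : Continuous v := by
    rw [continuous_iff_continuousAt]
    intro θ
    refine continuousAt_const.mul (ContinuousAt.cpow ?_ continuousAt_const (hw1 θ))
    exact (continuous_const.sub hwc).continuousAt
  have hv2 : ∀ θ, v θ ^ 2 = b - q θ := by
    intro θ
    have : ((1 - w θ) ^ (1 / 2 : ℂ)) ^ 2 = 1 - w θ := by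
      rw [← Complex.cpow_mul_nat]; simp
    simp only [v, mul_pow, hB, this, q]; ring
  have hS0 : ∀ θ, S (q θ) ≠ 0 := by
    intro θ h
    have := h2 _ (hqa θ) (hqb θ)
    rw [h] at this
    have h3 : (b - q θ) / (a - q θ) ≠ 0 :=
      div_ne_zero (sub_ne_zero.mpr (hqb θ).symm) (sub_ne_zero.mpr (hqa θ).symm)
    apply h3; rw [← this]; simp
  let m : ℝ → ℂ := fun θ => v θ / S (q θ) * Complex.exp (-(θ * Complex.I / 2))
  have hmc : Continuous m := by
    rw [continuous_iff_continuousAt]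
    intro θ
    refine ContinuousAt.mul (hvc.continuousAt.div ?_ (hS0 θ)) (by fun_prop)
    exact ContinuousAt.comp (g := S) (hS _ (hqa θ) (hqb θ)) hqc.continuousAt
  have hm2 : ∀ θ, m θ ^ 2 = - (b - a) / 2 := by
    intro θ
    have h4 : Complex.exp (-(θ * Complex.I / 2)) ^ 2 * Complex.exp (θ * Complex.I) = 1 := by
      rw [← Complex.exp_nat_mul, ← Complex.exp_add, ← Complex.exp_zero]
      congr 1; push_cast; ring
    have h5 : b - q θ ≠ 0 := sub_ne_zero.mpr (hqb θ).symm
    have h6 : a - q θ ≠ 0 := sub_ne_zero.mpr (hqa θ).symm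
    have h7 : v θ ^ 2 / S (q θ) ^ 2 = a - q θ := by
      rw [hv2, h2 _ (hqa θ) (hqb θ)]
      field_simp
    simp only [m, mul_pow, div_pow]
    rw [h7]
    simp only [q, w]
    linear_combination (-(b - a) / 2) * h4
  have hm0 : ∀ θ, m θ ≠ 0 := by
    intro θ h
    have := hm2 θ
    rw [h] at this
    apply hba
    linear_combination 2 * this
  have hconst : m (2 * Real.pi) = m 0 := by
    have hpc : IsPreconnected (Set.univ : Set ℝ) := isPreconnected_univ
    rcases hpc.eq_or_eq_neg_of_sq_eq hmc.continuousOn (g := fun _ => m 0) continuousOn_const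
      (by intro θ _; simp [hm2]) (by intro θ _; exact hm0 0) with h | h
    · exact h trivial
    · have := h (mem_univ (0 : ℝ))
      simp only [Pi.neg_apply] at this
      exact absurd (by linear_combination (1/2) * this) (hm0 0)
  have hw2 : w (2 * Real.pi) = w 0 := by
    simp only [w]; push_cast; rw [Complex.exp_two_pi_mul_I]; simp
  have hneg : m (2 * Real.pi) = - m 0 := by
    have h8 : Complex.exp (-(((2 * Real.pi : ℝ) : ℂ) * Complex.I / 2)) = -1 := by
      rw [show -(((2 * Real.pi : ℝ) : ℂ) * Complex.I / 2) = -(Real.pi * Complex.I) by push_cast; ring,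
        Complex.exp_neg, Complex.exp_pi_mul_I]; norm_num
    simp only [m, q, v, hw2]
    rw [h8]; simp
  rw [hconst] at hneg
  exact hm0 0 (by linear_combination (1/2) * hneg)

/-- sign change across the arc -/
theorem Geo.sign_change {Γ A : Set ℂ} (K : Geo Γ A) (hΓ : IsClosed Γ) (hA : A ⊆ Γ) {a b : ℂ} (hab : a ≠ b)
    (haΓ : a ∈ Γ) (hbΓ : b ∈ Γ) (haA : a ∉ A) (hbA : b ∉ A) {Rf : ℂ → ℂ}
    (hAc : ∀ q, q ∉ A → q ≠ a → q ≠ b → ∀ᶠ q' in 𝓝 q, q' ∉ A)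
    (hRc : ∀ q, q ∉ A → q ≠ a → q ≠ b → ContinuousAt Rf q)
    (hR2 : ∀ q, Rf q ^ 2 = (b - q) / (a - q)) {p : ℂ} (hp : p ∈ A) {ρ : ℂ → ℂ}
    (hρ : LocRoot (fun q => (b - q) / (a - q)) p ρ) :
    ∃ ε : ℂ, (ε = 1 ∨ ε = -1) ∧ ∀ᶠ q in 𝓝 p, ρ q ≠ 0 ∧ (q ∈ A ∨ q ∉ Γ) ∧
      (0 < (K.φ q).im → Rf q = ε * ρ q) ∧ ((K.φ q).im < 0 → Rf q = - ε * ρ q) := by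
  let D : Set ℂ := Γᶜ ∪ A
  have hDo : IsOpen D := K.D_open
  have hDa : ∀ q ∈ D, q ≠ a := by
    rintro q (h | h) rfl
    · exact h haΓ
    · exact haA h
  have hDb : ∀ q ∈ D, q ≠ b := by
    rintro q (h | h) rfl
    · exact h hbΓ
    · exact hbA h
  have hnum : ∀ ζ ∈ Str, ∀ c : ℂ, (∀ q ∈ D, q ≠ c) → (c - K.p) * K.f ζ - 1 ≠ 0 := by
    intro ζ hζ c hc h
    by_cases h0 : K.f ζ = 0
    · rw [h0] at h; simp at h
    · apply hc _ (K.fw ζ hζ h0)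
      have : (K.f ζ)⁻¹ = c - K.p := by
        rw [inv_eq_iff_eq_inv]
        exact eq_inv_of_mul_eq_one_right (sub_eq_zero.mp h)
      rw [this]; ring
  have hsc : IsSimplyConnected Str := by
    apply convex_sc
    · have : Str = {z : ℂ | -1 < z.im} ∩ {z : ℂ | z.im < 1} := by
        ext z
        show |z.im| < 1 ↔ -1 < z.im ∧ z.im < 1
        exact abs_lt
      rw [this]
      exact (convex_halfSpace_im_gt (-1)).inter (convex_halfSpace_im_lt 1)
    · exact ⟨0, by show |(0 : ℂ).im| < 1; simp⟩
  obtain ⟨r, hrc, hr2⟩ := exists_continuousOn_pow_eq hsc Str_open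
    (g := fun ζ => ((b - K.p) * K.f ζ - 1) / ((a - K.p) * K.f ζ - 1))
    (by
      have := K.fd.continuousOn
      apply ContinuousOn.div
      · fun_prop
      · fun_prop
      · intro ζ hζ; exact hnum ζ hζ a hDa)
    (by
      rintro ⟨ζ, hζ, h⟩
      exact div_ne_zero (hnum ζ hζ b hDb) (hnum ζ hζ a hDa) h) two_ne_zero
  let s : ℂ → ℂ := fun q => r (K.φ q)
  have hsc : ∀ q ∈ D, ContinuousAt s q := by
    intro q hq
    exact ContinuousAt.comp (g := r) (hrc.continuousAt (Str_open.mem_nhds (K.φ_mem hq)))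
      (K.φ_an hq).continuousAt
  have hs2 : ∀ q ∈ D, s q ^ 2 = (b - q) / (a - q) := by
    intro q hq
    show r (K.φ q) ^ 2 = _
    rw [hr2, K.fφ hq]
    have h1 : q - K.p ≠ 0 := K.ne_p hq
    have h2 : a - q ≠ 0 := sub_ne_zero.mpr (hDa q hq).symm
    have e : ∀ c : ℂ, (c - K.p) * (q - K.p)⁻¹ - 1 = (c - q) / (q - K.p) := by
      intro c; field_simp; ring
    rw [e, e, div_div_div_cancel_right₀ h1]
  have hc0 : ∀ q ∈ D, (b - q) / (a - q) ≠ 0 := fun q hq =>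
    div_ne_zero (sub_ne_zero.mpr (hDb q hq).symm) (sub_ne_zero.mpr (hDa q hq).symm)
  have hs0 : ∀ q ∈ D, s q ≠ 0 := by
    intro q hq h
    apply hc0 q hq
    rw [← hs2 q hq, h]; simp
  have side : ∀ L : Geo Γ A, ∃ ε : ℂ, (ε = 1 ∨ ε = -1) ∧ ∀ q ∈ L.Om, Rf q = ε * s q := by
    intro L
    have hsub : L.Om ⊆ D := fun q hq => Or.inl hq.1
    rcases (L.Om_preconn hA).eq_or_eq_neg_of_sq_eq (f := Rf) (g := s)
      (fun q hq => (hRc q (fun h => hq.1 (hA h)) (hDa q (hsub hq)) (hDb q (hsub hq))).continuousWithinAt)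
      (fun q hq => (hsc q (hsub hq)).continuousWithinAt)
      (fun q hq => by simp [hR2, hs2 q (hsub hq)]) (fun {q} hq => hs0 q (hsub hq)) with h | h
    · exact ⟨1, Or.inl rfl, fun q hq => by rw [h hq, one_mul]⟩
    · exact ⟨-1, Or.inr rfl, fun q hq => by rw [h hq]; simp⟩
  obtain ⟨ε₁, he₁, h₁⟩ := side K
  obtain ⟨ε₂, he₂, h₂⟩ := side K.flip
  have hne : ε₁ ≠ ε₂ := by
    intro heq
    classical
    refine no_sqrt hab (S := fun q => if q ∈ A then ε₁ * s q else Rf q) ?_ ?_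
    · intro q hqa hqb
      by_cases hq : q ∈ A
      · have hqD : q ∈ D := Or.inr hq
        have hev : (fun q => if q ∈ A then ε₁ * s q else Rf q) =ᶠ[𝓝 q] fun q => ε₁ * s q := by
          filter_upwards [hDo.mem_nhds hqD] with q' hq'
          by_cases h : q' ∈ A
          · simp [h]
          · simp only [h, if_false]
            have hq'' : q' ∉ Γ := hq'.resolve_right h
            rcases K.Om_cover hA hq'' with h' | h'
            · exact h₁ q' h'
            · rw [heq]; exact h₂ q' h'
        exact (continuousAt_const.mul (hsc q hqD)).congr hev.symm
      · have hev : (fun q => if q ∈ A then ε₁ * s q else Rf q) =ᶠ[𝓝 q] Rf := by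
          filter_upwards [hAc q hq hqa hqb] with q' hq'
          simp [hq']
        exact (hRc q hq hqa hqb).congr hev.symm
    · intro q hqa hqb
      by_cases hq : q ∈ A
      · simp only [hq, if_true, mul_pow, hs2 q (Or.inr hq)]
        rcases he₁ with h | h <;> rw [h] <;> ring
      · simp only [hq, if_false, hR2]
  have he : ε₂ = - ε₁ := by
    rcases he₁ with h | h <;> rcases he₂ with h' | h' <;> rw [h, h'] at hne ⊢ <;> simp at hne ⊢
  have hpD : p ∈ D := Or.inr hp
  have hfin : ∀ η : ℂ, (η = 1 ∨ η = -1) → (∀ᶠ q in 𝓝 p, s q = η * ρ q ∧ ρ q ≠ 0) →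
      ∃ ε : ℂ, (ε = 1 ∨ ε = -1) ∧ ∀ᶠ q in 𝓝 p, ρ q ≠ 0 ∧ (q ∈ A ∨ q ∉ Γ) ∧
      (0 < (K.φ q).im → Rf q = ε * ρ q) ∧ ((K.φ q).im < 0 → Rf q = - ε * ρ q) := by
    intro η hη h
    refine ⟨ε₁ * η, ?_, ?_⟩
    · rcases he₁ with h | h <;> rcases hη with h' | h' <;> rw [h, h'] <;> simp
    · filter_upwards [h, hDo.mem_nhds hpD] with q hq hqD
      refine ⟨hq.2, hqD.symm, fun hpos => ?_, fun hneg => ?_⟩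
      · have : q ∉ Γ := by
          rcases hqD with h | h
          · exact h
          · have := (K.im_zero (Or.inr h)).mpr h
            linarith
        rw [h₁ q ⟨this, hpos⟩, hq.1]; ring
      · have : q ∉ Γ := by
          rcases hqD with h | h
          · exact h
          · have := (K.im_zero (Or.inr h)).mpr h
            linarith
        rw [h₂ q ⟨this, by rw [K.flip_φ, neg_im]; linarith⟩, hq.1, he]; ring
  have hρ0 : ρ p ≠ 0 := by
    intro h
    apply hc0 p hpD
    have := hρ.1 p
    simp only at this
    rw [← this, h]; simp
  rcases sqrt_alt (hsc p hpD) hρ.2.self_of_nhds hρ0 (by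
    filter_upwards [hDo.mem_nhds hpD] with q hq
    rw [hs2 q hq, hρ.1]) with h | h
  · exact hfin 1 (Or.inl rfl) (by filter_upwards [h] with q hq; simpa using hq)
  · exact hfin (-1) (Or.inr rfl) (by filter_upwards [h] with q hq; simpa using hq)

end PG

/-! Part F2: bits are toggles -/

namespace PG
open Filter Topology

variable {n : ℕ} {Z Γ Γ' : Set ℂ}

lemma bit_tog (F : PathFam n Z Γ Γ') (hZ : IsClosed Z) {t : UI} {Δ : Set ℂ} (hΔ : IsClosed Δ)
    (hsub : ∀ k, F.carc k t ⊆ Δ) (hcov : ∀ p ∈ Δ, p ∉ Z → ∃ k, p ∈ F.arc k t)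
    (hZΔ : Z ⊆ Δ) (K : ∀ k, Geo Δ (F.arc k t)) (S : Sys n Z) (hSΓ : S.Γ = Δ)
    (hSγ : ∀ k, S.γ k = F.arc k t) (hSα : ∀ k, S.α k = (K k).α) {p : ℂ} (hp : p ∉ Z) {k : Fin n}
    {y : ℂ → Bool} (h : (F.toArcFam hZ).IsBit t p k y) : LocTog S k y p := by
  rcases h with ⟨h1, ρ, hρ, hy⟩ | ⟨h1, h2⟩
  · left
    have h1' : p ∈ F.arc k t := h1
    refine ⟨by rw [hSγ]; exact h1', ?_⟩
    have hA : F.arc k t ⊆ Δ := (F.arc_sub k t).trans (hsub k)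
    have hnc : ∀ q, q ∉ F.arc k t → q ≠ F.a k → q ≠ F.b k → q ∉ F.carc k t := by
      rintro q hq ha hb ⟨u, hu⟩
      apply hq
      refine ⟨u, ⟨?_, ?_⟩, hu⟩
      · rcases eq_or_lt_of_le (show (0 : UI) ≤ u from u.2.1) with h | h
        · exfalso; apply ha; rw [← hu, ← F.P0 k t, h]
        · exact h
      · rcases eq_or_lt_of_le (show u ≤ (1 : UI) from u.2.2) with h | h
        · exfalso; apply hb; rw [← hu, ← F.P1 k t, h]
        · exact h
    obtain ⟨ε, hε, hev⟩ := (K k).sign_change hΔ hA (F.a_ne_b k) (hZΔ (F.aZ k)) (hZΔ (F.bZ k))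
      F.a_not_arc F.b_not_arc (Rf := fun q => F.Rt k (t, q))
      (by
        intro q hq ha hb
        filter_upwards [(F.carc_closed k t).isOpen_compl.mem_nhds (hnc q hq ha hb)] with q' h' h''
        exact h' (F.arc_sub _ _ h''))
      (by
        intro q hq ha hb
        have h3 := F.Rt_cont k (t, q) (hnc q hq ha hb)
        exact ContinuousAt.comp (g := F.Rt k) (f := fun q => (t, q)) h3 (by fun_prop))
      (fun q => F.Rt_sq k (t, q)) h1' hρ
    refine ⟨fun q => ε * Complex.I * (K k).φ q, ?_, ?_⟩
    · exact analyticAt_const.mul ((K k).φ_an (Or.inr h1'))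
    · filter_upwards [hev] with q hq
      obtain ⟨h0, hD, hpos, hneg⟩ := hq
      have hyq : (y q = true ↔ F.Rt k (t, q) ≠ ρ q) := hy q
      have hre : (ε * Complex.I * (K k).φ q).re = - ε.re * ((K k).φ q).im := by
        rcases hε with h | h <;> rw [h] <;> simp
      have hz : q ∈ Δᶜ ∪ F.arc k t := hD.symm
      have hnn : ρ q ≠ - ρ q := by
        intro h; apply h0; linear_combination (1/2) * h
      rw [hSα, (K k).α_in hz, hre]
      refine ⟨?_, ?_, ?_⟩
      · rcases hε with h | h <;> rw [h] <;> simp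
      · intro hyt
        have hR := hyq.mp hyt
        rcases hε with h | h
        · rw [h] at hpos ⊢
          by_contra hc
          apply hR
          rw [hpos (by simp at hc; exact hc)]; ring
        · rw [h] at hneg ⊢
          by_contra hc
          apply hR
          rw [hneg (by simp at hc; exact hc)]; ring
      · intro hyf
        have hR : F.Rt k (t, q) = ρ q := by
          by_contra hc
          rw [hyq.mpr hc] at hyf
          simp at hyf
        rcases hε with h | h
        · rw [h] at hneg ⊢
          by_contra hc
          have := hneg (by simp at hc; exact hc)
          rw [hR] at this
          exact hnn (by linear_combination this)
        · rw [h] at hpos ⊢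
          by_contra hc
          have := hpos (by simp at hc; exact hc)
          rw [hR] at this
          exact hnn (by linear_combination this)
  · right
    refine ⟨?_, Eventually.of_forall h2⟩
    rw [hSΓ]
    intro hpΔ
    obtain ⟨j, hj⟩ := hcov p hpΔ hp
    exact h1 j hj

lemma exists_sys (F : PathFam n Z Γ Γ') (hn : 0 < n) {t : UI} {Δ : Set ℂ} (hΔ : IsClosed Δ)
    (hne : ∃ q, q ∉ Δ)
    (hsub : ∀ k, F.carc k t ⊆ Δ) (hcov : ∀ p ∈ Δ, p ∉ Z → ∃ k, p ∈ F.arc k t)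
    (hZΔ : Z ⊆ Δ) (hpg : PiecewiseGeodesic Δ Z) (hZ : IsClosed Z) :
    ∃ S : Sys n Z, S.Γ = Δ ∧ ∀ p ∉ Z, ∀ k y, (F.toArcFam hZ).IsBit t p k y → LocTog S k y p := by
  have hA : ∀ k, F.arc k t ⊆ Δ := fun k => (F.arc_sub k t).trans (hsub k)
  have hK : ∀ k, Nonempty (Geo Δ (F.arc k t)) := by
    intro k
    obtain ⟨x, hx⟩ := F.arc_nonempty k t
    have := hpg x ⟨hA k hx, F.arc_avoid hx⟩
    rw [F.comp_eq hsub hcov hx] at this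
    exact exists_geo this (hA k)
  let K : ∀ k, Geo Δ (F.arc k t) := fun k => (hK k).some
  refine ⟨mkSys hn hΔ hZΔ hne hcov (fun k p hp => ⟨hA k hp, F.arc_avoid hp⟩)
    (fun k => F.arc_nonempty k t) (F.arc_disj t) K, rfl, ?_⟩
  intro p hp k y h
  exact bit_tog F hZ hΔ hsub hcov hZΔ K _ rfl (fun _ => rfl) (fun _ => rfl) hp h

theorem exists_WD (hn : 2 ≤ n) {z : Fin n → ℂ} (hz : Function.Injective z)
    (hΓ : IsClosed Γ) (hΓ' : IsClosed Γ') (hne : ∃ q, q ∉ Γ) (hne' : ∃ q, q ∉ Γ')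
    (hzΓ : Set.range z ⊆ Γ) (hzΓ' : Set.range z ⊆ Γ')
    (hiso : IsotopicRel Γ Γ' (Set.range z))
    (hpg : PiecewiseGeodesic Γ (Set.range z)) (hpg' : PiecewiseGeodesic Γ' (Set.range z)) :
    ∃ (S S' : Sys n (Set.range z)) (w : ℂ → List (Fin n)), S.Γ = Γ ∧ S'.Γ = Γ' ∧ WD S S' w := by
  have hZ : IsClosed (Set.range z) := (Set.finite_range z).isClosed
  obtain ⟨F⟩ := exists_pathFam hn hz hiso
  obtain ⟨S, hS, hSb⟩ := exists_sys F (by omega) (t := 0) hΓ hne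
    (by rintro k _ ⟨u, rfl⟩; exact F.sub0 k u) (by
      intro p hp hpZ
      obtain ⟨k, u, hu, h⟩ := F.cover0 p hp hpZ
      exact ⟨k, u, hu, h⟩) hzΓ hpg hZ
  obtain ⟨S', hS', hSb'⟩ := exists_sys F (by omega) (t := 1) hΓ' hne'
    (by rintro k _ ⟨u, rfl⟩; exact F.sub1 k u) (by
      intro p hp hpZ
      obtain ⟨k, u, hu, h⟩ := F.cover1 p hp hpZ
      exact ⟨k, u, hu, h⟩) hzΓ' hpg' hZ
  obtain ⟨w, hw⟩ := (F.toArcFam hZ).words (by omega)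
  refine ⟨S, S', w, hS, hS', ?_⟩
  intro p hp
  obtain ⟨k, l, u, y, x, h1, h2, h3, h4⟩ := hw p hp
  exact ⟨k, l, u, y, x, h1, hSb p hp k y h2, hSb' p hp l x h3, h4⟩

end PG

/-! Part G: boundedness of the words -/

namespace PG
open Filter Topology

lemma const_on {β : Type*} {X : Set ℂ} (hX : IsPreconnected X) {g : ℂ → β}
    (h : ∀ p ∈ X, ∀ᶠ q in 𝓝 p, g q = g p) {p q : ℂ} (hp : p ∈ X) (hq : q ∈ X) : g p = g q := by
  letI : TopologicalSpace β := ⊥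
  haveI : DiscreteTopology β := ⟨rfl⟩
  have hc : ContinuousOn g X := by
    intro x hx
    have : ContinuousAt g x := by
      have h' : (fun _ => g x) =ᶠ[𝓝 x] g := (h x hx).mono fun q hq => hq.symm
      exact continuousAt_const.congr h'
    exact this.continuousWithinAt
  exact hX.constant hc hp hq

lemma sphere_bound {X : Set ℂ} (hX : IsPreconnected X) {f : ℂ → ℤ} {Q : Finset ℂ} (hQ : Q.card ≤ 4)
    (h1 : ∀ p ∈ X, ∀ᶠ q in 𝓝 p, |f q - f p| ≤ 4) (h2 : ∀ p ∈ X, p ∉ Q → ∀ᶠ q in 𝓝 p, f q = f p)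
    {p q : ℂ} (hp : p ∈ X) (hq : q ∈ X) : f q ≤ f p + 37 := by
  classical
  let W : Finset ℤ := Q.biUnion fun q => Finset.Icc (f q - 4) (f q + 4)
  have hW : W.card ≤ 36 := by
    calc W.card ≤ Q.card * 9 := Finset.card_biUnion_le_card_mul _ _ _ (by
          intro q _; simp; omega)
      _ ≤ 36 := by omega
  obtain ⟨m, hm, hmW⟩ : ∃ m ∈ Finset.Ioc (f p) (f p + 37), m ∉ W := by
    apply Finset.exists_mem_notMem_of_card_lt_card
    simp; omega
  rw [Finset.mem_Ioc] at hm
  have hloc : ∀ x ∈ X, ∀ᶠ y in 𝓝 x, (f y < m) = (f x < m) := by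
    intro x hx
    by_cases hxQ : x ∈ Q
    · have hx4 : m ∉ Finset.Icc (f x - 4) (f x + 4) := by
        intro h; exact hmW (Finset.mem_biUnion.mpr ⟨x, hxQ, h⟩)
      rw [Finset.mem_Icc] at hx4
      filter_upwards [h1 x hx] with y hy
      rw [abs_le] at hy
      apply propext
      constructor <;> intro h <;> by_contra hc <;> apply hx4 <;> constructor <;> omega
    · filter_upwards [h2 x hx hxQ] with y hy
      rw [hy]
  have := const_on hX hloc hp hq
  have h3 : f q < m := this.mp (by omega)
  omega

/-- local structure of a smooth curve at a point -/
lemma c1_local {Γ : Set ℂ} (hΓ : IsC1JordanCurve Γ) {z : ℂ} (hz : z ∈ Γ) :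
    ∃ d : ℂ, d ≠ 0 ∧ ∀ ε : ℝ, 0 < ε → ∃ r0 : ℝ, 0 < r0 ∧ ∃ γ : ℝ → ℂ, ∃ t0 η : ℝ, 0 < η ∧
      γ t0 = z ∧ (∀ s t, |s - t0| < η → |t - t0| < η → ‖(γ s - γ t) / d - (s - t : ℝ)‖ ≤ ε * |s - t|) ∧
      ∀ q ∈ Γ, ‖q - z‖ < r0 → ∃ t, |t - t0| < η ∧ γ t = q := by
  obtain ⟨γ, ⟨hc, hper, hinj⟩, hC1, hd, rfl⟩ := hΓ
  obtain ⟨t0, rfl⟩ := hz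
  refine ⟨deriv γ t0, hd t0, fun ε hε => ?_⟩
  have hd0 := hd t0
  have hstrict := (hC1.contDiffAt (x := t0)).hasStrictDerivAt (by simp)
  have hlo := hstrict.hasStrictFDerivAt.isLittleO.def (c := ε * ‖deriv γ t0‖) (by positivity)
  obtain ⟨η, hη, hball⟩ := Metric.eventually_nhds_iff.mp hlo
  set T : ℝ := 2 * Real.pi with hTdef
  have hT : 0 < T := Real.two_pi_pos
  set η' : ℝ := min η (T / 2) with hη'
  have hη'0 : 0 < η' := lt_min hη (by linarith)
  have hη'T : η' ≤ T / 2 := min_le_right _ _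
  have hcomp : IsCompact (γ '' Icc (t0 + η') (t0 + T - η' / 2)) := isCompact_Icc.image hc
  have hzn : γ t0 ∉ γ '' Icc (t0 + η') (t0 + T - η' / 2) := by
    rintro ⟨s, ⟨hs1, hs2⟩, hs⟩
    have := mod_close hT (mod_eq hT hper hinj hs) (by linarith) (by linarith)
    linarith
  obtain ⟨r0, hr0, hr⟩ := Metric.mem_nhds_iff.mp (hcomp.isClosed.isOpen_compl.mem_nhds hzn)
  refine ⟨r0, hr0, γ, t0, η', hη'0, rfl, ?_, ?_⟩
  · intro s t hs ht
    have := hball (y := (s, t)) (by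
      rw [Prod.dist_eq, max_lt_iff, Real.dist_eq, Real.dist_eq]
      exact ⟨lt_of_lt_of_le hs (min_le_left _ _), lt_of_lt_of_le ht (min_le_left _ _)⟩)
    simp only [ContinuousLinearMap.toSpanSingleton_apply] at this
    have e : (γ s - γ t) / deriv γ t0 - (s - t : ℝ) =
        (γ s - γ t - (s - t) • deriv γ t0) / deriv γ t0 := by
      rw [Complex.real_smul]; field_simp
    rw [e, norm_div, div_le_iff₀ (norm_pos_iff.mpr hd0)]
    refine this.trans (le_of_eq ?_)
    rw [Real.norm_eq_abs]; ring
  · rintro q ⟨s, rfl⟩ hq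
    have hmem := toIcoMod_mem_Ico hT (t0 - η' / 2) s
    have hs : γ (toIcoMod hT (t0 - η' / 2) s) = γ s := by
      have := hper.sub_zsmul_eq (x := s) (toIcoDiv hT (t0 - η' / 2) s)
      rw [← this, toIcoMod]
    refine ⟨toIcoMod hT (t0 - η' / 2) s, ?_, hs⟩
    by_contra hc'
    rw [abs_lt] at hc'
    have h1 : t0 + η' ≤ toIcoMod hT (t0 - η' / 2) s := by
      by_contra h; push Not at h
      exact hc' ⟨by linarith [hmem.1], by linarith⟩
    have : γ s ∈ Metric.ball (γ t0) r0 := by rw [Metric.mem_ball, dist_eq_norm]; exact hq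
    exact hr this ⟨_, ⟨h1, by linarith [hmem.2]⟩, hs⟩

/-- small circles meet the curve in at most two points -/
lemma c1_circle {Γ : Set ℂ} (hΓ : IsC1JordanCurve Γ) {z : ℂ} (hz : z ∈ Γ) :
    ∃ r0 : ℝ, 0 < r0 ∧ ∀ r, 0 < r → r < r0 → ∃ q1 q2 : ℂ, ∀ q ∈ Γ, ‖q - z‖ = r → q = q1 ∨ q = q2 := by
  obtain ⟨d, hd, H⟩ := c1_local hΓ hz
  obtain ⟨r0, hr0, γ, t0, η, hη, hγ, hlip, hloc⟩ := H (1/4) (by norm_num)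
  refine ⟨r0, hr0, fun r hr hrr => ?_⟩
  -- same side injectivity of the modulus
  have key : ∀ s t, |s - t0| < η → |t - t0| < η → 0 < (s - t0) * (t - t0) →
      ‖γ s - z‖ = r → ‖γ t - z‖ = r → s = t := by
    intro s t hs ht hst h1 h2
    have e1 := hlip s t hs ht
    have e2 := hlip s t0 hs (by simpa using hη)
    have e3 := hlip t t0 ht (by simpa using hη)
    rw [hγ] at e2 e3
    set A := (γ s - z) / d with hA
    set B := (γ t - z) / d with hB
    have hAB : (γ s - γ t) / d = A - B := by rw [hA, hB, ← sub_div]; congr 1; ring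
    rw [hAB] at e1
    have hn : ‖A‖ = ‖B‖ := by rw [hA, hB, norm_div, norm_div, h1, h2]
    have hn2 : Complex.normSq A = Complex.normSq B := by
      rw [Complex.normSq_eq_norm_sq, Complex.normSq_eq_norm_sq, hn]
    by_contra hne
    have r1 := (Complex.abs_re_le_norm _).trans e1
    have i1 := (Complex.abs_im_le_norm _).trans e1
    have r2 := (Complex.abs_re_le_norm _).trans e2
    have i2 := (Complex.abs_im_le_norm _).trans e2
    have r3 := (Complex.abs_re_le_norm _).trans e3
    have i3 := (Complex.abs_im_le_norm _).trans e3
    simp only [Complex.sub_re, Complex.sub_im, Complex.ofReal_re, Complex.ofReal_im, sub_zero] at r1 i1 r2 i2 r3 i3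
    rw [Complex.normSq_apply, Complex.normSq_apply] at hn2
    have hprod : (A.re - B.re) * (A.re + B.re) + (A.im - B.im) * (A.im + B.im) = 0 := by
      linarith
    have hsum : |s - t0| + |t - t0| = |s + t - 2 * t0| := by
      rcases lt_trichotomy (s - t0) 0 with h | h | h
      · have : t - t0 < 0 := by
          by_contra hc; push Not at hc; nlinarith
        rw [abs_of_neg h, abs_of_neg this, abs_of_neg (by linarith)]; ring
      · rw [h] at hst; simp at hst
      · have : 0 < t - t0 := by
          by_contra hc; push Not at hc; nlinarith
        rw [abs_of_pos h, abs_of_pos this, abs_of_pos (by linarith)]; ring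
    set σ := s - t with hσ
    set τ := s + t - 2 * t0 with hτ
    have hτ0 : 0 < |τ| := by
      rw [← hsum]
      have : s - t0 ≠ 0 := by intro h; rw [h] at hst; simp at hst
      have := abs_pos.mpr this
      have := abs_nonneg (t - t0)
      linarith
    have hσ0 : 0 < |σ| := abs_pos.mpr (sub_ne_zero.mpr hne)
    have r4 : |A.re + B.re - τ| ≤ 1 / 4 * |τ| := by
      rw [← hsum]
      calc |A.re + B.re - τ| = |(A.re - (s - t0)) + (B.re - (t - t0))| := by rw [hτ]; congr 1; ring
        _ ≤ _ := (abs_add_le _ _).trans (by linarith)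
    have i4 : |A.im + B.im| ≤ 1 / 4 * |τ| := by
      rw [← hsum]
      exact (abs_add_le _ _).trans (by linarith)
    have m1 : |(A.im - B.im) * (A.im + B.im)| ≤ 1 / 16 * (|σ| * |τ|) := by
      rw [abs_mul]
      calc _ ≤ (1 / 4 * |σ|) * (1 / 4 * |τ|) := by gcongr
        _ = _ := by ring
    have m2 : 9 / 16 * (|σ| * |τ|) ≤ |(A.re - B.re) * (A.re + B.re)| := by
      have u1 : 3 / 4 * |σ| ≤ |A.re - B.re| := by
        have := abs_sub_abs_le_abs_sub σ (A.re - B.re)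
        have h' := abs_sub_comm σ (A.re - B.re)
        linarith
      have u2 : 3 / 4 * |τ| ≤ |A.re + B.re| := by
        have := abs_sub_abs_le_abs_sub τ (A.re + B.re)
        have h' := abs_sub_comm τ (A.re + B.re)
        linarith
      rw [abs_mul]
      calc _ = (3 / 4 * |σ|) * (3 / 4 * |τ|) := by ring
        _ ≤ _ := by gcongr
    have : (A.re - B.re) * (A.re + B.re) = - ((A.im - B.im) * (A.im + B.im)) := by linarith
    rw [this, abs_neg] at m2
    have := mul_pos hσ0 hτ0
    linarith
  have side : ∀ o : ℝ, ∃ q1 : ℂ, ∀ t, |t - t0| < η → 0 < o * (t - t0) → ‖γ t - z‖ = r → γ t = q1 := by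
    intro o
    by_cases hex : ∃ t, |t - t0| < η ∧ 0 < o * (t - t0) ∧ ‖γ t - z‖ = r
    · obtain ⟨s, h1, h2, h3⟩ := hex
      refine ⟨γ s, fun t h1' h2' h3' => ?_⟩
      have : 0 < (t - t0) * (s - t0) := by
        by_contra hc; push Not at hc
        have := mul_pos h2' h2
        nlinarith [sq_nonneg o, mul_nonneg (sq_nonneg o) (neg_nonneg.mpr hc)]
      rw [key t s h1' h1 this h3' h3]
    · exact ⟨0, fun t h1 h2 h3 => absurd ⟨t, h1, h2, h3⟩ hex⟩
  obtain ⟨q1, hq1⟩ := side 1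
  obtain ⟨q2, hq2⟩ := side (-1)
  refine ⟨q1, q2, fun q hq hqr => ?_⟩
  obtain ⟨t, ht, rfl⟩ := hloc q hq (by rw [hqr]; exact hrr)
  rcases lt_trichotomy t t0 with h | h | h
  · right; exact hq2 t ht (by linarith) hqr
  · rw [h, hγ] at hqr; simp at hqr; linarith
  · left; exact hq1 t ht (by linarith) hqr

/-- transversal rays avoid the curve near the point -/
lemma c1_ray {Γ : Set ℂ} (hΓ : IsC1JordanCurve Γ) {z : ℂ} (hz : z ∈ Γ) :
    ∃ d : ℂ, d ≠ 0 ∧ ∀ v : ℂ, (v / d).im ≠ 0 → ∃ r0 : ℝ, 0 < r0 ∧ ∀ s : ℝ, 0 < s → s < r0 →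
      z + s * v ∉ Γ := by
  obtain ⟨d, hd, H⟩ := c1_local hΓ hz
  refine ⟨d, hd, fun v hv => ?_⟩
  have hv0 : 0 < ‖v / d‖ := norm_pos_iff.mpr (by intro h; rw [h] at hv; simp at hv)
  have hvim := abs_pos.mpr hv
  have hvle := Complex.abs_im_le_norm (v / d)
  set ε : ℝ := |(v / d).im| / (4 * ‖v / d‖) with hε
  have hε0 : 0 < ε := by positivity
  have hεv : ε * ‖v / d‖ = |(v / d).im| / 4 := by rw [hε]; field_simp
  have hε1 : ε ≤ 1 / 4 := by
    rw [hε, div_le_iff₀ (by positivity)]; linarith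
  obtain ⟨r0, hr0, γ, t0, η, hη, hγ, hlip, hloc⟩ := H ε hε0
  have hvn : 0 < ‖v‖ := norm_pos_iff.mpr (by rintro rfl; simp at hv)
  refine ⟨r0 / ‖v‖, by positivity, fun s hs hsr hmem => ?_⟩
  have hsv : s * ‖v‖ < r0 := by rwa [lt_div_iff₀ hvn] at hsr
  obtain ⟨t, ht, hγt⟩ := hloc _ hmem (by
    simp only [add_sub_cancel_left, norm_mul, Complex.norm_real, Real.norm_eq_abs, abs_of_pos hs]
    exact hsv)
  have e := hlip t t0 ht (by simpa using hη)
  rw [hγ, hγt] at e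
  have e' : (z + s * v - z) / d = s * (v / d) := by rw [add_sub_cancel_left, mul_div_assoc]
  rw [e'] at e
  have him := (Complex.abs_im_le_norm _).trans e
  simp only [Complex.sub_im, Complex.ofReal_im, sub_zero, Complex.im_ofReal_mul, abs_mul, abs_of_pos hs] at him
  have hn : |t - t0| ≤ s * ‖v / d‖ + ε * |t - t0| := by
    have h1 : |t - t0| = ‖((t - t0 : ℝ) : ℂ)‖ := by rw [Complex.norm_real, Real.norm_eq_abs]
    have h2 : ‖((t - t0 : ℝ) : ℂ)‖ ≤ ‖(s : ℂ) * (v / d)‖ + ‖(s : ℂ) * (v / d) - ((t - t0 : ℝ) : ℂ)‖ := by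
      have := norm_sub_norm_le (((t - t0 : ℝ) : ℂ)) ((s : ℂ) * (v / d))
      rw [norm_sub_rev] at this
      linarith
    have h3' : ‖(s : ℂ) * (v / d)‖ = s * ‖v / d‖ := by
      rw [norm_mul, Complex.norm_real, Real.norm_eq_abs, abs_of_pos hs]
    rw [h3', ← h1] at h2
    linarith [e]
  have h3 : |t - t0| ≤ 2 * (s * ‖v / d‖) := by
    have := abs_nonneg (t - t0)
    nlinarith
  have h4 : s * |(v / d).im| ≤ ε * (2 * (s * ‖v / d‖)) := him.trans (by gcongr)
  have h5 : ε * (2 * (s * ‖v / d‖)) = s * (|(v / d).im| / 2) := by rw [show ε * (2 * (s * ‖v / d‖)) = 2 * s * (ε * ‖v / d‖) by ring, hεv]; ring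
  rw [h5] at h4
  have := mul_pos hs hvim
  linarith

end PG

/-! Part G2: global bound and the theorem -/

namespace PG
open Filter Topology

variable {n : ℕ} {Z : Set ℂ}

lemma Lt_length (l : Fin n) (w : List (Fin n)) : |((Lt l w).length : ℤ) - w.length| ≤ 1 := by
  cases w with
  | nil => simp [Lt]
  | cons a t =>
    by_cases h : a = l <;> simp [Lt, h]

lemma Rt_length (l : Fin n) (w : List (Fin n)) : |((Rt l w).length : ℤ) - w.length| ≤ 1 := by
  have := Lt_length l w.reverse
  simpa [Rt] using this

lemma tg_length {f : List (Fin n) → List (Fin n)} (hf : ∀ w, |((f w).length : ℤ) - w.length| ≤ 1)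
    (b : Bool) (w : List (Fin n)) : |((tg f b w).length : ℤ) - w.length| ≤ 1 := by
  cases b
  · simp [tg]
  · simpa [tg] using hf w

lemma WD.len_loc {S S' : Sys n Z} {w : ℂ → List (Fin n)} (h : WD S S' w) {p : ℂ} (hp : p ∉ Z) :
    ∀ᶠ q in 𝓝 p, |((w q).length : ℤ) - (w p).length| ≤ 4 := by
  obtain ⟨k, l, u, y, x, hu, h1, h2, h3⟩ := h p hp
  have hb : ∀ q, w q = tg (Lt l) (x q) (tg (Rt k) (y q) u) →
      |((w q).length : ℤ) - u.length| ≤ 2 := by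
    intro q hq
    have a1 := tg_length (Lt_length l) (x q) (tg (Rt k) (y q) u)
    have a2 := tg_length (Rt_length k) (y q) u
    rw [← hq] at a1
    rw [abs_le] at *
    omega
  have hp' := hb p h3.self_of_nhds
  filter_upwards [h3] with q hq
  have := hb q hq
  rw [abs_le] at *
  omega

lemma WD.len_const {S S' : Sys n Z} {w : ℂ → List (Fin n)} (h : WD S S' w) {p : ℂ}
    (hp : p ∉ S.Γ) (hp' : p ∉ S'.Γ) :
    ∀ᶠ q in 𝓝 p, ((w q).length : ℤ) = (w p).length := by
  obtain ⟨k, l, u, y, x, hu, h1, h2, h3⟩ := h p (fun hz => hp (S.Zsub hz))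
  have hy : ∀ᶠ q in 𝓝 p, y q = false := by
    rcases h1 with h1 | h1
    · exact absurd (S.sub k p h1.1).1 hp
    · exact h1.2
  have hx : ∀ᶠ q in 𝓝 p, x q = false := by
    rcases h2 with h1 | h1
    · exact absurd (S'.sub l p h1.1).1 hp'
    · exact h1.2
  have hw : ∀ᶠ q in 𝓝 p, w q = u := by
    filter_upwards [hy, hx, h3] with q a b c
    rw [c, a, b]; rfl
  have e := hw.self_of_nhds
  filter_upwards [hw] with q hq
  rw [hq, e]

lemma sphere_preconn (c : ℂ) (r : ℝ) : IsPreconnected (Metric.sphere c r) :=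
  isPreconnected_sphere (by rw [Complex.rank_real_complex]; norm_num) c r

lemma exists_dir {d d' : ℂ} (hd : d ≠ 0) (hd' : d' ≠ 0) :
    ∃ v : ℂ, v ≠ 0 ∧ (v / d).im ≠ 0 ∧ (v / d').im ≠ 0 := by
  by_cases h : (d / d').re = 0
  · refine ⟨(1 + I) * d, mul_ne_zero ?_ hd, ?_, ?_⟩
    · intro h; have := congrArg Complex.re h; simp at this
    · rw [mul_div_assoc, div_self hd]; simp
    · rw [mul_div_assoc]
      intro h2
      have h3 : (d / d').im = 0 := by simpa [h] using h2
      exact div_ne_zero hd hd' (Complex.ext h h3)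
  · refine ⟨I * d, mul_ne_zero I_ne_zero hd, ?_, ?_⟩
    · rw [mul_div_assoc, div_self hd]; simp
    · rw [mul_div_assoc]; simpa using h

lemma WD.near_pt {S S' : Sys n Z} {w : ℂ → List (Fin n)} (h : WD S S' w) (hZ : Z.Finite)
    (hΓ : IsC1JordanCurve S.Γ) (hΓ' : IsC1JordanCurve S'.Γ) {z : ℂ} (hz : z ∈ Z) :
    ∃ M : ℤ, ∀ᶠ q in 𝓝 z, q ≠ z → ((w q).length : ℤ) ≤ M := by
  classical
  obtain ⟨d, hd, hray⟩ := c1_ray hΓ (S.Zsub hz)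
  obtain ⟨d', hd', hray'⟩ := c1_ray hΓ' (S'.Zsub hz)
  obtain ⟨v, hv, hv1, hv2⟩ := exists_dir hd hd'
  obtain ⟨r1, hr1, H1⟩ := hray v hv1
  obtain ⟨r2, hr2, H2⟩ := hray' v hv2
  obtain ⟨r3, hr3, H3⟩ := c1_circle hΓ (S.Zsub hz)
  obtain ⟨r4, hr4, H4⟩ := c1_circle hΓ' (S'.Zsub hz)
  obtain ⟨r5, hr5, H5⟩ : ∃ r5 : ℝ, 0 < r5 ∧ ∀ q, ‖q - z‖ < r5 → q ∈ Z → q = z := by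
    have : (Z \ {z})ᶜ ∈ 𝓝 z := (hZ.sdiff).isClosed.isOpen_compl.mem_nhds (by simp)
    obtain ⟨r, hr, hb⟩ := Metric.mem_nhds_iff.mp this
    refine ⟨r, hr, fun q hq hqZ => ?_⟩
    by_contra hne
    exact hb (by rwa [Metric.mem_ball, dist_eq_norm]) ⟨hqZ, hne⟩
  have hvn : 0 < ‖v‖ := norm_pos_iff.mpr hv
  set ρ : ℝ := min r1 r2 with hρ
  have hρ0 : 0 < ρ := lt_min hr1 hr2
  set f : ℂ → ℤ := fun q => ((w q).length : ℤ) with hf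
  -- constancy along the ray
  set X : Set ℂ := (fun s : ℝ => z + s * v) '' Ioo 0 ρ with hX
  have hXc : IsPreconnected X := isPreconnected_Ioo.image _ (by fun_prop)
  have hXl : ∀ p ∈ X, ∀ᶠ q in 𝓝 p, f q = f p := by
    rintro _ ⟨s, ⟨hs1, hs2⟩, rfl⟩
    exact h.len_const (H1 s hs1 (lt_of_lt_of_le hs2 (min_le_left _ _)))
      (H2 s hs1 (lt_of_lt_of_le hs2 (min_le_right _ _)))
  set C : ℤ := f (z + (ρ / 2 : ℝ) * v) with hC
  have hCX : z + (ρ / 2 : ℝ) * v ∈ X := ⟨ρ / 2, ⟨by linarith, by linarith⟩, rfl⟩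
  refine ⟨C + 37, ?_⟩
  set r0 : ℝ := min (min r3 r4) (min r5 (ρ * ‖v‖)) with hr0
  have hr00 : 0 < r0 := lt_min (lt_min hr3 hr4) (lt_min hr5 (by positivity))
  filter_upwards [Metric.ball_mem_nhds z hr00] with q hq hqz
  rw [Metric.mem_ball, dist_eq_norm] at hq
  set r : ℝ := ‖q - z‖ with hr
  have hrp : 0 < r := norm_pos_iff.mpr (sub_ne_zero.mpr hqz)
  have g3 : r < r3 := lt_of_lt_of_le hq ((min_le_left _ _).trans (min_le_left _ _))
  have g4 : r < r4 := lt_of_lt_of_le hq ((min_le_left _ _).trans (min_le_right _ _))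
  have g5 : r < r5 := lt_of_lt_of_le hq ((min_le_right _ _).trans (min_le_left _ _))
  have g6 : r < ρ * ‖v‖ := lt_of_lt_of_le hq ((min_le_right _ _).trans (min_le_right _ _))
  obtain ⟨q1, q2, Hq⟩ := H3 r hrp g3
  obtain ⟨q3, q4, Hq'⟩ := H4 r hrp g4
  have hbase : z + (r / ‖v‖ : ℝ) * v ∈ X :=
    ⟨r / ‖v‖, ⟨by positivity, by rwa [div_lt_iff₀ hvn]⟩, rfl⟩
  have hbs : z + (r / ‖v‖ : ℝ) * v ∈ Metric.sphere z r := by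
    rw [mem_sphere_iff_norm, add_sub_cancel_left, norm_mul, Complex.norm_real, Real.norm_eq_abs,
      abs_of_pos (by positivity)]
    field_simp
  have hqs : q ∈ Metric.sphere z r := by rw [mem_sphere_iff_norm]
  have := sphere_bound (sphere_preconn z r) (f := f) (Q := {q1, q2, q3, q4}) Finset.card_le_four
    (by
      intro p hp
      rw [mem_sphere_iff_norm] at hp
      refine h.len_loc fun hpZ => ?_
      have := H5 p (by rw [hp]; exact g5) hpZ
      rw [this] at hp; simp at hp; linarith)
    (by
      intro p hp hpQ
      rw [mem_sphere_iff_norm] at hp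
      simp only [Finset.mem_insert, Finset.mem_singleton, not_or] at hpQ
      refine h.len_const ?_ ?_
      · intro hm; rcases Hq p hm hp with e | e
        · exact hpQ.1 e
        · exact hpQ.2.1 e
      · intro hm; rcases Hq' p hm hp with e | e
        · exact hpQ.2.2.1 e
        · exact hpQ.2.2.2 e) hbs hqs
  rw [const_on hXc hXl hbase hCX] at this
  exact this

lemma c1_compact {Γ : Set ℂ} (hΓ : IsC1JordanCurve Γ) : IsCompact Γ := by
  obtain ⟨γ, ⟨hc, hper, -⟩, -, -, rfl⟩ := hΓ
  rw [← hper.image_Icc Real.two_pi_pos 0]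
  exact isCompact_Icc.image hc

lemma WD.bounded {S S' : Sys n Z} {w : ℂ → List (Fin n)} (h : WD S S' w) (hZ : Z.Finite)
    (hΓ : IsC1JordanCurve S.Γ) (hΓ' : IsC1JordanCurve S'.Γ) :
    ∃ M : ℕ, ∀ z, z ∉ Z → (w z).length ≤ M := by
  obtain ⟨R0, hR0⟩ := ((c1_compact hΓ).union (c1_compact hΓ')).isBounded.subset_closedBall 0
  set R : ℝ := max R0 0 with hR
  have hRn : 0 ≤ R := le_max_right _ _
  have hout : ∀ q : ℂ, R < ‖q‖ → ∀ᶠ p in 𝓝 q, ((w p).length : ℤ) = (w q).length := by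
    intro q hq
    have hq0 : R0 < ‖q‖ := lt_of_le_of_lt (le_max_left _ _) hq
    refine h.len_const ?_ ?_
    · intro hm; have := hR0 (Or.inl hm); simp at this; linarith
    · intro hm; have := hR0 (Or.inr hm); simp at this; linarith
  have hray : IsPreconnected ((fun s : ℝ => (s : ℂ)) '' Ioi R) :=
    isPreconnected_Ioi.image _ (by fun_prop)
  have hinf : ∀ q : ℂ, R < ‖q‖ → ((w q).length : ℤ) = (w ((R + 1 : ℝ) : ℂ)).length := by
    intro q hq
    have h1 := const_on (sphere_preconn 0 ‖q‖) (g := fun q => ((w q).length : ℤ))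
      (fun p hp => hout p (by rw [mem_sphere_zero_iff_norm] at hp; rw [hp]; exact hq))
      (p := q) (q := ((‖q‖ : ℝ) : ℂ)) (by simp) (by simp)
    have h2 := const_on hray (g := fun q => ((w q).length : ℤ))
      (by
        rintro _ ⟨s, hs, rfl⟩
        refine hout _ ?_
        rw [Complex.norm_real, Real.norm_eq_abs]
        exact lt_of_lt_of_le hs (le_abs_self s))
      (p := ((‖q‖ : ℝ) : ℂ)) (q := ((R + 1 : ℝ) : ℂ)) ⟨_, hq, rfl⟩ ⟨R + 1, by simp, rfl⟩
    exact h1.trans h2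
  have hloc : ∀ p : ℂ, ∃ M : ℤ, ∀ᶠ q in 𝓝 p, q ∉ Z → ((w q).length : ℤ) ≤ M := by
    intro p
    by_cases hp : p ∈ Z
    · obtain ⟨M, hM⟩ := h.near_pt hZ hΓ hΓ' hp
      exact ⟨M, hM.mono fun q hq hqZ => hq (fun e => hqZ (e ▸ hp))⟩
    · refine ⟨(w p).length + 4, (h.len_loc hp).mono fun q hq _ => ?_⟩
      rw [abs_le] at hq; omega
  obtain ⟨M, hM⟩ : ∃ M : ℤ, ∀ q ∈ Metric.closedBall (0 : ℂ) R, q ∉ Z → ((w q).length : ℤ) ≤ M := by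
    refine (isCompact_closedBall (0 : ℂ) R).induction_on
      (p := fun s => ∃ M : ℤ, ∀ q ∈ s, q ∉ Z → ((w q).length : ℤ) ≤ M) ⟨0, by simp⟩ ?_ ?_ ?_
    · rintro s t hst ⟨M, hM⟩
      exact ⟨M, fun q hq => hM q (hst hq)⟩
    · rintro s t ⟨M, hM⟩ ⟨M', hM'⟩
      refine ⟨max M M', fun q hq hqZ => ?_⟩
      rcases hq with hq | hq
      · exact (hM q hq hqZ).trans (le_max_left _ _)
      · exact (hM' q hq hqZ).trans (le_max_right _ _)
    · intro x _
      obtain ⟨M, hM⟩ := hloc x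
      exact ⟨_, mem_nhdsWithin_of_mem_nhds hM, M, fun q hq => hq⟩
  refine ⟨(max M (w ((R + 1 : ℝ) : ℂ)).length).toNat, fun q hq => ?_⟩
  by_cases hqR : R < ‖q‖
  · have := hinf q hqR; omega
  · have := hM q (by simpa using hqR) hq; omega

end PG

/-- **Uniqueness of piecewise geodesic `C¹` Jordan curves.** If two `C¹`-smooth Jordan
curves pass through the distinct points `z 1, …, z n` (`n ≥ 3`), are isotopic relative to
these points, and are both piecewise geodesic with respect to them, then they coincide. -/
theorem uniqueness_of_piecewise_geodesic_jordan_curves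
    (n : ℕ) (hn : 3 ≤ n) (z : Fin n → ℂ) (hz : Function.Injective z)
    (Γ Γ' : Set ℂ) (hΓ : IsC1JordanCurve Γ) (hΓ' : IsC1JordanCurve Γ')
    (hzΓ : Set.range z ⊆ Γ) (hzΓ' : Set.range z ⊆ Γ')
    (hiso : IsotopicRel Γ Γ' (Set.range z))
    (hpg : PiecewiseGeodesic Γ (Set.range z))
    (hpg' : PiecewiseGeodesic Γ' (Set.range z)) :
    Γ = Γ' := by
  have key : ∀ G : Set ℂ, IsC1JordanCurve G → ∃ q, q ∉ G := by
    intro G hG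
    by_contra hc
    push Not at hc
    exact noncompact_univ ℂ (Set.eq_univ_of_forall hc ▸ PG.c1_compact hG)
  obtain ⟨S, S', w, rfl, rfl, h⟩ := PG.exists_WD (by omega) hz (PG.c1_compact hΓ).isClosed
    (PG.c1_compact hΓ').isClosed (key _ hΓ) (key _ hΓ') hzΓ hzΓ' hiso hpg hpg'
  obtain ⟨M, hM⟩ := h.bounded (Set.finite_range z) hΓ hΓ'
  exact PG.abstract_uniqueness hn (Set.finite_range z) h hM
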